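/- For every ε > 0 there exist N ∈ ℕ, δ > 0 and C ≥ 1 such that the following holds for every field K which is a finite field 𝔽_{p^n} (uniformly in p and n) or K = ℂ, and for every smooth quadric surface Q ⊆ ℙ³(K), i.e. Q = {[v] ∈ ℙ³(K) : q(v) = 0} for a quadratic form q on K⁴ whose associated symmetric matrix is invertible. Suppose X ⊆ Q and S ⊆ ℙ³(K)∖Q are finite sets with: (1) |X| = |S| ≥ C; (2) |X| < p^{1/N} if char K = p > 0; (3) max{|X ∩ ℓ|, |S ∩ ℓ|} ≤ |X|^{1−ε} for every projective line ℓ ⊆ ℙ³(K). Then |{(x₁,x₂,x₃) ∈ X × X × S : x₁, x₂, x₃ are distinct and collinear}| ≤ |X|^{2−δ}. -/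

import Mathlib

open Matrix Module

universe u

/-- Three points of `ℙ³(K)` are collinear when their representative vectors lie in a common
2-dimensional linear subspace of `K⁴`. -/
def Coll3 {K : Type u} [Field K] (x y z : Projectivization K (Fin 4 → K)) : Prop :=
  finrank K ↥(x.submodule ⊔ y.submodule ⊔ z.submodule) ≤ 2

/-- The conclusion of the quadric orchard theorem over the field `K`, with parameters
`ε, N, δ, C`: for every smooth quadric surface `Q ⊆ ℙ³(K)` (cut out by a quadratic form
with invertible symmetric matrix `B`), finite sets `X ⊆ Q`, `S ⊆ ℙ³(K)∖Q` with
`|X| = |S| ≥ C`, `|X| < p^{1/N}` in characteristic `p > 0`, and with neither `X` nor `S`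
concentrating on projective lines, the number of collinear triples of `X × X × S` is at
most `|X|^{2−δ}`. -/
def QuadricOrchardStatement (K : Type u) [Field K] (ε : ℝ) (N : ℕ) (δ C : ℝ) : Prop :=
  ∀ B : Matrix (Fin 4) (Fin 4) K, B.IsSymm → IsUnit B →
  ∀ X S : Finset (Projectivization K (Fin 4 → K)),
    -- `X ⊆ Q` and `S ⊆ ℙ³(K) ∖ Q`, where `Q = {[v] : vᵀBv = 0}`
    (∀ x ∈ X, x.rep ⬝ᵥ (B *ᵥ x.rep) = 0) →
    (∀ x ∈ S, x.rep ⬝ᵥ (B *ᵥ x.rep) ≠ 0) →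
    -- (1) `1 ≪ |X| = |S|`
    X.card = S.card → C ≤ (X.card : ℝ) →
    -- (2) `|X| < p^{1/N}` if `char K = p > 0`
    (∀ p : ℕ, ringChar K = p → 0 < p → (X.card : ℝ) < (p : ℝ) ^ ((1 : ℝ) / N)) →
    -- (3) neither `X` nor `S` concentrates on a projective line
    (∀ W : Submodule K (Fin 4 → K), finrank K W = 2 →
      (({x : Projectivization K (Fin 4 → K) | x ∈ X ∧ x.submodule ≤ W}.ncard : ℝ) ≤
          (X.card : ℝ) ^ ((1 : ℝ) - ε) ∧
        ({x : Projectivization K (Fin 4 → K) | x ∈ S ∧ x.submodule ≤ W}.ncard : ℝ) ≤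
          (X.card : ℝ) ^ ((1 : ℝ) - ε))) →
    (({t : Projectivization K (Fin 4 → K) × Projectivization K (Fin 4 → K) ×
          Projectivization K (Fin 4 → K) |
        t.1 ∈ X ∧ t.2.1 ∈ X ∧ t.2.2 ∈ S ∧
          t.1 ≠ t.2.1 ∧ t.1 ≠ t.2.2 ∧ t.2.1 ≠ t.2.2 ∧
          Coll3 t.1 t.2.1 t.2.2}.ncard : ℝ) ≤
      (X.card : ℝ) ^ ((2 : ℝ) - δ))

section Pivot

variable {F : Type*} [Field F]

/-- If the multiples `k • 1`, `0 < k ≤ T`, do not vanish, then a set of at most `T` elements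
containing `0` is not stable under a nonzero translation. -/
theorem exists_mem_add_notMem {T : ℕ} (hT : ∀ k : ℕ, 0 < k → k ≤ T → (k : F) ≠ 0)
    {D : Finset F} (hD : D.card ≤ T) (h0 : (0 : F) ∈ D) {a : F} (ha : a ≠ 0) :
    ∃ d ∈ D, d + a ∉ D := by
  by_contra! h
  have hmem : ∀ k : ℕ, (k : F) * a ∈ D := by
    intro k
    induction k with
    | zero => simpa using h0
    | succ k ih =>
      have := h _ ih
      push_cast
      rwa [add_mul, one_mul]
  have hlt : ∀ i j : ℕ, j < T + 1 → i < j → (i : F) * a ≠ (j : F) * a := by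
    intro i j hj hij heq
    have h1 := mul_right_cancel₀ ha heq
    refine hT (j - i) (by omega) (by omega) ?_
    rw [Nat.cast_sub hij.le, h1, sub_self]
  have hinj : Set.InjOn (fun k : ℕ => (k : F) * a) (Finset.range (T + 1) : Set ℕ) := by
    intro i hi j hj hij
    simp only [Finset.coe_range, Set.mem_Iio] at hi hj
    rcases lt_trichotomy i j with h1 | h1 | h1
    · exact absurd hij (hlt i j hj h1)
    · exact h1
    · exact absurd hij.symm (hlt j i hi h1)
  have := Finset.card_le_card_of_injOn _ (fun k _ => hmem k) hinj
  simp at this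
  omega

/-- The pivot argument: some combination `(b₁ - b₂) A + ((a₁ - a₂) + p (b₁ - b₂)) B` has the
maximal number `|A| |B|` of elements. -/
theorem exists_injOn_pivot {T : ℕ} (hT : ∀ k : ℕ, 0 < k → k ≤ T → (k : F) ≠ 0)
    {A B : Finset F} (hcard : A.card ^ 2 * B.card ^ 2 ≤ T) (hA : A.Nonempty)
    (hB : 1 < B.card) {p : F} (hp : p ≠ 0) :
    ∃ a₁ ∈ A, ∃ a₂ ∈ A, ∃ b₁ ∈ B, ∃ b₂ ∈ B,
      Set.InjOn (fun z : F × F => (b₁ - b₂) * z.1 + ((a₁ - a₂) + p * (b₁ - b₂)) * z.2)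
        (A ×ˢ B : Finset (F × F)) := by
  classical
  set D : Finset F := ((A ×ˢ A) ×ˢ B.offDiag).image
    (fun z => (z.1.1 - z.1.2) / (z.2.1 - z.2.2)) with hD
  have hDcard : D.card ≤ T := by
    refine Finset.card_image_le.trans (le_trans ?_ hcard)
    rw [Finset.card_product, Finset.card_product, Finset.offDiag_card, sq, sq]
    exact Nat.mul_le_mul_left _ (Nat.sub_le _ _)
  have hmem : ∀ a₁ ∈ A, ∀ a₂ ∈ A, ∀ b₁ ∈ B, ∀ b₂ ∈ B, b₁ ≠ b₂ →
      (a₁ - a₂) / (b₁ - b₂) ∈ D := by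
    intro a₁ h1 a₂ h2 b₁ h3 b₂ h4 hne
    refine Finset.mem_image.2 ⟨((a₁, a₂), (b₁, b₂)), ?_, rfl⟩
    simp [h1, h2, h3, h4, hne]
  obtain ⟨a, ha⟩ := hA
  obtain ⟨b, hb, b', hb', hbb⟩ := Finset.one_lt_card.1 hB
  have h0 : (0 : F) ∈ D := by simpa using hmem a ha a ha b hb b' hb' hbb
  obtain ⟨d, hd, hdp⟩ := exists_mem_add_notMem hT hDcard h0 hp
  obtain ⟨⟨⟨a₁, a₂⟩, ⟨b₁, b₂⟩⟩, hz, rfl⟩ := Finset.mem_image.1 hd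
  simp only [Finset.mem_product, Finset.mem_offDiag] at hz
  obtain ⟨⟨h1, h2⟩, h3, h4, hne⟩ := hz
  refine ⟨a₁, h1, a₂, h2, b₁, h3, b₂, h4, ?_⟩
  rintro ⟨x, y⟩ hx ⟨x', y'⟩ hx' heq
  simp only [Finset.coe_product, Set.mem_prod, Finset.mem_coe] at hx hx' heq
  have hb0 : b₁ - b₂ ≠ 0 := sub_ne_zero.2 hne
  by_cases hy : y = y'
  · subst hy
    have : (b₁ - b₂) * x = (b₁ - b₂) * x' := by linear_combination heq
    simp [mul_left_cancel₀ hb0 this]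
  · exfalso
    apply hdp
    have hy0 : y - y' ≠ 0 := sub_ne_zero.2 hy
    have : (a₁ - a₂) / (b₁ - b₂) + p = (x' - x) / (y - y') := by
      field_simp
      linear_combination heq
    simp only [this]
    exact hmem x' hx'.1 x hx.1 y hx.2 y' hx'.2 hy

end Pivot

section Counting

open Finset

/-- Cauchy–Schwarz for the fibres of a map. -/
theorem card_sq_le_card_mul_card_collisions {α β : Type*} [DecidableEq α] [DecidableEq β]
    {s : Finset α} {t : Finset β} {f : α → β} (hf : ∀ x ∈ s, f x ∈ t) :
    s.card ^ 2 ≤ t.card * #{p ∈ s ×ˢ s | f p.1 = f p.2} := by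
  have h1 : s.card = ∑ b ∈ t, #{a ∈ s | f a = b} := card_eq_sum_card_fiberwise hf
  have h2 : #{p ∈ s ×ˢ s | f p.1 = f p.2} = ∑ b ∈ t, #{a ∈ s | f a = b} ^ 2 := by
    rw [card_eq_sum_card_fiberwise (f := fun p : α × α => f p.1) (t := t)]
    · refine sum_congr rfl fun b _ => ?_
      rw [sq, ← card_product]
      congr 1
      ext ⟨x, y⟩
      simp only [mem_filter, mem_product]
      constructor
      · rintro ⟨⟨⟨hx, hy⟩, h⟩, rfl⟩
        exact ⟨⟨hx, rfl⟩, hy, h.symm⟩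
      · rintro ⟨⟨hx, rfl⟩, hy, h⟩
        exact ⟨⟨⟨hx, hy⟩, h.symm⟩, rfl⟩
    · intro p hp
      simp only [coe_filter, mem_product, Set.mem_ofPred_eq] at hp
      exact hf _ hp.1.1
  rw [h1, h2]
  exact sq_sum_le_card_mul_sum_sq

/-- A map all of whose fibres over `t` have at least `c` elements in `s`. -/
theorem card_mul_le_card_of_fiber {α β : Type*} [DecidableEq β]
    {s : Finset α} {t : Finset β} {f : α → β} {c : ℝ}
    (h : ∀ b ∈ t, c ≤ (#{a ∈ s | f a = b} : ℝ)) : (t.card : ℝ) * c ≤ s.card := by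
  calc (t.card : ℝ) * c = ∑ b ∈ t, c := by simp
    _ ≤ ∑ b ∈ t, (#{a ∈ s | f a = b} : ℝ) := sum_le_sum h
    _ = ((∑ b ∈ t, #{a ∈ s | f a = b} : ℕ) : ℝ) := by push_cast; rfl
    _ ≤ s.card := by
      have := sum_card_fiberwise_eq_card_filter s t f
      rw [this]
      exact_mod_cast card_filter_le _ _

/-- Double counting. -/
theorem sum_card_filter_comm {α β : Type*} (s : Finset α) (t : Finset β) (R : α → β → Prop)
    [∀ a b, Decidable (R a b)] :
    ∑ a ∈ s, #{b ∈ t | R a b} = ∑ b ∈ t, #{a ∈ s | R a b} := by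
  simp only [card_filter]
  exact sum_comm

set_option maxHeartbeats 1000000 in
/-- In a dense graph, many vertices are pairwise joined by many paths of length four. -/
theorem exists_subset_many_paths {α : Type*} [DecidableEq α] {A : Finset α} (hA : A.Nonempty)
    (r : α → α → Prop) [DecidableRel r] {k : ℝ} (hk : 2 ≤ k)
    (hr : (#A : ℝ) ^ 2 ≤ k * #{p ∈ A ×ˢ A | r p.1 p.2}) :
    ∃ A' ⊆ A, (#A : ℝ) ≤ k ^ 3 * #A' ∧ ∀ a ∈ A', ∀ c ∈ A',
      (#A : ℝ) ^ 3 ≤ k ^ 17 *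
        #{p ∈ A ×ˢ A ×ˢ A | r a p.1 ∧ r p.2.1 p.1 ∧ r p.2.1 p.2.2 ∧ r c p.2.2} := by
  classical
  have hk0 : 0 < k := by linarith
  set N : α → Finset α := fun b => {a ∈ A | r a b} with hN
  set codeg : α → α → ℕ := fun a c => #{b ∈ A | r a b ∧ r c b} with hcodeg
  set bad : α → α → Prop := fun a c => k ^ 7 * (codeg a c : ℝ) < #A with hbad
  have hn0 : (0 : ℝ) < #A := by exact_mod_cast hA.card_pos
  have hsum1 : ∑ b ∈ A, (#(N b) : ℝ) = #{p ∈ A ×ˢ A | r p.1 p.2} := by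
    have : ∑ b ∈ A, #(N b) = #{p ∈ A ×ˢ A | r p.1 p.2} := by
      rw [card_filter, sum_product_right]
      simp only [hN, card_filter]
    exact_mod_cast this
  have hsum2 : (#A : ℝ) ^ 3 ≤ k ^ 2 * ∑ b ∈ A, (#(N b) : ℝ) ^ 2 := by
    have h1 : (∑ b ∈ A, (#(N b) : ℝ)) ^ 2 ≤ #A * ∑ b ∈ A, (#(N b) : ℝ) ^ 2 :=
      sq_sum_le_card_mul_sum_sq
    rw [← hsum1] at hr
    have h2 : ((#A : ℝ) ^ 2) ^ 2 ≤ (k * ∑ b ∈ A, (#(N b) : ℝ)) ^ 2 :=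
      pow_le_pow_left₀ (by positivity) hr 2
    have h3 : (#A : ℝ) * (#A : ℝ) ^ 3 ≤ #A * (k ^ 2 * ∑ b ∈ A, (#(N b) : ℝ) ^ 2) := by
      nlinarith [mul_le_mul_of_nonneg_left h1 (sq_nonneg k)]
    exact le_of_mul_le_mul_left h3 hn0
  have hsum3 : k ^ 7 * ∑ b ∈ A, (#{p ∈ N b ×ˢ N b | bad p.1 p.2} : ℝ) ≤ (#A : ℝ) ^ 3 := by
    have h1 : ∑ b ∈ A, (#{p ∈ N b ×ˢ N b | bad p.1 p.2} : ℝ)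
        = ∑ p ∈ A ×ˢ A with bad p.1 p.2, (codeg p.1 p.2 : ℝ) := by
      have h2 : ∑ b ∈ A, #{p ∈ N b ×ˢ N b | bad p.1 p.2}
        = ∑ p ∈ A ×ˢ A with bad p.1 p.2, codeg p.1 p.2 := by
        rw [← sum_card_filter_comm A {p ∈ A ×ˢ A | bad p.1 p.2}
          (fun b p => r p.1 b ∧ r p.2 b)]
        refine sum_congr rfl fun b _ => congrArg _ ?_
        ext ⟨x, y⟩
        simp only [hN, mem_filter, mem_product]
        tauto
      exact_mod_cast h2
    rw [h1, mul_sum]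
    calc ∑ p ∈ A ×ˢ A with bad p.1 p.2, k ^ 7 * (codeg p.1 p.2 : ℝ)
        ≤ ∑ p ∈ A ×ˢ A with bad p.1 p.2, (#A : ℝ) :=
          sum_le_sum fun p hp => (mem_filter.1 hp).2.le
      _ ≤ ∑ p ∈ A ×ˢ A, (#A : ℝ) :=
          sum_le_sum_of_subset_of_nonneg (filter_subset _ _) fun _ _ _ => hn0.le
      _ = (#A : ℝ) ^ 3 := by
          rw [sum_const, card_product, nsmul_eq_mul]
          push_cast
          ring
  obtain ⟨b, hb, hNb⟩ : ∃ b ∈ A, (#A : ℝ) ^ 2 ≤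
      k ^ 3 * ((#(N b) : ℝ) ^ 2 - 16 * #{p ∈ N b ×ˢ N b | bad p.1 p.2}) := by
    refine exists_le_of_sum_le hA ?_
    rw [← mul_sum, sum_sub_distrib, ← mul_sum, sum_const, nsmul_eq_mul]
    have hs3 : 0 ≤ ∑ b ∈ A, (#{p ∈ N b ×ˢ N b | bad p.1 p.2} : ℝ) :=
      sum_nonneg fun _ _ => Nat.cast_nonneg _
    generalize ∑ b ∈ A, (#(N b) : ℝ) ^ 2 = s2 at *
    generalize ∑ b ∈ A, (#{p ∈ N b ×ˢ N b | bad p.1 p.2} : ℝ) = s3 at *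
    have h16 : 16 * s3 * k ^ 3 ≤ (#A : ℝ) ^ 3 := by
      have : (16 : ℝ) ≤ k ^ 4 := by
        calc (16 : ℝ) = 2 ^ 4 := by norm_num
          _ ≤ k ^ 4 := pow_le_pow_left₀ (by norm_num) hk 4
      calc 16 * s3 * k ^ 3 ≤ k ^ 4 * s3 * k ^ 3 := by gcongr
        _ = k ^ 7 * s3 := by ring
        _ ≤ _ := hsum3
    have : k * (#A : ℝ) ^ 3 ≤ k ^ 3 * s2 := by
      calc k * (#A : ℝ) ^ 3 ≤ k * (k ^ 2 * s2) := by gcongr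
        _ = _ := by ring
    nlinarith [mul_le_mul_of_nonneg_right hk (pow_nonneg hn0.le 3)]
  set M := N b with hM
  set β : ℝ := Nat.cast (#{p ∈ M ×ˢ M | bad p.1 p.2}) with hβ
  have hβ0 : 0 ≤ β := Nat.cast_nonneg _
  have hMA : M ⊆ A := filter_subset _ _
  have hM0 : (0 : ℝ) ≤ #M := Nat.cast_nonneg _
  have hM2 : (#A : ℝ) ^ 2 ≤ k ^ 3 * (#M : ℝ) ^ 2 := by
    nlinarith [mul_nonneg (pow_nonneg hk0.le 3) hβ0]
  have hM1 : (#A : ℝ) ≤ k ^ 2 * #M := by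
    refine (pow_le_pow_iff_left₀ hn0.le (by positivity) two_ne_zero).1 ?_
    calc (#A : ℝ) ^ 2 ≤ k ^ 3 * (#M : ℝ) ^ 2 := hM2
      _ ≤ k ^ 4 * (#M : ℝ) ^ 2 := by
        gcongr
        · linarith
        · norm_num
      _ = _ := by ring
  have hMpos : (0 : ℝ) < #M := by
    by_contra h
    have : (#M : ℝ) = 0 := le_antisymm (not_lt.1 h) hM0
    rw [this] at hM1
    linarith
  have hβM : 16 * β ≤ (#M : ℝ) ^ 2 := by
    have h1 : 0 < k ^ 3 * ((#M : ℝ) ^ 2 - 16 * β) := lt_of_lt_of_le (by positivity) hNb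
    have := pos_of_mul_pos_right h1 (by positivity)
    linarith
  set A' : Finset α := {a ∈ M | 4 * #{c ∈ M | bad a c} ≤ #M} with hA'
  have hbadc : (#M : ℝ) * #{a ∈ M | ¬ 4 * #{c ∈ M | bad a c} ≤ #M} ≤ 4 * β := by
    have h1 : #{p ∈ M ×ˢ M | bad p.1 p.2} = ∑ a ∈ M, #{c ∈ M | bad a c} := by
      rw [card_filter, sum_product]
      simp only [card_filter]
    rw [hβ, h1]
    calc (#M : ℝ) * #{a ∈ M | ¬ 4 * #{c ∈ M | bad a c} ≤ #M}
        = ∑ a ∈ M with ¬ 4 * #{c ∈ M | bad a c} ≤ #M, (#M : ℝ) := by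
          rw [sum_const, nsmul_eq_mul, mul_comm]
      _ ≤ ∑ a ∈ M with ¬ 4 * #{c ∈ M | bad a c} ≤ #M, (4 * #{c ∈ M | bad a c} : ℝ) := by
          refine sum_le_sum fun a ha => ?_
          exact_mod_cast (not_le.1 (mem_filter.1 ha).2).le
      _ ≤ ∑ a ∈ M, (4 * #{c ∈ M | bad a c} : ℝ) :=
          sum_le_sum_of_subset_of_nonneg (filter_subset _ _) fun _ _ _ =>
            mul_nonneg (by norm_num) (Nat.cast_nonneg _)
      _ = _ := by push_cast; rw [mul_sum]
  have hA'card : (#M : ℝ) ≤ 2 * #A' := by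
    have h1 : #A' + #{a ∈ M | ¬ 4 * #{c ∈ M | bad a c} ≤ #M} = #M :=
      card_filter_add_card_filter_not _
    have h2 : (#A' : ℝ) + #{a ∈ M | ¬ 4 * #{c ∈ M | bad a c} ≤ #M} = #M := by
      exact_mod_cast h1
    nlinarith
  refine ⟨A', (filter_subset _ _).trans hMA, ?_, ?_⟩
  · calc (#A : ℝ) ≤ k ^ 2 * #M := hM1
      _ ≤ k ^ 2 * (2 * #A') := by gcongr
      _ ≤ k ^ 2 * (k * #A') := by gcongr
      _ = _ := by ring
  · intro a ha c hc
    have ha2 := (mem_filter.1 ha).2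
    have hc2 := (mem_filter.1 hc).2
    set good : Finset α := {x ∈ M | ¬ bad a x ∧ ¬ bad c x} with hgood
    have hgoodc : (#M : ℝ) ≤ 2 * #good := by
      have h1 : M ⊆ good ∪ {x ∈ M | bad a x} ∪ {x ∈ M | bad c x} := by
        intro x hx
        simp only [hgood, mem_union, mem_filter]
        tauto
      have h2 := (card_le_card h1).trans ((card_union_le _ _).trans
        (Nat.add_le_add_right (card_union_le _ _) _))
      have : #M ≤ 2 * #good := by omega
      exact_mod_cast this
    have hcount : ∑ x ∈ good, codeg a x * codeg c x ≤
        #{p ∈ A ×ˢ A ×ˢ A | r a p.1 ∧ r p.2.1 p.1 ∧ r p.2.1 p.2.2 ∧ r c p.2.2} := by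
      have h1 : ∀ x, codeg a x * codeg c x =
          #({y ∈ A | r a y ∧ r x y} ×ˢ {y ∈ A | r c y ∧ r x y}) := by
        intro x
        rw [card_product]
      simp only [h1]
      rw [← card_sigma]
      refine card_le_card_of_injOn (fun z => (z.2.1, z.1, z.2.2)) ?_ ?_
      · rintro ⟨x, y, z⟩ h
        simp only [coe_sigma, Set.mem_sigma_iff, mem_coe, mem_product, mem_filter] at h
        simp only [mem_coe, mem_filter, mem_product]
        exact ⟨⟨h.2.1.1, hMA (mem_filter.1 h.1).1, h.2.2.1⟩, h.2.1.2.1, h.2.1.2.2,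
          h.2.2.2.2, h.2.2.2.1⟩
      · rintro ⟨x, y, z⟩ _ ⟨x', y', z'⟩ _ h
        simp only [Prod.mk.injEq] at h
        obtain ⟨rfl, rfl, rfl⟩ := h
        rfl
    have hlow : (#good : ℝ) * (#A : ℝ) ^ 2 ≤ k ^ 14 * ∑ x ∈ good, (codeg a x * codeg c x : ℝ) := by
      rw [mul_sum, ← nsmul_eq_mul]
      refine card_nsmul_le_sum _ _ _ fun x hx => ?_
      obtain ⟨_, hx1, hx2⟩ := mem_filter.1 hx
      have hx1 := not_lt.1 hx1
      have hx2 := not_lt.1 hx2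
      calc (#A : ℝ) ^ 2 = #A * #A := sq _
        _ ≤ (k ^ 7 * codeg a x) * (k ^ 7 * codeg c x) := by gcongr
        _ = _ := by ring
    have hcount' : ∑ x ∈ good, (codeg a x * codeg c x : ℝ) ≤
        #{p ∈ A ×ˢ A ×ˢ A | r a p.1 ∧ r p.2.1 p.1 ∧ r p.2.1 p.2.2 ∧ r c p.2.2} := by
      exact_mod_cast hcount
    calc (#A : ℝ) ^ 3 = #A * (#A : ℝ) ^ 2 := by ring
      _ ≤ (k ^ 2 * #M) * (#A : ℝ) ^ 2 := by gcongr
      _ ≤ (k ^ 2 * (2 * #good)) * (#A : ℝ) ^ 2 := by gcongr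
      _ ≤ (k ^ 2 * (k * #good)) * (#A : ℝ) ^ 2 := by gcongr
      _ = k ^ 3 * (#good * (#A : ℝ) ^ 2) := by ring
      _ ≤ k ^ 3 * (k ^ 14 * ∑ x ∈ good, (codeg a x * codeg c x : ℝ)) := by gcongr
      _ ≤ k ^ 3 * (k ^ 14 *
          #{p ∈ A ×ˢ A ×ˢ A | r a p.1 ∧ r p.2.1 p.1 ∧ r p.2.1 p.2.2 ∧ r c p.2.2}) := by gcongr
      _ = _ := by ring

end Counting

section SmallDoubling

open Finset Pointwise

variable {G : Type*} [Group G] [DecidableEq G]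

/-- The Balog–Szemerédi–Gowers theorem. -/
theorem exists_subset_card_mul_inv_le {A R : Finset G} (hA : A.Nonempty) {k : ℝ} (hk : 2 ≤ k)
    (hR : (#R : ℝ) ≤ k * #A) (hE : (#A : ℝ) ^ 2 ≤ k * #{p ∈ A ×ˢ A | p.1 * p.2⁻¹ ∈ R}) :
    ∃ A' ⊆ A, (#A : ℝ) ≤ k ^ 3 * #A' ∧ (#(A' * A'⁻¹) : ℝ) ≤ k ^ 24 * #A' := by
  have hk0 : 0 < k := by linarith
  have hn0 : (0 : ℝ) < #A := by exact_mod_cast hA.card_pos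
  obtain ⟨A', hA', hc, hpath⟩ := exists_subset_many_paths hA (fun a b => a * b⁻¹ ∈ R) hk hE
  refine ⟨A', hA', hc, ?_⟩
  have key : (#(A' * A'⁻¹) : ℝ) * ((#A : ℝ) ^ 3 / k ^ 17) ≤ #(R ×ˢ R ×ˢ R ×ˢ R) := by
    refine card_mul_le_card_of_fiber
      (f := fun z : G × G × G × G => z.1 * z.2.1⁻¹ * z.2.2.1 * z.2.2.2⁻¹) ?_
    intro z hz
    obtain ⟨a, ha, c', hc', rfl⟩ := mem_mul.1 hz
    have hc := mem_inv'.1 hc'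
    rw [div_le_iff₀' (by positivity)]
    refine (hpath a ha c'⁻¹ hc).trans ?_
    gcongr
    refine card_le_card_of_injOn
      (fun p => (a * p.1⁻¹, p.2.1 * p.1⁻¹, p.2.1 * p.2.2⁻¹, c'⁻¹ * p.2.2⁻¹)) ?_ ?_
    · rintro ⟨b, a', b'⟩ h
      simp only [coe_filter, mem_product, Set.mem_ofPred_eq] at h ⊢
      refine ⟨⟨h.2.1, h.2.2.1, h.2.2.2.1, h.2.2.2.2⟩, ?_⟩
      group
    · rintro ⟨b, a', b'⟩ _ ⟨c, d, c''⟩ _ h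
      simp only [Prod.mk.injEq, mul_right_inj, _root_.inv_inj] at h
      obtain ⟨rfl, h1, h2, rfl⟩ := h
      rw [mul_left_inj] at h1
      rw [h1]
  have hR4 : (#(R ×ˢ R ×ˢ R ×ˢ R) : ℝ) ≤ (k * #A) ^ 4 := by
    simp only [card_product]
    push_cast
    calc (#R : ℝ) * (#R * (#R * #R)) = (#R : ℝ) ^ 4 := by ring
      _ ≤ _ := by gcongr
  have h1 : (#(A' * A'⁻¹) : ℝ) * (#A : ℝ) ^ 3 ≤ (k ^ 21 * #A) * (#A : ℝ) ^ 3 := by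
    have := key.trans hR4
    rw [mul_div_assoc', div_le_iff₀ (by positivity)] at this
    calc _ ≤ _ := this
      _ = _ := by ring
  have h2 := le_of_mul_le_mul_right h1 (by positivity)
  calc _ ≤ _ := h2
    _ ≤ k ^ 21 * (k ^ 3 * #A') := by gcongr
    _ = _ := by ring

set_option maxHeartbeats 2000000 in
/-- A set of small doubling is controlled by an approximate group. -/
theorem exists_approximateSubgroup {A : Finset G} (hA : A.Nonempty) {k : ℝ} (hk : 2 ≤ k)
    (hd : (#(A * A⁻¹) : ℝ) ≤ k * #A) :
    ∃ H : Finset G, ∃ y ∈ A, (1 : G) ∈ H ∧ H⁻¹ = H ∧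
      (∀ m : ℕ, (#(H ^ m) : ℝ) ≤ k ^ (3 * m + 3) * #H) ∧
      (#H : ℝ) ≤ k ^ 2 * #A ∧ (#A : ℝ) ≤ k ^ 2 * #{x ∈ A | y⁻¹ * x ∈ H} := by
  have hk0 : 0 < k := by linarith
  have hn0 : (0 : ℝ) < #A := by exact_mod_cast hA.card_pos
  have h2k : 2 * k ≤ k ^ 2 := by nlinarith
  set r : G → ℕ := fun h => #{p ∈ A ×ˢ A | p.2⁻¹ * p.1 = h} with hr
  set H : Finset G := {h ∈ A⁻¹ * A | (#A : ℝ) ≤ 2 * k * r h} with hH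
  have hr_le : ∀ h, r h ≤ #A := by
    intro h
    refine card_le_card_of_injOn (fun p => p.1) ?_ ?_
    · rintro ⟨x, y⟩ h
      simp only [coe_filter, mem_product, Set.mem_ofPred_eq] at h
      exact h.1.1
    · rintro ⟨x, y⟩ h1 ⟨x', y'⟩ h2 h3
      simp only [coe_filter, mem_product, Set.mem_ofPred_eq] at h1 h2 h3
      subst h3
      have := h1.2.trans h2.2.symm
      simp only [mul_left_inj, _root_.inv_inj] at this
      rw [this]
  have hr_inv : ∀ h, r h⁻¹ = r h := by
    intro h
    refine card_bij' (fun p _ => (p.2, p.1)) (fun p _ => (p.2, p.1)) ?_ ?_ ?_ ?_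
    · rintro ⟨x, y⟩ hp
      simp only [mem_filter, mem_product] at hp ⊢
      refine ⟨hp.1.symm, ?_⟩
      rw [← _root_.inv_inj, ← hp.2]
      group
    · rintro ⟨x, y⟩ hp
      simp only [mem_filter, mem_product] at hp ⊢
      refine ⟨hp.1.symm, ?_⟩
      rw [← hp.2]
      group
    · intros; rfl
    · intros; rfl
  have hr_one : r 1 = #A := by
    refine le_antisymm (hr_le 1) ?_
    refine card_le_card_of_injOn (fun x => (x, x)) ?_ ?_
    · intro x hx
      simpa using hx
    · intro x _ y _ h
      exact (Prod.mk.inj h).1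
  have hpos : ∀ h, (#A : ℝ) ≤ 2 * k * r h → h ∈ H := by
    intro h hh
    refine mem_filter.2 ⟨?_, hh⟩
    have : 0 < r h := by
      by_contra h0
      rw [Nat.eq_zero_of_not_pos h0] at hh
      simp at hh
      simp [hh] at hn0
    obtain ⟨⟨x, y⟩, hp⟩ := card_pos.1 this
    simp only [mem_filter, mem_product] at hp
    exact mem_mul.2 ⟨_, inv_mem_inv hp.1.2, _, hp.1.1, hp.2⟩
  have hHr : ∀ h ∈ H, (#A : ℝ) ≤ 2 * k * r h := fun h hh => (mem_filter.1 hh).2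
  have h1H : (1 : G) ∈ H := by
    apply hpos
    rw [hr_one]
    nlinarith
  have hHinv : H⁻¹ = H := by
    have : ∀ h ∈ H, h⁻¹ ∈ H := fun h hh => hpos _ (by rw [hr_inv]; exact hHr h hh)
    ext h
    rw [mem_inv']
    exact ⟨fun hh => by simpa using this _ hh, this h⟩
  have henergy : (#A : ℝ) ^ 3 ≤ k * ∑ p ∈ A ×ˢ A, (r (p.2⁻¹ * p.1) : ℝ) := by
    have h1 := card_sq_le_card_mul_card_collisions (s := A ×ˢ A) (t := A * A⁻¹)
      (f := fun p => p.1 * p.2⁻¹) (fun p hp => by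
        obtain ⟨h1, h2⟩ := mem_product.1 hp
        exact mul_mem_mul h1 (inv_mem_inv h2))
    have h2 : #{q ∈ (A ×ˢ A) ×ˢ (A ×ˢ A) | q.1.1 * q.1.2⁻¹ = q.2.1 * q.2.2⁻¹} ≤
        ∑ p ∈ A ×ˢ A, r (p.2⁻¹ * p.1) := by
      simp only [hr]
      rw [← card_sigma]
      refine card_le_card_of_injOn (fun q => ⟨(q.1.1, q.2.1), (q.1.2, q.2.2)⟩) ?_ ?_
      · rintro ⟨⟨x, y⟩, ⟨x', y'⟩⟩ h
        simp only [coe_filter, mem_product, Set.mem_ofPred_eq] at h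
        simp only [mem_coe, mem_sigma, mem_product, mem_filter]
        refine ⟨⟨h.1.1.1, h.1.2.1⟩, ⟨h.1.1.2, h.1.2.2⟩, ?_⟩
        have : x = x' * y'⁻¹ * y := by rw [← h.2]; group
        rw [this]
        group
      · rintro ⟨⟨x, y⟩, ⟨x', y'⟩⟩ _ ⟨⟨a, b⟩, ⟨a', b'⟩⟩ _ h
        simp only [Sigma.mk.injEq, heq_eq_eq, Prod.mk.injEq] at h
        obtain ⟨⟨rfl, rfl⟩, rfl, rfl⟩ := h
        rfl
    have h3 : ((#A : ℝ) ^ 2) ^ 2 ≤ #(A * A⁻¹) * ∑ p ∈ A ×ˢ A, (r (p.2⁻¹ * p.1) : ℝ) := by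
      have h4 := h1.trans (Nat.mul_le_mul_left _ h2)
      rw [card_product, ← sq] at h4
      exact_mod_cast h4
    have h5 : 0 ≤ ∑ p ∈ A ×ˢ A, (r (p.2⁻¹ * p.1) : ℝ) :=
      sum_nonneg fun _ _ => Nat.cast_nonneg _
    generalize ∑ p ∈ A ×ˢ A, (r (p.2⁻¹ * p.1) : ℝ) = e at *
    have h6 : (#A : ℝ) * (#A : ℝ) ^ 3 ≤ #A * (k * e) := by
      calc (#A : ℝ) * (#A : ℝ) ^ 3 = ((#A : ℝ) ^ 2) ^ 2 := by ring
        _ ≤ _ := h3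
        _ ≤ (k * #A) * e := by gcongr
        _ = _ := by ring
    exact le_of_mul_le_mul_left h6 hn0
  have hpairs : (#A : ℝ) ^ 2 ≤ 2 * k * #{p ∈ A ×ˢ A | p.2⁻¹ * p.1 ∈ H} := by
    have h1 : ∑ p ∈ A ×ˢ A, (r (p.2⁻¹ * p.1) : ℝ) ≤
        ∑ p ∈ A ×ˢ A, ((if p.2⁻¹ * p.1 ∈ H then (#A : ℝ) else 0) + #A / (2 * k)) := by
      refine sum_le_sum fun p _ => ?_
      split_ifs with h
      · have : (r (p.2⁻¹ * p.1) : ℝ) ≤ #A := by exact_mod_cast hr_le _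
        have h0 : 0 ≤ (#A : ℝ) / (2 * k) := by positivity
        linarith
      · rw [zero_add, le_div_iff₀ (by positivity)]
        have := fun hh => h (hpos _ hh)
        have := (not_le.1 this).le
        linarith
    rw [sum_add_distrib, ← sum_filter, sum_const, sum_const, card_product, nsmul_eq_mul,
      nsmul_eq_mul] at h1
    push_cast at h1
    have h2 := mul_le_mul_of_nonneg_left h1 hk0.le
    have h3 : k * ((#A : ℝ) * #A * (#A / (2 * k))) = #A ^ 3 / 2 := by
      field_simp
    rw [mul_add, h3] at h2
    have h4 : (#A : ℝ) * (#A : ℝ) ^ 2 ≤ #A * (2 * k * #{p ∈ A ×ˢ A | p.2⁻¹ * p.1 ∈ H}) := by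
      nlinarith
    exact le_of_mul_le_mul_left h4 hn0
  obtain ⟨y, hy, hyA⟩ : ∃ y ∈ A, (#A : ℝ) ≤ 2 * k * #{x ∈ A | y⁻¹ * x ∈ H} := by
    refine exists_le_of_sum_le hA ?_
    rw [← mul_sum, sum_const, nsmul_eq_mul, ← sq]
    have : #{p ∈ A ×ˢ A | p.2⁻¹ * p.1 ∈ H} = ∑ y ∈ A, #{x ∈ A | y⁻¹ * x ∈ H} := by
      rw [card_filter, sum_product_right]
      simp only [card_filter]
    rw [this] at hpairs
    exact_mod_cast hpairs
  have hAH : (#A : ℝ) ≤ 2 * k * #H := by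
    refine hyA.trans (mul_le_mul_of_nonneg_left ?_ (by positivity))
    refine Nat.cast_le.2 ?_
    refine card_le_card_of_injOn (fun x => y⁻¹ * x) ?_ ?_
    · intro x hx
      exact (mem_filter.1 hx).2
    · intro x _ x' _ h
      exact mul_left_cancel h
  have hHA : (#H : ℝ) ≤ 2 * k * #A := by
    have h1 : (#H : ℝ) * (#A / (2 * k)) ≤ #(A ×ˢ A) := by
      refine card_mul_le_card_of_fiber (f := fun p : G × G => p.2⁻¹ * p.1) fun h hh => ?_
      rw [div_le_iff₀' (by positivity)]
      exact hHr h hh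
    rw [mul_div_assoc', div_le_iff₀ (by positivity), card_product] at h1
    push_cast at h1
    have h4 : (#H : ℝ) * #A ≤ (2 * k * #A) * #A := by linarith
    exact le_of_mul_le_mul_right h4 hn0
  have hgrow : ∀ m : ℕ, (#(A * H ^ m * A⁻¹) : ℝ) ≤ k ^ (3 * m + 1) * #A := by
    intro m
    induction m with
    | zero => simpa using hd
    | succ m ih =>
      have h1 : (#(A * H ^ (m + 1) * A⁻¹) : ℝ) * (#A / (2 * k)) ≤
          #((A * H ^ m * A⁻¹) ×ˢ (A * A⁻¹)) := by
        refine card_mul_le_card_of_fiber (f := fun p : G × G => p.1 * p.2) fun z hz => ?_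
        rw [div_le_iff₀' (by positivity)]
        obtain ⟨w, hw, b, hb, rfl⟩ := mem_mul.1 hz
        rw [pow_succ, ← mul_assoc] at hw
        obtain ⟨v, hv, h, hh, rfl⟩ := mem_mul.1 hw
        refine (hHr h hh).trans ?_
        gcongr
        refine card_le_card_of_injOn (fun p => (v * p.2⁻¹, p.1 * b)) ?_ ?_
        · rintro ⟨x, y⟩ hp
          simp only [coe_filter, mem_product, Set.mem_ofPred_eq] at hp ⊢
          refine ⟨⟨mul_mem_mul hv (inv_mem_inv hp.1.2), mul_mem_mul hp.1.1 hb⟩, ?_⟩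
          rw [← hp.2]
          group
        · rintro ⟨x, y⟩ _ ⟨x', y'⟩ _ h
          simp only [Prod.mk.injEq, mul_right_inj, _root_.inv_inj, mul_left_inj] at h
          simp [h]
      rw [card_product, mul_div_assoc', div_le_iff₀ (by positivity)] at h1
      push_cast at h1
      have h2 : (#(A * H ^ (m + 1) * A⁻¹) : ℝ) * #A ≤ (k ^ (3 * (m + 1) + 1) * #A) * #A := by
        calc _ ≤ _ := h1
          _ ≤ (k ^ (3 * m + 1) * #A) * (k * #A) * (k ^ 2) := by gcongr
          _ = _ := by ring
      exact le_of_mul_le_mul_right h2 hn0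
  refine ⟨H, y, hy, h1H, hHinv, fun m => ?_, hHA.trans (by gcongr), hyA.trans (by gcongr)⟩
  have h1 : (#(H ^ m) : ℝ) ≤ #(A * H ^ m * A⁻¹) := by
    have := (card_le_card_mul_left hA (t := H ^ m)).trans
      (card_le_card_mul_right (s := A * H ^ m) hA.inv)
    exact_mod_cast this
  calc _ ≤ _ := h1
    _ ≤ _ := hgrow m
    _ ≤ k ^ (3 * m + 1) * (2 * k * #H) := by gcongr
    _ ≤ k ^ (3 * m + 1) * (k ^ 2 * #H) := by gcongr
    _ = _ := by ring

end SmallDoubling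

section Weighted

open Finset Pointwise

variable {G : Type*} [Group G] [DecidableEq G] {ι : Type*} [Fintype ι]

/-- The number of representations of `x` as a quotient of two values of `φ` is at most the
number of coincidences of `φ`. -/
theorem card_quotient_le_card_collisions (φ : ι → G) (x : G) :
    #{p : ι × ι | φ p.1 * (φ p.2)⁻¹ = x} ≤ #{p : ι × ι | φ p.1 = φ p.2} := by
  set im := (univ : Finset ι).image φ with him
  set f : G → ℕ := fun g => #{ω | φ ω = g} with hf
  have hfim : ∀ g, f g ≠ 0 → g ∈ im := by
    intro g hg
    obtain ⟨ω, hω⟩ := card_pos.1 (Nat.pos_of_ne_zero hg)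
    exact mem_image.2 ⟨ω, mem_univ _, (mem_filter.1 hω).2⟩
  have h1 : ∀ y : G, #{p : ι × ι | φ p.1 * (φ p.2)⁻¹ = y} = ∑ g ∈ im, f (y * g) * f g := by
    intro y
    rw [card_eq_sum_card_fiberwise (f := fun p : ι × ι => φ p.2) (t := im)
      (fun p _ => mem_image_of_mem _ (mem_univ _))]
    refine sum_congr rfl fun g _ => ?_
    rw [hf, ← card_product]
    congr 1
    ext ⟨a, b⟩
    simp only [mem_filter, mem_product, mem_univ, true_and]
    constructor
    · rintro ⟨h, rfl⟩
      exact ⟨by rw [← h]; group, rfl⟩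
    · rintro ⟨h, rfl⟩
      exact ⟨by rw [h]; group, rfl⟩
  have h2 : #{p : ι × ι | φ p.1 = φ p.2} = ∑ g ∈ im, f g ^ 2 := by
    have := h1 1
    simp only [mul_inv_eq_one, one_mul, ← sq] at this
    exact this
  have h3 : ∑ g ∈ im, f (x * g) ^ 2 ≤ ∑ g ∈ im, f g ^ 2 := by
    rw [← sum_image (f := fun g => f g ^ 2) (g := fun g => x * g) (s := im)
      (fun a _ b _ h => mul_left_cancel h)]
    refine sum_le_sum_of_ne_zero fun g _ hg => hfim g fun h0 => hg (by simp [h0])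
  rw [h1, h2]
  have h4 : ∑ g ∈ im, 2 * (f (x * g) * f g) ≤ ∑ g ∈ im, (f (x * g) ^ 2 + f g ^ 2) := by
    refine sum_le_sum fun g _ => ?_
    have := two_mul_le_add_sq (f (x * g)) (f g)
    linarith
  rw [← mul_sum, sum_add_distrib] at h4
  omega

set_option maxHeartbeats 2000000 in
/-- If the quotients of `φ` coincide almost as often as `φ` itself, then `φ` charges a translate
of an approximate group. -/
theorem exists_approximateSubgroup_of_collisions [Nonempty ι] [DecidableEq ι] (φ : ι → G) {K : ℝ} (hK : 2 ≤ K)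
    (hE : (Fintype.card ι : ℝ) ^ 2 * #{p : ι × ι | φ p.1 = φ p.2} ≤
      K * #{p : (ι × ι) × (ι × ι) | φ p.1.1 * (φ p.1.2)⁻¹ = φ p.2.1 * (φ p.2.2)⁻¹}) :
    ∃ (H : Finset G) (y : G), (1 : G) ∈ H ∧ H⁻¹ = H ∧
      (∀ m : ℕ, (#(H ^ m) : ℝ) ≤ K ^ (2000 * (m + 1)) * #H) ∧
      #H * (#{p : ι × ι | φ p.1 = φ p.2} : ℝ) ≤ K ^ 2000 * (Fintype.card ι : ℝ) ^ 2 ∧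
      (Fintype.card ι : ℝ) ≤ K ^ 2000 * #{ω | y⁻¹ * φ ω ∈ H} := by
  have hK0 : 0 < K := by linarith
  have hK1 : 1 ≤ K := by linarith
  have hpw : ∀ j : ℕ, (2 : ℝ) ^ j ≤ K ^ j := fun j => pow_le_pow_left₀ (by norm_num) hK j
  set f : G → ℕ := fun g => #{ω | φ ω = g} with hf
  set r : G → ℕ := fun x => #{p : ι × ι | φ p.1 * (φ p.2)⁻¹ = x} with hr
  have hrP' : ∀ x, r x ≤ #{p : ι × ι | φ p.1 = φ p.2} := card_quotient_le_card_collisions φ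
  have hPsum' : #{p : ι × ι | φ p.1 = φ p.2} = ∑ a, f (φ a) := by
    rw [card_filter, Fintype.sum_prod_type_right]
    simp only [hf, card_filter]
  have hEsum' : #{p : (ι × ι) × (ι × ι) | φ p.1.1 * (φ p.1.2)⁻¹ = φ p.2.1 * (φ p.2.2)⁻¹} =
      ∑ p : ι × ι, r (φ p.1 * (φ p.2)⁻¹) := by
    rw [card_filter, Fintype.sum_prod_type_right]
    simp only [hr, card_filter]
  have hI : (0 : ℝ) < Fintype.card ι := by exact_mod_cast Fintype.card_pos
  have hPpos : (0 : ℝ) < #{p : ι × ι | φ p.1 = φ p.2} := by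
    obtain ⟨a⟩ := ‹Nonempty ι›
    exact_mod_cast card_pos.2 ⟨(a, a), by simp⟩
  have hEsum : (#{p : (ι × ι) × (ι × ι) | φ p.1.1 * (φ p.1.2)⁻¹ = φ p.2.1 * (φ p.2.2)⁻¹} : ℝ) =
      ∑ p : ι × ι, (r (φ p.1 * (φ p.2)⁻¹) : ℝ) := by exact_mod_cast hEsum'
  have hPsum : (#{p : ι × ι | φ p.1 = φ p.2} : ℝ) = ∑ a, (f (φ a) : ℝ) := by
    exact_mod_cast hPsum'
  have hrP : ∀ x, (r x : ℝ) ≤ #{p : ι × ι | φ p.1 = φ p.2} := fun x => by exact_mod_cast hrP' x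
  rw [hEsum] at hE
  clear hEsum hEsum' hPsum' hrP'
  have hIcard : (#(univ : Finset ι) : ℝ) = Fintype.card ι := by rw [card_univ]
  generalize (#{p : ι × ι | φ p.1 = φ p.2} : ℝ) = P at *
  generalize hIdef : (Fintype.card ι : ℝ) = I at *
  -- popular quotients
  set Pop : Finset G := {x ∈ univ.image (fun p : ι × ι => φ p.1 * (φ p.2)⁻¹) | P ≤ 2 * K * r x}
    with hPop
  have hcardPop : (#Pop : ℝ) * P ≤ 2 * K * I ^ 2 := by
    have h1 : (#Pop : ℝ) * (P / (2 * K)) ≤ #(univ : Finset (ι × ι)) := by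
      refine card_mul_le_card_of_fiber (f := fun p : ι × ι => φ p.1 * (φ p.2)⁻¹) fun x hx => ?_
      rw [div_le_iff₀' (by positivity)]
      exact (mem_filter.1 hx).2
    rw [card_univ, Fintype.card_prod, mul_div_assoc', div_le_iff₀ (by positivity)] at h1
    push_cast at h1
    rw [hIdef] at h1
    linarith
  have hpairs : I ^ 2 ≤ 2 * K * #{p : ι × ι | φ p.1 * (φ p.2)⁻¹ ∈ Pop} := by
    have h1 : ∑ p : ι × ι, (r (φ p.1 * (φ p.2)⁻¹) : ℝ) ≤
        ∑ p : ι × ι, ((if φ p.1 * (φ p.2)⁻¹ ∈ Pop then P else 0) + P / (2 * K)) := by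
      refine sum_le_sum fun p _ => ?_
      have h0 : 0 ≤ P / (2 * K) := by positivity
      split_ifs with h
      · have := hrP (φ p.1 * (φ p.2)⁻¹)
        linarith
      · rw [zero_add, le_div_iff₀ (by positivity)]
        have h2 : ¬ P ≤ 2 * K * r (φ p.1 * (φ p.2)⁻¹) := fun hh =>
          h (mem_filter.2 ⟨mem_image_of_mem (fun p : ι × ι => φ p.1 * (φ p.2)⁻¹) (mem_univ p), hh⟩)
        linarith
    rw [sum_add_distrib, ← sum_filter, sum_const, sum_const, card_univ, Fintype.card_prod,
      nsmul_eq_mul, nsmul_eq_mul] at h1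
    push_cast at h1
    rw [hIdef] at h1
    generalize (#{p : ι × ι | φ p.1 * (φ p.2)⁻¹ ∈ Pop} : ℝ) = z at *
    have h2 := hE.trans (mul_le_mul_of_nonneg_left h1 hK0.le)
    have h3 : K * (I * I * (P / (2 * K))) = I ^ 2 * P / 2 := by
      field_simp
    rw [mul_add, h3] at h2
    have h4 : I ^ 2 * P ≤ (2 * K * z) * P := by linarith
    exact le_of_mul_le_mul_right h4 hPpos
  -- the level sets of moderate multiplicity
  set A : Finset G := {x ∈ univ.image φ | P ≤ K ^ 7 * (I * f x) ∧ I * f x ≤ K ^ 5 * P} with hA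
  have hhigh : K ^ 5 * #{a | K ^ 5 * P < I * f (φ a)} ≤ I := by
    have h1 : ∑ a with K ^ 5 * P < I * f (φ a), (K ^ 5 * P) ≤
        ∑ a with K ^ 5 * P < I * f (φ a), (I * f (φ a) : ℝ) :=
      sum_le_sum fun a ha => (mem_filter.1 ha).2.le
    have h2 : ∑ a with K ^ 5 * P < I * f (φ a), (I * f (φ a) : ℝ) ≤ ∑ a, (I * f (φ a) : ℝ) :=
      sum_le_sum_of_subset_of_nonneg (filter_subset _ _) fun _ _ _ =>
        mul_nonneg hI.le (Nat.cast_nonneg _)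
    rw [← mul_sum univ, ← hPsum] at h2
    rw [sum_const, nsmul_eq_mul] at h1
    generalize (#{a | K ^ 5 * P < I * f (φ a)} : ℝ) = z at *
    have h3 : (K ^ 5 * z) * P ≤ I * P := by linarith
    exact le_of_mul_le_mul_right h3 hPpos
  have hlow1 : K ^ 7 * #{p : ι × ι | φ p.1 * (φ p.2)⁻¹ ∈ Pop ∧ K ^ 7 * (I * f (φ p.1)) < P} ≤
      2 * K * I ^ 2 := by
    have h1 : #{p : ι × ι | φ p.1 * (φ p.2)⁻¹ ∈ Pop ∧ K ^ 7 * (I * f (φ p.1)) < P} =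
        ∑ q ∈ Pop ×ˢ (univ : Finset ι), #{p ∈ ({p : ι × ι | φ p.1 * (φ p.2)⁻¹ ∈ Pop ∧
          K ^ 7 * (I * f (φ p.1)) < P} : Finset (ι × ι)) | (φ p.1 * (φ p.2)⁻¹, p.2) = q} :=
      card_eq_sum_card_fiberwise fun p hp => by
        simp only [coe_filter, Set.mem_ofPred_eq, mem_univ, true_and] at hp
        simp [hp.1]
    have h2 : ∀ q ∈ Pop ×ˢ (univ : Finset ι), K ^ 7 * I * (#{p ∈ ({p : ι × ι |
        φ p.1 * (φ p.2)⁻¹ ∈ Pop ∧ K ^ 7 * (I * f (φ p.1)) < P} : Finset (ι × ι)) |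
          (φ p.1 * (φ p.2)⁻¹, p.2) = q} : ℝ) ≤ P := by
      rintro ⟨x, b⟩ hq
      rcases eq_empty_or_nonempty ({p ∈ ({p : ι × ι |
        φ p.1 * (φ p.2)⁻¹ ∈ Pop ∧ K ^ 7 * (I * f (φ p.1)) < P} : Finset (ι × ι)) |
          (φ p.1 * (φ p.2)⁻¹, p.2) = (x, b)}) with h0 | ⟨⟨a, b'⟩, h0⟩
      · rw [h0]
        simpa using hPpos.le
      · simp only [mem_filter, mem_univ, true_and, Prod.mk.injEq] at h0
        obtain ⟨⟨h3, h4⟩, h5, rfl⟩ := h0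
        refine le_trans ?_ h4.le
        rw [mul_assoc]
        have h6 : #{p ∈ ({p : ι × ι |
            φ p.1 * (φ p.2)⁻¹ ∈ Pop ∧ K ^ 7 * (I * f (φ p.1)) < P} : Finset (ι × ι)) |
            (φ p.1 * (φ p.2)⁻¹, p.2) = (x, b')} ≤ f (φ a) := by
          refine card_le_card_of_injOn (fun p => p.1) ?_ ?_
          · rintro ⟨c, d⟩ h
            simp only [coe_filter, mem_filter, mem_univ, true_and, Prod.mk.injEq,
              Set.mem_ofPred_eq] at h
            simp only [mem_coe, mem_filter, mem_univ, true_and]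
            rw [← h5, h.2.2] at h
            exact mul_right_cancel h.2.1
          · rintro ⟨c, d⟩ h ⟨c', d'⟩ h' hc
            simp only [coe_filter, mem_filter, mem_univ, true_and, Prod.mk.injEq,
              Set.mem_ofPred_eq] at h h' hc
            rw [h.2.2, h'.2.2, hc]
        have h7 : (_ : ℝ) ≤ _ := Nat.cast_le (α := ℝ).2 h6
        exact mul_le_mul_of_nonneg_left (mul_le_mul_of_nonneg_left h7 hI.le) (by positivity)
    have h3 := sum_le_sum h2
    rw [← mul_sum, sum_const, card_product, nsmul_eq_mul] at h3
    have h4 : (#{p : ι × ι | φ p.1 * (φ p.2)⁻¹ ∈ Pop ∧ K ^ 7 * (I * f (φ p.1)) < P} : ℝ) = _ :=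
      congrArg _ h1
    push_cast at h4 h3
    rw [← h4, hIcard] at h3
    generalize (#{p : ι × ι | φ p.1 * (φ p.2)⁻¹ ∈ Pop ∧ K ^ 7 * (I * f (φ p.1)) < P} : ℝ) = z at *
    have h5 : (K ^ 7 * z) * I ≤ (2 * K * I ^ 2) * I := by
      calc _ = K ^ 7 * I * z := by ring
        _ ≤ _ := h3
        _ = (#Pop * P) * I := by ring
        _ ≤ _ := by gcongr
    exact le_of_mul_le_mul_right h5 hI
  have hrinv : ∀ a b, r (φ b * (φ a)⁻¹) = r (φ a * (φ b)⁻¹) := by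
    intro a b
    refine card_bij' (fun p _ => (p.2, p.1)) (fun p _ => (p.2, p.1)) ?_ ?_ ?_ ?_
    · rintro ⟨c, d⟩ hp
      simp only [mem_filter, mem_univ, true_and] at hp ⊢
      rw [← _root_.inv_inj, _root_.mul_inv_rev, _root_.mul_inv_rev, inv_inv, inv_inv, hp]
    · rintro ⟨c, d⟩ hp
      simp only [mem_filter, mem_univ, true_and] at hp ⊢
      rw [← _root_.inv_inj, _root_.mul_inv_rev, _root_.mul_inv_rev, inv_inv, inv_inv, hp]
    · intros; rfl
    · intros; rfl
  have hPopinv : ∀ a b, φ a * (φ b)⁻¹ ∈ Pop → φ b * (φ a)⁻¹ ∈ Pop := by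
    intro a b h
    refine mem_filter.2 ⟨mem_image_of_mem (fun p : ι × ι => φ p.1 * (φ p.2)⁻¹)
      (mem_univ (b, a)), ?_⟩
    rw [hrinv]
    exact (mem_filter.1 h).2
  have hlow2 : K ^ 7 * #{p : ι × ι | φ p.1 * (φ p.2)⁻¹ ∈ Pop ∧ K ^ 7 * (I * f (φ p.2)) < P} ≤
      2 * K * I ^ 2 := by
    refine le_trans (le_of_eq ?_) hlow1
    congr 2
    refine card_bij' (fun p _ => (p.2, p.1)) (fun p _ => (p.2, p.1)) ?_ ?_ ?_ ?_
    · rintro ⟨c, d⟩ hp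
      simp only [mem_filter, mem_univ, true_and] at hp ⊢
      exact ⟨hPopinv _ _ hp.1, hp.2⟩
    · rintro ⟨c, d⟩ hp
      simp only [mem_filter, mem_univ, true_and] at hp ⊢
      exact ⟨hPopinv _ _ hp.1, hp.2⟩
    · intros; rfl
    · intros; rfl
  have hmid : I ^ 2 ≤ 4 * K *
      #{p : ι × ι | φ p.1 * (φ p.2)⁻¹ ∈ Pop ∧ φ p.1 ∈ A ∧ φ p.2 ∈ A} := by
    have hsub : ({p : ι × ι | φ p.1 * (φ p.2)⁻¹ ∈ Pop} : Finset (ι × ι)) ⊆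
        (((({p : ι × ι | φ p.1 * (φ p.2)⁻¹ ∈ Pop ∧ φ p.1 ∈ A ∧ φ p.2 ∈ A} : Finset (ι × ι)) ∪
        ({p : ι × ι | φ p.1 * (φ p.2)⁻¹ ∈ Pop ∧ K ^ 7 * (I * f (φ p.1)) < P} : Finset (ι × ι))) ∪
        ({p : ι × ι | φ p.1 * (φ p.2)⁻¹ ∈ Pop ∧ K ^ 7 * (I * f (φ p.2)) < P} : Finset (ι × ι))) ∪
        (({a | K ^ 5 * P < I * f (φ a)} : Finset ι) ×ˢ univ)) ∪
        (univ ×ˢ ({a | K ^ 5 * P < I * f (φ a)} : Finset ι)) := by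
      rintro ⟨a, b⟩ h
      simp only [mem_filter, mem_univ, true_and] at h
      simp only [mem_union, mem_filter, mem_univ, true_and, mem_product, h, and_true, hA,
        mem_image, exists_apply_eq_apply, ← not_lt]
      tauto
    have h1 := (card_le_card hsub).trans <| (card_union_le _ _).trans <|
      Nat.add_le_add_right ((card_union_le _ _).trans <|
      Nat.add_le_add_right ((card_union_le _ _).trans <|
      Nat.add_le_add_right (card_union_le _ _) _) _) _
    rw [card_product, card_product] at h1
    have h2 : (_ : ℝ) ≤ _ := Nat.cast_le (α := ℝ).2 h1
    push_cast at h2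
    rw [hIcard] at h2
    generalize (#{p : ι × ι | φ p.1 * (φ p.2)⁻¹ ∈ Pop} : ℝ) = z0 at *
    generalize (#{p : ι × ι | φ p.1 * (φ p.2)⁻¹ ∈ Pop ∧ φ p.1 ∈ A ∧ φ p.2 ∈ A} : ℝ) = z1 at *
    have hhz2 : (0 : ℝ) ≤ (#{p : ι × ι | φ p.1 * (φ p.2)⁻¹ ∈ Pop ∧ K ^ 7 * (I * f (φ p.1)) < P} : ℝ) := Nat.cast_nonneg _
    generalize (#{p : ι × ι | φ p.1 * (φ p.2)⁻¹ ∈ Pop ∧ K ^ 7 * (I * f (φ p.1)) < P} : ℝ) = z2 at *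
    have hhz3 : (0 : ℝ) ≤ (#{p : ι × ι | φ p.1 * (φ p.2)⁻¹ ∈ Pop ∧ K ^ 7 * (I * f (φ p.2)) < P} : ℝ) := Nat.cast_nonneg _
    generalize (#{p : ι × ι | φ p.1 * (φ p.2)⁻¹ ∈ Pop ∧ K ^ 7 * (I * f (φ p.2)) < P} : ℝ) = z3 at *
    have hhz4 : (0 : ℝ) ≤ (#{a | K ^ 5 * P < I * f (φ a)} : ℝ) := Nat.cast_nonneg _
    generalize (#{a | K ^ 5 * P < I * f (φ a)} : ℝ) = z4 at *
    have e1 : 16 * (K * z2) ≤ I ^ 2 := by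
      have h3 : (2 * K) * (16 * (K * z2)) ≤ (2 * K) * I ^ 2 := by
        calc (2 * K) * (16 * (K * z2)) = 2 ^ 5 * (K * (K * z2)) := by ring
          _ ≤ K ^ 5 * (K * (K * z2)) := by gcongr
          _ = K ^ 7 * z2 := by ring
          _ ≤ _ := hlow1
      exact le_of_mul_le_mul_left h3 (by positivity)
    have e2 : 16 * (K * z3) ≤ I ^ 2 := by
      have h3 : (2 * K) * (16 * (K * z3)) ≤ (2 * K) * I ^ 2 := by
        calc (2 * K) * (16 * (K * z3)) = 2 ^ 5 * (K * (K * z3)) := by ring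
          _ ≤ K ^ 5 * (K * (K * z3)) := by gcongr
          _ = K ^ 7 * z3 := by ring
          _ ≤ _ := hlow2
      exact le_of_mul_le_mul_left h3 (by positivity)
    have e3 : 16 * (K * z4) ≤ I := by
      calc 16 * (K * z4) = 2 ^ 4 * (K * z4) := by ring
        _ ≤ K ^ 4 * (K * z4) := by
          have := hpw 4
          gcongr
        _ = K ^ 5 * z4 := by ring
        _ ≤ _ := hhigh
    have e4 := mul_le_mul_of_nonneg_left e3 hI.le
    have e5 := mul_le_mul_of_nonneg_left h2 hK0.le
    nlinarith
  have hpairs2 : I ^ 4 ≤ K ^ 13 * P ^ 2 * #{p ∈ A ×ˢ A | p.1 * p.2⁻¹ ∈ Pop} := by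
    have h1 : #{p : ι × ι | φ p.1 * (φ p.2)⁻¹ ∈ Pop ∧ φ p.1 ∈ A ∧ φ p.2 ∈ A} =
        ∑ q ∈ A ×ˢ A with q.1 * q.2⁻¹ ∈ Pop, f q.1 * f q.2 := by
      rw [card_eq_sum_card_fiberwise (f := fun p : ι × ι => (φ p.1, φ p.2))
        (t := {q ∈ A ×ˢ A | q.1 * q.2⁻¹ ∈ Pop}) (fun p hp => by
          simp only [coe_filter, Set.mem_ofPred_eq, mem_univ, true_and] at hp
          simp [hp])]
      refine sum_congr rfl fun q hq => ?_
      simp only [hf]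
      rw [← card_product]
      congr 1
      ext ⟨a, b⟩
      simp only [mem_filter, mem_product, mem_univ, true_and] at hq ⊢
      constructor
      · rintro ⟨h, rfl⟩
        exact ⟨rfl, rfl⟩
      · rintro ⟨h1, h2⟩
        rw [h1, h2]
        exact ⟨⟨hq.2, hq.1⟩, rfl⟩
    have h2 : I ^ 2 * (#{p : ι × ι | φ p.1 * (φ p.2)⁻¹ ∈ Pop ∧ φ p.1 ∈ A ∧ φ p.2 ∈ A} : ℝ) ≤
        (K ^ 5 * P) ^ 2 * #{p ∈ A ×ˢ A | p.1 * p.2⁻¹ ∈ Pop} := by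
      rw [h1]
      push_cast
      rw [mul_sum, mul_comm _ (Nat.cast (R := ℝ) _), ← nsmul_eq_mul]
      refine sum_le_card_nsmul _ _ _ fun q hq => ?_
      simp only [mem_filter, mem_product] at hq
      have h3 := (mem_filter.1 hq.1.1).2.2
      have h4 := (mem_filter.1 hq.1.2).2.2
      calc I ^ 2 * ((f q.1 : ℝ) * f q.2) = (I * f q.1) * (I * f q.2) := by ring
        _ ≤ (K ^ 5 * P) * (K ^ 5 * P) :=
          mul_le_mul h3 h4 (mul_nonneg hI.le (Nat.cast_nonneg _)) (by positivity)
        _ = _ := by ring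
    generalize hz1 : (#{p : ι × ι | φ p.1 * (φ p.2)⁻¹ ∈ Pop ∧ φ p.1 ∈ A ∧ φ p.2 ∈ A} : ℝ) = z1 at *
    have h0 : (0 : ℝ) ≤ (#{p ∈ A ×ˢ A | p.1 * p.2⁻¹ ∈ Pop} : ℝ) := Nat.cast_nonneg _
    generalize (#{p ∈ A ×ˢ A | p.1 * p.2⁻¹ ∈ Pop} : ℝ) = z2 at *
    calc I ^ 4 = I ^ 2 * I ^ 2 := by ring
      _ ≤ I ^ 2 * (4 * K * z1) := by gcongr
      _ = 4 * K * (I ^ 2 * z1) := by ring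
      _ ≤ K ^ 2 * K * ((K ^ 5 * P) ^ 2 * z2) := by
        have : (4 : ℝ) ≤ K ^ 2 := by nlinarith
        have h5 : 4 * K ≤ K ^ 2 * K := by gcongr
        exact mul_le_mul h5 h2 (mul_nonneg (by positivity) (by rw [← hz1]; positivity)) (by positivity)
      _ = _ := by ring
  have hAcard : (#A : ℝ) * P ≤ K ^ 7 * I ^ 2 := by
    have h1 : (#A : ℝ) * (P / (K ^ 7 * I)) ≤ #(univ : Finset ι) := by
      refine card_mul_le_card_of_fiber (f := φ) fun x hx => ?_
      rw [div_le_iff₀' (by positivity), mul_assoc]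
      exact (mem_filter.1 hx).2.1
    rw [hIcard, mul_div_assoc', div_le_iff₀ (by positivity)] at h1
    linarith
  have hpairsA : (#{p ∈ A ×ˢ A | p.1 * p.2⁻¹ ∈ Pop} : ℝ) ≤ (#A : ℝ) ^ 2 := by
    have : #{p ∈ A ×ˢ A | p.1 * p.2⁻¹ ∈ Pop} ≤ #A ^ 2 := by
      rw [sq, ← card_product]
      exact card_filter_le _ _
    exact_mod_cast this
  have hfA : ∀ x ∈ A, P ≤ K ^ 7 * (I * f x) := fun x hx => (mem_filter.1 hx).2.1
  have hA0 : (0 : ℝ) ≤ #A := Nat.cast_nonneg _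
  have hAlow : I ^ 2 ≤ K ^ 7 * P * #A := by
    refine (pow_le_pow_iff_left₀ (by positivity) (by positivity) two_ne_zero).1 ?_
    calc (I ^ 2) ^ 2 = I ^ 4 := by ring
      _ ≤ K ^ 13 * P ^ 2 * #{p ∈ A ×ˢ A | p.1 * p.2⁻¹ ∈ Pop} := hpairs2
      _ ≤ K ^ 13 * P ^ 2 * (#A : ℝ) ^ 2 := by gcongr
      _ ≤ K ^ 14 * P ^ 2 * (#A : ℝ) ^ 2 := by gcongr; norm_num [hK1]
      _ = _ := by ring
  have hAne : A.Nonempty := by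
    rw [nonempty_iff_ne_empty]
    intro h
    rw [h] at hAlow
    simp at hAlow
    nlinarith
  have hE1 : (#A : ℝ) ^ 2 ≤ K ^ 27 * #{p ∈ A ×ˢ A | p.1 * p.2⁻¹ ∈ Pop} := by
    have h1 : (#A : ℝ) ^ 2 * P ^ 2 ≤
        (K ^ 27 * #{p ∈ A ×ˢ A | p.1 * p.2⁻¹ ∈ Pop}) * P ^ 2 := by
      calc (#A : ℝ) ^ 2 * P ^ 2 = (#A * P) ^ 2 := by ring
        _ ≤ (K ^ 7 * I ^ 2) ^ 2 := by gcongr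
        _ = K ^ 14 * I ^ 4 := by ring
        _ ≤ K ^ 14 * (K ^ 13 * P ^ 2 * #{p ∈ A ×ˢ A | p.1 * p.2⁻¹ ∈ Pop}) := by gcongr
        _ = _ := by ring
    exact le_of_mul_le_mul_right h1 (by positivity)
  have hPopA : (#Pop : ℝ) ≤ K ^ 27 * #A := by
    have h1 : (#Pop : ℝ) * P ≤ (K ^ 9 * #A) * P := by
      calc _ ≤ _ := hcardPop
        _ ≤ K * K * (K ^ 7 * P * #A) := by gcongr
        _ = _ := by ring
    refine (le_of_mul_le_mul_right h1 hPpos).trans ?_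
    exact mul_le_mul_of_nonneg_right (pow_le_pow_right₀ hK1 (by norm_num)) hA0
  have hK27 : 2 ≤ K ^ 27 := hK.trans (le_self_pow₀ hK1 (by norm_num))
  obtain ⟨A', hA'A, hA'1, hA'2⟩ := exists_subset_card_mul_inv_le hAne hK27 hPopA hE1
  have hA'ne : A'.Nonempty := by
    rw [nonempty_iff_ne_empty]
    intro h
    rw [h] at hA'1
    simp at hA'1
    simp [hA'1] at hAne
  rw [← pow_mul] at hA'1 hA'2
  have hK648 : 2 ≤ K ^ (27 * 24) := hK.trans (le_self_pow₀ hK1 (by norm_num))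
  obtain ⟨H, y, hy, h1H, hHinv, hHpow, hHA, hAH⟩ := exists_approximateSubgroup hA'ne hK648 hA'2
  have hA'A2 : (#A' : ℝ) ≤ #A := by exact_mod_cast card_le_card hA'A
  refine ⟨H, y, h1H, hHinv, fun m => (hHpow m).trans ?_, ?_, ?_⟩
  · rw [← pow_mul]
    exact mul_le_mul_of_nonneg_right (pow_le_pow_right₀ hK1 (by omega)) (Nat.cast_nonneg _)
  · calc (#H : ℝ) * P ≤ ((K ^ (27 * 24)) ^ 2 * #A) * P := by gcongr; exact hHA.trans (by gcongr)
      _ = K ^ 1296 * (#A * P) := by ring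
      _ ≤ K ^ 1296 * (K ^ 7 * I ^ 2) := by gcongr
      _ = K ^ 1303 * I ^ 2 := by ring
      _ ≤ _ := mul_le_mul_of_nonneg_right (pow_le_pow_right₀ hK1 (by norm_num)) (by positivity)
  · have h1 : (#{x ∈ A' | y⁻¹ * x ∈ H} : ℝ) * (P / (K ^ 7 * I)) ≤ #{ω | y⁻¹ * φ ω ∈ H} := by
      refine card_mul_le_card_of_fiber (f := φ) fun x hx => ?_
      obtain ⟨hx1, hx2⟩ := mem_filter.1 hx
      rw [div_le_iff₀' (by positivity), mul_assoc]
      refine (hfA x (hA'A hx1)).trans ?_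
      refine mul_le_mul_of_nonneg_left (mul_le_mul_of_nonneg_left (Nat.cast_le.2 ?_) hI.le)
        (by positivity)
      refine card_le_card fun ω hω => ?_
      simp only [mem_filter, mem_univ, true_and] at hω ⊢
      subst hω
      exact ⟨hx2, rfl⟩
    rw [mul_div_assoc', div_le_iff₀ (by positivity)] at h1
    generalize (#{x ∈ A' | y⁻¹ * x ∈ H} : ℝ) = z1 at *
    generalize hz : (#{ω | y⁻¹ * φ ω ∈ H} : ℝ) = z2 at *
    have hz2 : 0 ≤ z2 := by rw [← hz]; exact Nat.cast_nonneg _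
    have h2 : I * I ≤ (K ^ 1391 * z2) * I := by
      calc I * I = I ^ 2 := by ring
        _ ≤ K ^ 7 * P * #A := hAlow
        _ ≤ K ^ 7 * P * (K ^ (27 * 3) * ((K ^ (27 * 24)) ^ 2 * z1)) := by
          gcongr
          exact hA'1.trans (by gcongr)
        _ = K ^ 1384 * (z1 * P) := by ring
        _ ≤ K ^ 1384 * (z2 * (K ^ 7 * I)) := by gcongr
        _ = _ := by ring
    refine (le_of_mul_le_mul_right h2 hI).trans ?_
    exact mul_le_mul_of_nonneg_right (pow_le_pow_right₀ hK1 (by norm_num)) hz2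

end Weighted

section Lines

open Finset

variable {F : Type u} [Field F]

/-- A set of `2 × 2` matrices is covered by `n` lines of the projective space of matrices. -/
def CoveredByLines (S : Set (Matrix (Fin 2) (Fin 2) F)) (n : ℝ) : Prop :=
  ∃ L : Finset (Submodule F (Matrix (Fin 2) (Fin 2) F)), (#L : ℝ) ≤ n ∧
    (∀ W ∈ L, finrank F W ≤ 2) ∧ ∀ m ∈ S, ∃ W ∈ L, m ∈ W

theorem CoveredByLines.mono {S S' : Set (Matrix (Fin 2) (Fin 2) F)} {n n' : ℝ}
    (h : CoveredByLines S n) (hS : S' ⊆ S) (hn : n ≤ n') : CoveredByLines S' n' := by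
  obtain ⟨L, h1, h2, h3⟩ := h
  exact ⟨L, h1.trans hn, h2, fun m hm => h3 m (hS hm)⟩

theorem CoveredByLines.union {S S' : Set (Matrix (Fin 2) (Fin 2) F)} {n n' : ℝ}
    (h : CoveredByLines S n) (h' : CoveredByLines S' n') : CoveredByLines (S ∪ S') (n + n') := by
  classical
  obtain ⟨L, h1, h2, h3⟩ := h
  obtain ⟨L', h1', h2', h3'⟩ := h'
  refine ⟨L ∪ L', ?_, ?_, ?_⟩
  · have : (#(L ∪ L') : ℝ) ≤ #L + #L' := by exact_mod_cast card_union_le _ _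
    linarith
  · intro W hW
    rcases mem_union.1 hW with hW | hW
    exacts [h2 W hW, h2' W hW]
  · rintro m (hm | hm)
    · obtain ⟨W, hW, hmW⟩ := h3 m hm
      exact ⟨W, mem_union_left _ hW, hmW⟩
    · obtain ⟨W, hW, hmW⟩ := h3' m hm
      exact ⟨W, mem_union_right _ hW, hmW⟩

theorem coveredByLines_of_forall {α : Type*} (I : Finset α)
    (W : α → Submodule F (Matrix (Fin 2) (Fin 2) F)) (hW : ∀ i ∈ I, finrank F (W i) ≤ 2)
    {S : Set (Matrix (Fin 2) (Fin 2) F)} (hS : ∀ m ∈ S, ∃ i ∈ I, m ∈ W i) :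
    CoveredByLines S #I := by
  classical
  refine ⟨I.image W, by exact_mod_cast card_image_le, ?_, ?_⟩
  · intro V hV
    obtain ⟨i, hi, rfl⟩ := mem_image.1 hV
    exact hW i hi
  · intro m hm
    obtain ⟨i, hi, h⟩ := hS m hm
    exact ⟨W i, mem_image_of_mem _ hi, h⟩

theorem finrank_le_two_of_injOn {V : Type*} [AddCommGroup V] [Module F V] (W : Submodule F V)
    (f : V →ₗ[F] F × F) (h : ∀ m ∈ W, f m = 0 → m = 0) : finrank F W ≤ 2 := by
  have hinj : Function.Injective (f ∘ₗ W.subtype) := by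
    rw [← LinearMap.ker_eq_bot, LinearMap.ker_eq_bot']
    rintro ⟨m, hm⟩ h0
    exact Subtype.ext (h m hm h0)
  simpa using LinearMap.finrank_le_finrank_of_injective hinj

theorem CoveredByLines.comap {S S' : Set (Matrix (Fin 2) (Fin 2) F)} {n : ℝ}
    (h : CoveredByLines S n) (f : Matrix (Fin 2) (Fin 2) F →ₗ[F] Matrix (Fin 2) (Fin 2) F)
    (hf : Function.Injective f) (hS : ∀ m ∈ S', f m ∈ S) : CoveredByLines S' n := by
  obtain ⟨L, h1, h2, h3⟩ := h
  refine (coveredByLines_of_forall L (fun W => W.comap f) (fun W hW => ?_) fun m hm => ?_).mono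
    subset_rfl h1
  · refine le_trans ?_ (h2 W hW)
    refine LinearMap.finrank_le_finrank_of_injective
      (f := (f ∘ₗ (W.comap f).subtype).codRestrict W fun x => x.2) ?_
    intro x y hxy
    exact Subtype.ext (hf (congrArg Subtype.val hxy))
  · exact h3 _ (hS m hm)

theorem coveredByLines_finset (s : Finset (Matrix (Fin 2) (Fin 2) F)) :
    CoveredByLines (s : Set (Matrix (Fin 2) (Fin 2) F)) #s := by
  refine coveredByLines_of_forall s (fun m => F ∙ m) (fun m _ => ?_) fun m hm =>
    ⟨m, hm, Submodule.mem_span_singleton_self m⟩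
  exact (by simpa using finrank_span_le_card (R := F) {m} : finrank F (F ∙ m) ≤ 1).trans (by norm_num)

theorem coveredByLines_submodule (W : Submodule F (Matrix (Fin 2) (Fin 2) F))
    (hW : finrank F W ≤ 2) : CoveredByLines (W : Set (Matrix (Fin 2) (Fin 2) F)) 1 :=
  ⟨{W}, by simp, by simpa using hW, fun m hm => ⟨W, by simp, hm⟩⟩

end Lines

section SL2

open Finset Pointwise

variable {F : Type u} [Field F]

/-- The group `SL₂(F)`. -/
abbrev SL2 (F : Type*) [Field F] := Matrix.SpecialLinearGroup (Fin 2) F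

theorem sl2_mul (g h : SL2 F) (i j : Fin 2) : (g * h) i j = g i 0 * h 0 j + g i 1 * h 1 j := by
  rw [Matrix.SpecialLinearGroup.coe_mul, Matrix.mul_apply, Fin.sum_univ_two]

theorem sl2_det (g : SL2 F) : g 0 0 * g 1 1 - g 0 1 * g 1 0 = 1 := by
  rw [← Matrix.det_fin_two]
  exact g.2

theorem sl2_inv (g : SL2 F) : g⁻¹ 0 0 = g 1 1 ∧ g⁻¹ 0 1 = - g 0 1 ∧ g⁻¹ 1 0 = - g 1 0 ∧
    g⁻¹ 1 1 = g 0 0 := by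
  rw [Matrix.SpecialLinearGroup.SL2_inv_expl]
  simp

theorem sl2_ext {g h : SL2 F} (h00 : g 0 0 = h 0 0) (h01 : g 0 1 = h 0 1) (h10 : g 1 0 = h 1 0)
    (h11 : g 1 1 = h 1 1) : g = h := by
  ext i j
  fin_cases i <;> fin_cases j <;> assumption

theorem sl2_one : (1 : SL2 F) 0 0 = 1 ∧ (1 : SL2 F) 0 1 = 0 ∧ (1 : SL2 F) 1 0 = 0 ∧
    (1 : SL2 F) 1 1 = 1 := by
  simp

end SL2

section ApproxGroup

open Finset Pointwise

variable {G : Type*} [Group G] [DecidableEq G]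

/-- A symmetric neighbourhood of the identity whose first powers have comparable sizes. -/
structure IsApproxGroup (H : Finset G) (κ : ℝ) : Prop where
  one_mem : (1 : G) ∈ H
  inv_eq : H⁻¹ = H
  card_pow_le : ∀ m ≤ 100, (#(H ^ m) : ℝ) ≤ κ * #H

variable {H : Finset G} {κ : ℝ}

theorem mul_mem_pow_add {x y : G} {a b : ℕ} (hx : x ∈ H ^ a) (hy : y ∈ H ^ b) :
    x * y ∈ H ^ (a + b) := by
  rw [pow_add]
  exact mul_mem_mul hx hy

namespace IsApproxGroup

theorem card_pos (h : IsApproxGroup H κ) : (0 : ℝ) < #H := by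
  exact_mod_cast Finset.card_pos.2 ⟨1, h.one_mem⟩

theorem one_le (h : IsApproxGroup H κ) : 1 ≤ κ := by
  have h1 := h.card_pow_le 1 (by norm_num)
  rw [pow_one] at h1
  have := h.card_pos
  by_contra! hk
  nlinarith

theorem inv_mem_pow (h : IsApproxGroup H κ) {x : G} {a : ℕ} (hx : x ∈ H ^ a) : x⁻¹ ∈ H ^ a := by
  have := inv_mem_inv hx
  rwa [← inv_pow, h.inv_eq] at this

theorem one_mem_pow (h : IsApproxGroup H κ) (a : ℕ) : (1 : G) ∈ H ^ a := by
  simpa using pow_mem_pow h.one_mem (n := a)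

theorem pow_mono (h : IsApproxGroup H κ) {a b : ℕ} (hab : a ≤ b) : H ^ a ⊆ H ^ b :=
  pow_subset_pow_right h.one_mem hab

theorem map (h : IsApproxGroup H κ) {G' : Type*} [Group G'] [DecidableEq G'] (f : G ≃* G') :
    IsApproxGroup (H.image f) κ where
  one_mem := mem_image.2 ⟨1, h.one_mem, map_one f⟩
  inv_eq := by rw [← image_inv, h.inv_eq]
  card_pow_le m hm := by
    rw [← image_pow, card_image_of_injective _ f.injective, card_image_of_injective _ f.injective]
    exact h.card_pow_le m hm

/-- The slices of the powers of `H` by a subgroup have comparable sizes. -/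
theorem card_slice_le (h : IsApproxGroup H κ) (p : G → Prop) [DecidablePred p]
    (hp : ∀ x y, p x → p y → p (x * y⁻¹)) {k : ℕ} (hk : k < 100) :
    (#{x ∈ H ^ k | p x} : ℝ) ≤ κ * #{x ∈ H ^ 2 | p x} := by
  have h1 : #({x ∈ H ^ k | p x} ×ˢ H) ≤ #{x ∈ H ^ 2 | p x} * #(H ^ (k + 1)) := by
    refine card_le_mul_card_image_of_maps_to (f := fun z => z.2 * z.1) ?_ _ ?_
    · rintro ⟨b, x⟩ hz
      simp only [mem_product, mem_filter] at hz
      rw [pow_succ']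
      exact mul_mem_mul hz.2 hz.1.1
    · intro z _
      rcases eq_empty_or_nonempty
        {a ∈ {x ∈ H ^ k | p x} ×ˢ H | a.2 * a.1 = z} with h0 | ⟨⟨b₀, x₀⟩, h0⟩
      · rw [h0]
        simp
      · simp only [mem_filter, mem_product] at h0
        refine card_le_card_of_injOn (fun a => x₀⁻¹ * a.2) ?_ ?_
        · rintro ⟨b, x⟩ hz
          simp only [coe_filter, mem_product, mem_filter, Set.mem_ofPred_eq] at hz ⊢
          have h2 : x₀⁻¹ * x = b₀ * b⁻¹ := by
            rw [inv_mul_eq_iff_eq_mul, ← mul_assoc, eq_mul_inv_iff_mul_eq, hz.2, h0.2]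
          refine ⟨?_, ?_⟩
          · rw [sq]
            refine mul_mem_mul ?_ hz.1.2
            rw [← h.inv_eq]
            exact inv_mem_inv h0.1.2
          · rw [h2]
            exact hp _ _ h0.1.1.2 hz.1.1.2
        · rintro ⟨b, x⟩ hz ⟨b', x'⟩ hz' heq
          simp only [coe_filter, mem_product, mem_filter, Set.mem_ofPred_eq] at hz hz' heq
          have hx := mul_left_cancel heq
          subst hx
          have := mul_left_cancel (hz.2.trans hz'.2.symm)
          rw [this]
  rw [card_product] at h1
  have h2 : (#{x ∈ H ^ k | p x} : ℝ) * #H ≤ #{x ∈ H ^ 2 | p x} * #(H ^ (k + 1)) := by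
    exact_mod_cast h1
  have h3 := h.card_pow_le (k + 1) (by omega)
  have h4 : (#{x ∈ H ^ k | p x} : ℝ) * #H ≤ (κ * #{x ∈ H ^ 2 | p x}) * #H := by
    calc _ ≤ _ := h2
      _ ≤ #{x ∈ H ^ 2 | p x} * (κ * #H) := by gcongr
      _ = _ := by ring
  exact le_of_mul_le_mul_right h4 h.card_pos

end IsApproxGroup

end ApproxGroup

section Borel

open Finset Pointwise

variable {F : Type u} [Field F]

/-- Upper unipotent matrices. -/
def upperUnipotent (p : F) : SL2 F := ⟨!![1, p; 0, 1], by simp⟩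

@[simp] theorem upperUnipotent_apply (p : F) : upperUnipotent p 0 0 = 1 ∧
    upperUnipotent p 0 1 = p ∧ upperUnipotent p 1 0 = 0 ∧ upperUnipotent p 1 1 = 1 := by
  simp [upperUnipotent]

theorem upperUnipotent_add (p q : F) :
    upperUnipotent (p + q) = upperUnipotent p * upperUnipotent q := by
  apply sl2_ext <;> simp [sl2_mul, add_comm]

theorem upperUnipotent_neg (p : F) : upperUnipotent (-p) = (upperUnipotent p)⁻¹ := by
  apply sl2_ext <;> simp [sl2_inv]

theorem upperUnipotent_injective : Function.Injective (upperUnipotent : F → SL2 F) := by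
  intro p q h
  have := congrArg (fun g : SL2 F => g 0 1) h
  simpa using this

theorem eq_upperUnipotent {g : SL2 F} (h10 : g 1 0 = 0) (h00 : g 0 0 = 1) :
    g = upperUnipotent (g 0 1) := by
  have h := sl2_det g
  rw [h10, h00] at h
  apply sl2_ext <;> simp [h10, h00]
  simpa using h

theorem conj_upperUnipotent {g : SL2 F} (h10 : g 1 0 = 0) (p : F) :
    g * upperUnipotent p * g⁻¹ = upperUnipotent ((g 0 0) ^ 2 * p) := by
  have h := sl2_det g
  rw [h10] at h
  apply sl2_ext <;> simp [sl2_mul, sl2_inv, h10]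
  · linear_combination h
  · ring
  · linear_combination h

variable [DecidableEq F] {H : Finset (SL2 F)} {κ : ℝ}

theorem upperUnipotent_add_mem {a b c : ℕ} {p q : F} (hp : upperUnipotent p ∈ H ^ a)
    (hq : upperUnipotent q ∈ H ^ b) (hc : a + b = c) :
    upperUnipotent (p + q) ∈ H ^ c := by
  rw [upperUnipotent_add, ← hc]
  exact mul_mem_pow_add hp hq

theorem IsApproxGroup.upperUnipotent_neg_mem (h : IsApproxGroup H κ) {a : ℕ} {p : F}
    (hp : upperUnipotent p ∈ H ^ a) : upperUnipotent (-p) ∈ H ^ a := by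
  rw [upperUnipotent_neg]
  exact h.inv_mem_pow hp

theorem IsApproxGroup.upperUnipotent_mul_mem (h : IsApproxGroup H κ) {a c : ℕ} {l p : F}
    (hc : 2 + a + 2 = c) (hl : l ∈ ({g ∈ H ^ 2 | g 1 0 = 0} : Finset (SL2 F)).image
      (fun g => (g 0 0) ^ 2)) (hp : upperUnipotent p ∈ H ^ a) :
    upperUnipotent (l * p) ∈ H ^ c := by
  obtain ⟨g, hg, rfl⟩ := mem_image.1 hl
  have hg2 := mem_filter.1 hg
  rw [← conj_upperUnipotent hg2.2, ← hc]
  exact mul_mem_pow_add (mul_mem_pow_add hg2.1 hp) (h.inv_mem_pow hg2.1)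

theorem IsApproxGroup.upperUnipotent_pivot_mem (h : IsApproxGroup H κ) {a c : ℕ}
    {l₁ l₂ x y p₀ p₁ p₂ : F}
    (hl₁ : l₁ ∈ ({g ∈ H ^ 2 | g 1 0 = 0} : Finset (SL2 F)).image (fun g => (g 0 0) ^ 2))
    (hl₂ : l₂ ∈ ({g ∈ H ^ 2 | g 1 0 = 0} : Finset (SL2 F)).image (fun g => (g 0 0) ^ 2))
    (hy : y ∈ ({g ∈ H ^ 2 | g 1 0 = 0} : Finset (SL2 F)).image (fun g => (g 0 0) ^ 2))
    (hx : upperUnipotent x ∈ H ^ a) (hp₁ : upperUnipotent p₁ ∈ H ^ a)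
    (hp₂ : upperUnipotent p₂ ∈ H ^ a) (hp₀ : upperUnipotent p₀ ∈ H ^ a) (hc : 6 * a + 32 = c) :
    upperUnipotent ((l₁ - l₂) * x + ((p₁ - p₂) + p₀ * (l₁ - l₂)) * y) ∈ H ^ c := by
  have k1 : upperUnipotent (l₁ * x) ∈ H ^ (2 + a + 2) := h.upperUnipotent_mul_mem rfl hl₁ hx
  have k2 : upperUnipotent (l₂ * x) ∈ H ^ (2 + a + 2) := h.upperUnipotent_mul_mem rfl hl₂ hx
  have k3 : upperUnipotent (y * p₁) ∈ H ^ (2 + a + 2) := h.upperUnipotent_mul_mem rfl hy hp₁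
  have k4 : upperUnipotent (y * p₂) ∈ H ^ (2 + a + 2) := h.upperUnipotent_mul_mem rfl hy hp₂
  have k5 : upperUnipotent (l₁ * p₀) ∈ H ^ (2 + a + 2) := h.upperUnipotent_mul_mem rfl hl₁ hp₀
  have k6 : upperUnipotent (l₂ * p₀) ∈ H ^ (2 + a + 2) := h.upperUnipotent_mul_mem rfl hl₂ hp₀
  have k7 : upperUnipotent (y * (l₁ * p₀)) ∈ H ^ (2 + (2 + a + 2) + 2) := h.upperUnipotent_mul_mem rfl hy k5
  have k8 : upperUnipotent (y * (l₂ * p₀)) ∈ H ^ (2 + (2 + a + 2) + 2) := h.upperUnipotent_mul_mem rfl hy k6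
  have k9 := upperUnipotent_add_mem k1 (h.upperUnipotent_neg_mem k2) rfl
  have k10 := upperUnipotent_add_mem k3 (h.upperUnipotent_neg_mem k4) rfl
  have k11 := upperUnipotent_add_mem k7 (h.upperUnipotent_neg_mem k8) rfl
  have k12 := upperUnipotent_add_mem k9 k10 rfl
  have he : (l₁ - l₂) * x + ((p₁ - p₂) + p₀ * (l₁ - l₂)) * y =
    l₁ * x + -(l₂ * x) + (y * p₁ + -(y * p₂)) + (y * (l₁ * p₀) + -(y * (l₂ * p₀))) := by
    ring
  rw [he]
  exact upperUnipotent_add_mem k12 k11 (by omega)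

set_option maxHeartbeats 1000000 in
/-- The upper triangular part of an approximate subgroup of `SL₂` is covered by few lines. -/
theorem IsApproxGroup.covered_upperTriangular (h : IsApproxGroup H κ) {T : ℕ}
    (hT : ∀ k : ℕ, 0 < k → k ≤ T → (k : F) ≠ 0) (hH : #(H ^ 8) ^ 4 ≤ T) :
    CoveredByLines {m | ∃ g ∈ H ^ 2, g 1 0 = 0 ∧ g.1 = m} κ := by
  set E : Finset (SL2 F) := {g ∈ H ^ 2 | g 1 0 = 0} with hE
  set Λ : Finset F := E.image (fun g => (g 0 0) ^ 2) with hΛ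
  have hdet : ∀ g ∈ E, g 0 0 * g 1 1 = 1 := by
    intro g hg
    have := sl2_det g
    rw [(mem_filter.1 hg).2] at this
    simpa using this
  by_cases hΛκ : (#Λ : ℝ) ≤ κ
  · let W : F → Submodule F (Matrix (Fin 2) (Fin 2) F) := fun l =>
      { carrier := {m | m 1 0 = 0 ∧ m 0 0 = l * m 1 1}
        add_mem' := by
          rintro x y ⟨h1, h2⟩ ⟨h3, h4⟩
          exact ⟨by simp [h1, h3], by simp [h2, h4, mul_add]⟩
        zero_mem' := by simp
        smul_mem' := by
          rintro c x ⟨h1, h2⟩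
          exact ⟨by simp [h1], by simp [h2]; ring⟩ }
    refine (coveredByLines_of_forall Λ W (fun l _ => ?_) ?_).mono subset_rfl hΛκ
    · refine finrank_le_two_of_injOn _
        ((Matrix.entryLinearMap F F 0 1).prod (Matrix.entryLinearMap F F 1 1)) ?_
      rintro m ⟨h1, h2⟩ h0
      have h01 : m 0 1 = 0 := congrArg Prod.fst h0
      have h11 : m 1 1 = 0 := congrArg Prod.snd h0
      rw [h11, mul_zero] at h2
      ext i j
      fin_cases i <;> fin_cases j <;> simp [h1, h2, h01, h11]
    · rintro m ⟨g, hg, hg0, rfl⟩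
      have hgE : g ∈ E := mem_filter.2 ⟨hg, hg0⟩
      refine ⟨_, mem_image_of_mem _ hgE, hg0, ?_⟩
      linear_combination -(g 0 0) * hdet g hgE
  push Not at hΛκ
  have hκ := h.one_le
  have hΛ1 : 1 < #Λ := by
    have : (1 : ℝ) < #Λ := by linarith
    exact_mod_cast this
  by_cases hP : ∀ p, upperUnipotent p ∈ H ^ 8 → p = 0
  · -- all commutators vanish
    obtain ⟨l, hl, hl1⟩ := exists_mem_ne hΛ1 1
    obtain ⟨e, he, rfl⟩ := mem_image.1 hl
    have had : e 0 0 - e 1 1 ≠ 0 := by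
      intro h0
      apply hl1
      linear_combination hdet e he + e 0 0 * h0
    have hcomm : ∀ g ∈ E, g * e = e * g := by
      intro g hg
      have hg2 := mem_filter.1 hg
      have he2 := mem_filter.1 he
      have hmem : g * e * g⁻¹ * e⁻¹ ∈ H ^ 8 :=
        mul_mem_pow_add (mul_mem_pow_add (mul_mem_pow_add hg2.1 he2.1) (h.inv_mem_pow hg2.1))
          (h.inv_mem_pow he2.1)
      have h10 : (g * e * g⁻¹ * e⁻¹) 1 0 = 0 := by
        simp [sl2_mul, sl2_inv, hg2.2, he2.2]
      have h00 : (g * e * g⁻¹ * e⁻¹) 0 0 = 1 := by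
        simp only [sl2_mul, sl2_inv, hg2.2, he2.2]
        linear_combination (e 0 0 * e 1 1) * hdet g hg + hdet e he
      have h1 := eq_upperUnipotent h10 h00
      rw [hP ((g * e * g⁻¹ * e⁻¹) 0 1) (h1 ▸ hmem)] at h1
      have h2 : upperUnipotent (0 : F) = 1 := by
        apply sl2_ext <;> simp
      rw [h2, mul_inv_eq_one, mul_inv_eq_iff_eq_mul] at h1
      exact h1
    let W : Submodule F (Matrix (Fin 2) (Fin 2) F) :=
      { carrier := {m | m 1 0 = 0 ∧ m 0 1 * (e 0 0 - e 1 1) = e 0 1 * (m 0 0 - m 1 1)}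
        add_mem' := by
          rintro x y ⟨h1, h2⟩ ⟨h3, h4⟩
          refine ⟨by simp [h1, h3], ?_⟩
          simp only [Matrix.add_apply]
          linear_combination h2 + h4
        zero_mem' := by simp
        smul_mem' := by
          rintro c x ⟨h1, h2⟩
          refine ⟨by simp [h1], ?_⟩
          simp only [Matrix.smul_apply, smul_eq_mul]
          linear_combination c * h2 }
    refine (coveredByLines_submodule W ?_).mono ?_ hκ
    · refine finrank_le_two_of_injOn _
        ((Matrix.entryLinearMap F F 0 0).prod (Matrix.entryLinearMap F F 1 1)) ?_
      rintro m ⟨h1, h2⟩ h0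
      have h00 : m 0 0 = 0 := congrArg Prod.fst h0
      have h11 : m 1 1 = 0 := congrArg Prod.snd h0
      rw [h00, h11, sub_zero, mul_zero] at h2
      have h3 := (mul_eq_zero.1 h2).resolve_right had
      ext i j
      fin_cases i <;> fin_cases j <;> simp [h1, h3, h00, h11]
    · rintro m ⟨g, hg, hg0, rfl⟩
      have := congrArg (fun g : SL2 F => g 0 1) (hcomm g (mem_filter.2 ⟨hg, hg0⟩))
      simp only [sl2_mul] at this
      refine ⟨hg0, ?_⟩
      linear_combination -this
  · exfalso
    push Not at hP
    obtain ⟨p₀, hp₀, hp₀0⟩ := hP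
    set U : SL2 F → Prop := fun g => g 1 0 = 0 ∧ g 0 0 = 1 with hU
    set P : Finset F := ({g ∈ H ^ 8 | U g} : Finset (SL2 F)).image (fun g => g 0 1) with hPdef
    have hPmem : ∀ p ∈ P, upperUnipotent p ∈ H ^ 8 := by
      intro p hp
      obtain ⟨g, hg, rfl⟩ := mem_image.1 hp
      obtain ⟨hg8, hg10, hg00⟩ := mem_filter.1 hg
      rwa [← eq_upperUnipotent hg10 hg00]
    have hPcard : #P = #{g ∈ H ^ 8 | U g} := by
      refine card_image_of_injOn ?_
      intro g hg g' hg' heq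
      simp only [coe_filter, Set.mem_ofPred_eq] at hg hg' heq
      rw [eq_upperUnipotent hg.2.1 hg.2.2, eq_upperUnipotent hg'.2.1 hg'.2.2, heq]
    have hPne : P.Nonempty := by
      refine ⟨0, mem_image.2 ⟨1, mem_filter.2 ⟨h.one_mem_pow 8, ?_⟩, ?_⟩⟩ <;> simp [hU]
    have hP8 : #P ≤ #(H ^ 8) := hPcard.trans_le (card_filter_le _ _)
    have hΛ8 : #Λ ≤ #(H ^ 8) :=
      card_image_le.trans ((card_filter_le _ _).trans (card_le_card (h.pow_mono (by norm_num))))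
    have hsize : #P ^ 2 * #Λ ^ 2 ≤ T := by
      refine le_trans ?_ hH
      calc #P ^ 2 * #Λ ^ 2 ≤ #(H ^ 8) ^ 2 * #(H ^ 8) ^ 2 := by gcongr
        _ = _ := by ring
    obtain ⟨p₁, hp₁, p₂, hp₂, l₁, hl₁, l₂, hl₂, hinj⟩ :=
      exists_injOn_pivot hT hsize hPne hΛ1 hp₀0
    obtain ⟨N, hN⟩ : ∃ N, 6 * 8 + 32 = N := ⟨80, rfl⟩
    have h1 : #(P ×ˢ Λ) ≤ #{g ∈ H ^ N | U g} := by
      refine card_le_card_of_injOn (fun z => upperUnipotent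
        ((l₁ - l₂) * z.1 + ((p₁ - p₂) + p₀ * (l₁ - l₂)) * z.2)) ?_ ?_
      · rintro ⟨x, y⟩ hz
        have hz' : (x, y) ∈ P ×ˢ Λ := hz
        rw [mem_product] at hz'
        have hx := hPmem x hz'.1
        have hy : y ∈ Λ := hz'.2
        have hp₁ := hPmem _ hp₁
        have hp₂ := hPmem _ hp₂
        rw [mem_coe, mem_filter]
        refine ⟨?_, (upperUnipotent_apply _).2.2.1, (upperUnipotent_apply _).1⟩
        exact h.upperUnipotent_pivot_mem hl₁ hl₂ hy hx hp₁ hp₂ hp₀ hN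
      · intro z hz z' hz' heq
        exact hinj hz hz' (upperUnipotent_injective heq)
    have h2 := h.card_slice_le U (fun x y hx hy => by
      obtain ⟨hx1, hx2⟩ := hx
      obtain ⟨hy1, hy2⟩ := hy
      have := sl2_det y
      rw [hy1, hy2] at this
      simp only [hU, sl2_mul, sl2_inv, hx1, hx2, hy1]
      refine ⟨by ring, ?_⟩
      linear_combination this) (k := N) (by omega)
    have h3 : (#{g ∈ H ^ 2 | U g} : ℝ) ≤ #P := by
      rw [hPcard]
      exact_mod_cast card_le_card (filter_subset_filter _ (h.pow_mono (by norm_num)))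
    rw [card_product] at h1
    have h4 : (#P : ℝ) * #Λ ≤ #{g ∈ H ^ N | U g} := by exact_mod_cast h1
    have hP0 : (0 : ℝ) < #P := by exact_mod_cast hPne.card_pos
    have h5 : (#Λ : ℝ) * #P ≤ κ * #P := by
      calc _ = (#P : ℝ) * #Λ := by ring
        _ ≤ _ := h4
        _ ≤ _ := h2
        _ ≤ _ := by gcongr
    exact absurd (le_of_mul_le_mul_right h5 hP0) (not_le.2 hΛκ)

end Borel

section Trace

open Finset Pointwise

variable {F : Type u} [Field F]

/-- The trace on `SL₂(F)`. -/
def sl2Trace (g : SL2 F) : F := g 0 0 + g 1 1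

/-- Diagonal elements of `SL₂(F)`. -/
def IsDiagonal (g : SL2 F) : Prop := g 0 1 = 0 ∧ g 1 0 = 0

instance [DecidableEq F] : DecidablePred (IsDiagonal (F := F)) := fun _ => instDecidableAnd

theorem IsDiagonal.det {g : SL2 F} (h : IsDiagonal g) : g 0 0 * g 1 1 = 1 := by
  have := sl2_det g
  rw [h.1] at this
  linear_combination this

theorem isDiagonal_one : IsDiagonal (1 : SL2 F) := ⟨sl2_one.2.1, sl2_one.2.2.1⟩

theorem IsDiagonal.mul {g h : SL2 F} (hg : IsDiagonal g) (hh : IsDiagonal h) :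
    IsDiagonal (g * h) := by
  constructor <;> simp [sl2_mul, hg.1, hg.2, hh.1, hh.2]

theorem IsDiagonal.inv {g : SL2 F} (hg : IsDiagonal g) : IsDiagonal g⁻¹ := by
  constructor <;> simp [sl2_inv, hg.1, hg.2]

theorem sl2Trace_mul_comm (g h : SL2 F) : sl2Trace (g * h) = sl2Trace (h * g) := by
  simp only [sl2Trace, sl2_mul]
  ring

theorem sl2Trace_conj (x g : SL2 F) : sl2Trace (x⁻¹ * g * x) = sl2Trace g := by
  rw [sl2Trace_mul_comm, ← mul_assoc, mul_inv_cancel, one_mul]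

theorem sl2Trace_conj' (x g : SL2 F) : sl2Trace (x * g * x⁻¹) = sl2Trace g := by
  simpa using sl2Trace_conj x⁻¹ g

theorem sl2_ne_of_trace {g : SL2 F} (h10 : g 1 0 = 0) (h2 : sl2Trace g ≠ 2)
    (h2' : sl2Trace g ≠ -2) : g 0 0 ≠ g 1 1 := by
  intro h
  have hd := sl2_det g
  rw [h10, ← h] at hd
  have : (g 0 0 - 1) * (g 0 0 + 1) = 0 := by linear_combination hd
  rcases mul_eq_zero.1 this with h0 | h0
  · apply h2
    rw [sl2Trace, ← h]
    linear_combination 2 * h0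
  · apply h2'
    rw [sl2Trace, ← h]
    linear_combination 2 * h0

theorem exists_conj_upperTriangular [IsAlgClosed F] (h2 : (2 : F) ≠ 0) (g : SL2 F) :
    ∃ x : SL2 F, (x⁻¹ * g * x) 1 0 = 0 := by
  by_cases hc : g 1 0 = 0
  · exact ⟨1, by simpa using hc⟩
  · have : NeZero (2 : F) := ⟨h2⟩
    obtain ⟨s, hs⟩ := IsAlgClosed.exists_eq_mul_self (discrim (g 1 0) (g 1 1 - g 0 0) (-(g 0 1)))
    obtain ⟨r, hr⟩ := exists_quadratic_eq_zero hc ⟨s, hs⟩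
    obtain ⟨x, h00, h01, h10, h11⟩ : ∃ x : SL2 F, x 0 0 = r ∧ x 0 1 = -1 ∧ x 1 0 = 1 ∧ x 1 1 = 0 :=
      ⟨⟨!![r, -1; 1, 0], by simp⟩, rfl, rfl, rfl, rfl⟩
    refine ⟨x, ?_⟩
    simp only [sl2_mul, sl2_inv, h00, h10]
    linear_combination hr

theorem exists_conj_isDiagonal [IsAlgClosed F] (hF : (2 : F) ≠ 0) {g : SL2 F}
    (h2 : sl2Trace g ≠ 2) (h2' : sl2Trace g ≠ -2) :
    ∃ x : SL2 F, ∀ h, h * g = g * h → IsDiagonal (x⁻¹ * h * x) := by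
  obtain ⟨y, hy⟩ := exists_conj_upperTriangular hF g
  set k := y⁻¹ * g * y with hk
  have hne : k 0 0 - k 1 1 ≠ 0 := sub_ne_zero.2 <| sl2_ne_of_trace hy
    (by rwa [hk, sl2Trace_conj]) (by rwa [hk, sl2Trace_conj])
  set z := upperUnipotent (-(k 0 1) / (k 0 0 - k 1 1)) with hz
  set l := z⁻¹ * k * z with hl
  have hl10 : l 1 0 = 0 := by simp [hl, hz, sl2_mul, sl2_inv, hy]
  have hl01 : l 0 1 = 0 := by
    simp [hl, hz, sl2_mul, sl2_inv, hy]
    field_simp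
    ring
  have hlg : l = (y * z)⁻¹ * g * (y * z) := by
    rw [hl, hk]
    group
  have hlne : l 0 0 - l 1 1 ≠ 0 := sub_ne_zero.2 <| sl2_ne_of_trace hl10
    (by rwa [hlg, sl2Trace_conj]) (by rwa [hlg, sl2Trace_conj])
  refine ⟨y * z, fun h hh => ?_⟩
  set m := (y * z)⁻¹ * h * (y * z) with hm
  have hcomm : m * l = l * m := by
    rw [hm, hlg]
    have : (y * z)⁻¹ * h * (y * z) * ((y * z)⁻¹ * g * (y * z)) =
      (y * z)⁻¹ * (h * g) * (y * z) := by group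
    rw [this, hh]
    group
  have e01 := congrArg (fun g : SL2 F => g 0 1) hcomm
  have e10 := congrArg (fun g : SL2 F => g 1 0) hcomm
  simp only [sl2_mul, hl10, hl01, mul_zero, zero_mul, add_zero, zero_add] at e01 e10
  constructor
  · have : m 0 1 * (l 0 0 - l 1 1) = 0 := by linear_combination -e01
    exact (mul_eq_zero.1 this).resolve_right hlne
  · have : m 1 0 * (l 0 0 - l 1 1) = 0 := by linear_combination e10
    exact (mul_eq_zero.1 this).resolve_right hlne

theorem CoveredByLines.translate {A B : Set (SL2 F)} {n : ℝ}
    (h : CoveredByLines {m | ∃ g ∈ A, g.1 = m} n) (x y : SL2 F) (hB : ∀ g ∈ B, x * g * y ∈ A) :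
    CoveredByLines {m | ∃ g ∈ B, g.1 = m} n := by
  refine h.comap (LinearMap.mulRight F y.1 ∘ₗ LinearMap.mulLeft F x.1) ?_ ?_
  · intro m m' hmm
    simp only [LinearMap.coe_comp, Function.comp_apply, LinearMap.mulRight_apply,
      LinearMap.mulLeft_apply] at hmm
    have hx : (x⁻¹).1 * x.1 = 1 := by
      rw [← Matrix.SpecialLinearGroup.coe_mul, inv_mul_cancel, Matrix.SpecialLinearGroup.coe_one]
    have hy : y.1 * (y⁻¹).1 = 1 := by
      rw [← Matrix.SpecialLinearGroup.coe_mul, mul_inv_cancel, Matrix.SpecialLinearGroup.coe_one]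
    have := congrArg (fun z => (x⁻¹).1 * z * (y⁻¹).1) hmm
    simp only [Matrix.mul_assoc] at this
    rw [hy, Matrix.mul_one, Matrix.mul_one, ← Matrix.mul_assoc, ← Matrix.mul_assoc, hx,
      Matrix.one_mul, Matrix.one_mul] at this
    exact this
  · rintro m ⟨g, hg, rfl⟩
    exact ⟨_, hB g hg, by simp⟩

/-- The line of projective space spanned by the identity and `upperUnipotent 1`. -/
theorem coveredByLines_upper_scalar :
    CoveredByLines {m : Matrix (Fin 2) (Fin 2) F | m 1 0 = 0 ∧ m 0 0 = m 1 1} 1 := by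
  let W : Submodule F (Matrix (Fin 2) (Fin 2) F) :=
    { carrier := {m | m 1 0 = 0 ∧ m 0 0 = m 1 1}
      add_mem' := by
        rintro x y ⟨h1, h2⟩ ⟨h3, h4⟩
        exact ⟨by simp [h1, h3], by simp [h2, h4]⟩
      zero_mem' := by simp
      smul_mem' := by
        rintro c x ⟨h1, h2⟩
        exact ⟨by simp [h1], by simp [h2]⟩ }
  refine coveredByLines_submodule W (finrank_le_two_of_injOn _
    ((Matrix.entryLinearMap F F 0 1).prod (Matrix.entryLinearMap F F 1 1)) ?_)
  rintro m ⟨h1, h2⟩ h0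
  have h01 : m 0 1 = 0 := congrArg Prod.fst h0
  have h11 : m 1 1 = 0 := congrArg Prod.snd h0
  ext i j
  fin_cases i <;> fin_cases j <;> simp [h1, h2, h01, h11]

end Trace

section Product

open Finset Pointwise

variable {F : Type u} [Field F]

theorem sl2_w : ∃ w : SL2 F, w 0 0 = 0 ∧ w 0 1 = 1 ∧ w 1 0 = -1 ∧ w 1 1 = 0 :=
  ⟨⟨!![0, 1; -1, 0], by simp⟩, rfl, rfl, rfl, rfl⟩

variable [DecidableEq F] {H : Finset (SL2 F)} {κ : ℝ}

/-- The image of an approximate subgroup under conjugation. -/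
theorem conj_image_pow (x : SL2 F) (k : ℕ) :
    (H.image (MulAut.conj x)) ^ k = (H ^ k).image (MulAut.conj x) := by
  rw [image_pow]

theorem mem_conj_image_pow {x g : SL2 F} {k : ℕ} :
    g ∈ (H.image (MulAut.conj x)) ^ k ↔ x⁻¹ * g * x ∈ H ^ k := by
  rw [conj_image_pow, mem_image]
  constructor
  · rintro ⟨h, hh, rfl⟩
    convert hh using 1
    rw [MulAut.conj_apply]
    group
  · intro h
    refine ⟨_, h, ?_⟩
    rw [MulAut.conj_apply]
    group

theorem card_conj_image_pow (x : SL2 F) (k : ℕ) :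
    #((H.image (MulAut.conj x)) ^ k) = #(H ^ k) := by
  rw [conj_image_pow, card_image_of_injective _ (MulAut.conj x).injective]

theorem IsApproxGroup.covered_lowerTriangular (h : IsApproxGroup H κ) {T : ℕ}
    (hT : ∀ k : ℕ, 0 < k → k ≤ T → (k : F) ≠ 0) (hH : #(H ^ 8) ^ 4 ≤ T) :
    CoveredByLines {m | ∃ g ∈ H ^ 2, g 0 1 = 0 ∧ g.1 = m} κ := by
  obtain ⟨w, w00, w01, w10, w11⟩ := sl2_w (F := F)
  have h1 := (h.map (MulAut.conj w)).covered_upperTriangular hT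
    (by rwa [card_conj_image_pow])
  have h2 : CoveredByLines {m | ∃ g ∈ {g : SL2 F | g ∈ (H.image (MulAut.conj w)) ^ 2 ∧ g 1 0 = 0},
      g.1 = m} κ :=
    h1.mono (by rintro m ⟨g, ⟨hg, hg'⟩, rfl⟩; exact ⟨g, hg, hg', rfl⟩) le_rfl
  refine (h2.translate (B := {g | g ∈ H ^ 2 ∧ g 0 1 = 0}) w w⁻¹ ?_).mono ?_ le_rfl
  · rintro g ⟨hg, hg'⟩
    refine ⟨mem_conj_image_pow.2 ?_, ?_⟩
    · convert hg using 1
      group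
    · simp [sl2_mul, sl2_inv, w10, w11, hg']
  · rintro m ⟨g, hg, hg', rfl⟩
    exact ⟨g, ⟨hg, hg'⟩, rfl⟩

/-- If every element of `H` has a vanishing entry, then `H` is covered by few lines. -/
theorem IsApproxGroup.covered_of_exists_entry_eq_zero (h : IsApproxGroup H κ) {T : ℕ}
    (hT : ∀ k : ℕ, 0 < k → k ≤ T → (k : F) ≠ 0) (hH : #(H ^ 8) ^ 4 ≤ T)
    (h0 : ∀ g ∈ H, g 0 0 = 0 ∨ g 0 1 = 0 ∨ g 1 0 = 0 ∨ g 1 1 = 0) :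
    CoveredByLines {m | ∃ g ∈ H, g.1 = m} (4 * κ) := by
  have hκ : 0 ≤ κ := zero_le_one.trans h.one_le
  have hdiv : ∀ {g g' : SL2 F}, g ∈ H → g' ∈ H → g⁻¹ * g' ∈ H ^ 2 := by
    intro g g' hg hg'
    rw [sq]
    refine mul_mem_mul ?_ hg'
    rw [← h.inv_eq]
    exact inv_mem_inv hg
  have key : ∀ (p q : SL2 F → Prop), (∀ g g', p g → p g' → q (g⁻¹ * g')) →
      CoveredByLines {m | ∃ g ∈ H ^ 2, q g ∧ g.1 = m} κ →
      CoveredByLines {m | ∃ g ∈ {g | g ∈ H ∧ p g}, g.1 = m} κ := by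
    intro p q hpq hq
    by_cases hp : ∃ g ∈ H, p g
    · obtain ⟨g, hg, hpg⟩ := hp
      have h2 : CoveredByLines {m | ∃ g ∈ {g | g ∈ H ^ 2 ∧ q g}, g.1 = m} κ :=
        hq.mono (by rintro m ⟨g, ⟨hg, hg'⟩, rfl⟩; exact ⟨g, hg, hg', rfl⟩) le_rfl
      refine h2.translate g⁻¹ 1 ?_
      rintro g' ⟨hg', hpg'⟩
      rw [mul_one]
      exact ⟨hdiv hg hg', hpq _ _ hpg hpg'⟩
    · push Not at hp
      exact ⟨∅, by simpa using hκ, by simp, by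
        rintro m ⟨g, ⟨hg, hg'⟩, rfl⟩
        exact absurd hg' (hp g hg)⟩
  have hu := h.covered_upperTriangular hT hH
  have hl := h.covered_lowerTriangular hT hH
  have k1 := key (fun g => g 0 0 = 0) (fun g => g 1 0 = 0) (by
    intro g g' hg hg'
    simp [sl2_mul, sl2_inv, hg, hg']) hu
  have k2 := key (fun g => g 0 1 = 0) (fun g => g 0 1 = 0) (by
    intro g g' hg hg'
    simp [sl2_mul, sl2_inv, hg, hg']) hl
  have k3 := key (fun g => g 1 0 = 0) (fun g => g 1 0 = 0) (by
    intro g g' hg hg'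
    simp [sl2_mul, sl2_inv, hg, hg']) hu
  have k4 := key (fun g => g 1 1 = 0) (fun g => g 0 1 = 0) (by
    intro g g' hg hg'
    simp [sl2_mul, sl2_inv, hg, hg']) hl
  refine (((k1.union k2).union k3).union k4).mono ?_ (by linarith)
  rintro m ⟨g, hg, rfl⟩
  rcases h0 g hg with h0 | h0 | h0 | h0
  · exact Or.inl (Or.inl (Or.inl ⟨g, ⟨hg, h0⟩, rfl⟩))
  · exact Or.inl (Or.inl (Or.inr ⟨g, ⟨hg, h0⟩, rfl⟩))
  · exact Or.inl (Or.inr ⟨g, ⟨hg, h0⟩, rfl⟩)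
  · exact Or.inr ⟨g, ⟨hg, h0⟩, rfl⟩

/-- An approximate subgroup without regular semisimple elements lies on a line. -/
theorem IsApproxGroup.covered_of_trace_eq [IsAlgClosed F] (h : IsApproxGroup H κ)
    (hF : (2 : F) ≠ 0) (htr : ∀ g ∈ H ^ 4, sl2Trace g = 2 ∨ sl2Trace g = -2) :
    CoveredByLines {m | ∃ g ∈ H, g.1 = m} 1 := by
  have h4 : (4 : F) ≠ 0 := by
    have : (4 : F) = 2 * 2 := by norm_num
    rw [this]
    exact mul_ne_zero hF hF
  have h8 : (8 : F) ≠ 0 := by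
    have : (8 : F) = 2 * 4 := by norm_num
    rw [this]
    exact mul_ne_zero hF h4
  have hH1 : ∀ g ∈ H, g ∈ H ^ 1 := fun g hg => by rwa [pow_one]
  suffices ∃ x : SL2 F, ∀ g ∈ H, (x⁻¹ * g * x) 1 0 = 0 by
    obtain ⟨x, hx⟩ := this
    refine (CoveredByLines.translate (A := {g : SL2 F | g 1 0 = 0 ∧ g 0 0 = g 1 1}) (n := 1)
      ?_ x⁻¹ x ?_)
    · refine coveredByLines_upper_scalar.mono ?_ le_rfl
      rintro m ⟨g, hg, rfl⟩
      exact hg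
    · intro g hg
      refine ⟨hx g hg, ?_⟩
      by_contra hne
      have hd := sl2_det (x⁻¹ * g * x)
      rw [hx g hg] at hd
      have ht := htr g (h.pow_mono (by norm_num) (hH1 g hg))
      rw [← sl2Trace_conj x g] at ht
      generalize x⁻¹ * g * x = k at *
      apply sub_ne_zero.2 hne
      rw [← sq_eq_zero_iff]
      rw [sl2Trace] at ht
      have : (k 0 0 + k 1 1) ^ 2 = 4 := by
        rcases ht with ht | ht <;> rw [ht] <;> norm_num
      linear_combination this - 4 * hd
  by_cases hu : ∃ u ∈ H, u ≠ 1 ∧ u ≠ -1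
  · obtain ⟨u, hu, hu1, hu2⟩ := hu
    obtain ⟨x, hx⟩ := exists_conj_upperTriangular hF u
    refine ⟨x, fun g hg => ?_⟩
    set v := x⁻¹ * u * x with hv
    set k := x⁻¹ * g * x with hk
    have t1 := htr _ (h.pow_mono (by norm_num) (hH1 u hu))
    have t2 := htr _ (h.pow_mono (by norm_num) (hH1 g hg))
    have t3 := htr _ (h.pow_mono (by norm_num) (mul_mem_pow_add (hH1 u hu) (hH1 g hg)))
    have t4 := htr _ (h.pow_mono (by norm_num)
      (mul_mem_pow_add (mul_mem_pow_add (hH1 u hu) (hH1 u hu)) (hH1 g hg)))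
    rw [← sl2Trace_conj x] at t1 t2 t3 t4
    have e3 : x⁻¹ * (u * g) * x = v * k := by rw [hv, hk]; group
    have e4 : x⁻¹ * (u * u * g) * x = v * v * k := by rw [hv, hk]; group
    rw [← hv] at t1
    rw [← hk] at t2
    rw [e3] at t3
    rw [e4] at t4
    have hd := sl2_det v
    rw [hx] at hd
    have hdiag : v 0 0 = v 1 1 := by
      rw [← sub_eq_zero, ← sq_eq_zero_iff]
      rw [sl2Trace] at t1
      have : (v 0 0 + v 1 1) ^ 2 = 4 := by
        rcases t1 with ht | ht <;> rw [ht] <;> norm_num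
      linear_combination this - 4 * hd
    have hsq : (v 0 0 - 1) * (v 0 0 + 1) = 0 := by
      linear_combination hd + v 0 0 * hdiag
    have hb : v 0 1 ≠ 0 := by
      intro hb
      have huv : u = x * v * x⁻¹ := by rw [hv]; group
      rcases mul_eq_zero.1 hsq with h0 | h0
      · apply hu1
        have : v = 1 := by
          apply sl2_ext <;> simp [hb, hx]
          · linear_combination h0
          · linear_combination h0 - hdiag
        rw [huv, this]
        group
      · apply hu2
        have : v = -1 := by
          apply sl2_ext <;> simp [hb, hx]
          · linear_combination h0
          · linear_combination h0 - hdiag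
        rw [huv, this]
        simp
    have h1 : (v 0 0) ^ 2 = 1 := by linear_combination hsq
    simp only [sl2Trace, sl2_mul, hx, ← hdiag, zero_mul, mul_zero, add_zero, zero_add] at t2 t3 t4
    by_contra hc
    have hbc := mul_ne_zero hb hc
    have sq_eq : ∀ {z : F}, z = 2 ∨ z = -2 → z ^ 2 = 4 := by
      rintro z (rfl | rfl) <;> norm_num
    have q2 := sq_eq t2
    have q3 := sq_eq t3
    have q4 := sq_eq t4
    have r3 : v 0 1 * k 1 0 * (2 * v 0 0 * (k 0 0 + k 1 1) + v 0 1 * k 1 0) = 0 := by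
      linear_combination q3 - (v 0 0) ^ 2 * q2 - 4 * h1
    have r4 : v 0 1 * k 1 0 * (4 * (v 0 0 * (k 0 0 + k 1 1) + v 0 1 * k 1 0)) = 0 := by
      linear_combination q4 - (v 0 0) ^ 4 * q2 - 4 * ((v 0 0) ^ 2 + 1) * h1 -
        4 * v 0 1 * k 1 0 * (v 0 0 * (k 0 0 + k 1 1) + v 0 1 * k 1 0) * h1
    have s3 := (mul_eq_zero.1 r3).resolve_left hbc
    have s4 := (mul_eq_zero.1 ((mul_eq_zero.1 r4).resolve_left hbc)).resolve_left h4
    have s5 : v 0 0 * (k 0 0 + k 1 1) = 0 := by linear_combination s3 - s4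
    apply h4
    linear_combination -q2 - (k 0 0 + k 1 1) ^ 2 * h1 + v 0 0 * (k 0 0 + k 1 1) * s5
  · push Not at hu
    refine ⟨1, fun g hg => ?_⟩
    by_cases hg1 : g = 1
    · simp [hg1]
    · simp [hu g hg hg1]

end Product

section Torus

open Finset Pointwise

variable {F : Type u} [Field F] [DecidableEq F] {H : Finset (SL2 F)} {κ : ℝ}

/-- The number of traces is controlled by the size of the largest torus slice. -/
theorem IsApproxGroup.card_trace_le [IsAlgClosed F] (h : IsApproxGroup H κ) (hF : (2 : F) ≠ 0)
    {L : ℕ} (hL : ∀ x : SL2 F, #{g ∈ H ^ 4 | IsDiagonal (x⁻¹ * g * x)} ≤ L) {k : ℕ} (hk : k < 99) :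
    (#((H ^ k).image sl2Trace) : ℝ) ≤ κ * L + 2 := by
  set Θ := ((H ^ k).image sl2Trace) \ {2, -2} with hΘ
  have hrep : ∀ t : F, ∃ g : SL2 F, t ∈ Θ → g ∈ H ^ k ∧ sl2Trace g = t := by
    intro t
    by_cases ht : t ∈ Θ
    · obtain ⟨g, hg, hgt⟩ := mem_image.1 (mem_sdiff.1 ht).1
      exact ⟨g, fun _ => ⟨hg, hgt⟩⟩
    · exact ⟨1, fun h => absurd h ht⟩
  choose r hr using hrep
  have h1 : #(Θ ×ˢ H) ≤ L * #(H ^ (k + 2)) := by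
    refine card_le_mul_card_image_of_maps_to (f := fun z => z.2 * r z.1 * z.2⁻¹) ?_ _ ?_
    · rintro ⟨t, g⟩ hz
      obtain ⟨ht, hg⟩ := mem_product.1 hz
      have e : k + 2 = 1 + k + 1 := by ring
      rw [e]
      have hg1 : g ∈ H ^ 1 := by rwa [pow_one]
      exact mul_mem_pow_add (mul_mem_pow_add hg1 (hr t ht).1) (h.inv_mem_pow hg1)
    · intro z _
      rcases eq_empty_or_nonempty {a ∈ Θ ×ˢ H | a.2 * r a.1 * a.2⁻¹ = z} with h0 | ⟨⟨t₀, g₀⟩, h0⟩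
      · rw [h0]
        simp
      · obtain ⟨h0, hz0⟩ := mem_filter.1 h0
        obtain ⟨ht0, hg0⟩ := mem_product.1 h0
        have hrt := hr t₀ ht0
        have htr : sl2Trace (r t₀) ≠ 2 ∧ sl2Trace (r t₀) ≠ -2 := by
          rw [hrt.2]
          have := (mem_sdiff.1 ht0).2
          simpa using this
        obtain ⟨x, hx⟩ := exists_conj_isDiagonal hF htr.1 htr.2
        refine le_trans ?_ (hL x)
        have htt : ∀ t g, (t, g) ∈ ({a ∈ Θ ×ˢ H | a.2 * r a.1 * a.2⁻¹ = z} : Finset _) →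
            t = t₀ ∧ g ∈ H ∧ g * r t₀ * g⁻¹ = z := by
          intro t g hz
          obtain ⟨hz1, hz2⟩ := mem_filter.1 hz
          obtain ⟨ht, hg⟩ := mem_product.1 hz1
          have : t = t₀ := by
            rw [← (hr t ht).2, ← hrt.2, ← sl2Trace_conj' g, ← sl2Trace_conj' g₀ (r t₀)]
            exact congrArg sl2Trace (hz2.trans hz0.symm)
          subst this
          exact ⟨rfl, hg, hz2⟩
        refine card_le_card_of_injOn (fun a => g₀⁻¹ * a.2) ?_ ?_
        · rintro ⟨t, g⟩ hz
          obtain ⟨rfl, hg, hgz⟩ := htt t g hz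
          rw [mem_coe, mem_filter]
          refine ⟨h.pow_mono (a := 2) (by norm_num) ?_, hx _ ?_⟩
          · rw [sq]
            refine mul_mem_mul ?_ hg
            rw [← h.inv_eq]
            exact inv_mem_inv hg0
          · have h3 : g * r t * g⁻¹ = g₀ * r t * g₀⁻¹ := hgz.trans hz0.symm
            have h4 : g * r t = g₀ * r t * g₀⁻¹ * g := by
              rw [← h3]
              group
            change g₀⁻¹ * g * r t = r t * (g₀⁻¹ * g)
            rw [mul_assoc, h4]
            group
        · rintro ⟨t, g⟩ hz ⟨t', g'⟩ hz' heq
          obtain ⟨rfl, hg, hgz⟩ := htt t g hz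
          obtain ⟨rfl, hg', hgz'⟩ := htt t' g' hz'
          have := mul_left_cancel heq
          simp only at this
          rw [this]
  rw [card_product] at h1
  have h2 : (#Θ : ℝ) * #H ≤ (κ * L) * #H := by
    calc (#Θ : ℝ) * #H ≤ L * #(H ^ (k + 2)) := by exact_mod_cast h1
      _ ≤ L * (κ * #H) := by
        exact mul_le_mul_of_nonneg_left (h.card_pow_le (k + 2) (by omega)) (Nat.cast_nonneg _)
      _ = _ := by ring
  have h3 := le_of_mul_le_mul_right h2 h.card_pos
  have h4 : #((H ^ k).image sl2Trace) ≤ #Θ + 2 := by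
    have h5 : (H ^ k).image sl2Trace ⊆ Θ ∪ {2, -2} := by
      rw [hΘ, sdiff_union_self_eq_union]
      exact subset_union_left
    exact ((card_le_card h5).trans (card_union_le _ _)).trans (Nat.add_le_add_left card_le_two _)
  have h5 : (#((H ^ k).image sl2Trace) : ℝ) ≤ #Θ + 2 := by exact_mod_cast h4
  linarith

end Torus

section SumProduct

open Finset Pointwise

variable {F : Type u} [Field F] [DecidableEq F]

/-- A sum-product estimate. -/
theorem card_le_of_sub_le {T : ℕ} (hT : ∀ k : ℕ, 0 < k → k ≤ T → (k : F) ≠ 0)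
    {P P' : Finset F} (hPP : P ⊆ P') (hP : P.Nonempty)
    (hmul : ∀ x ∈ P, ∀ y ∈ P, ∃ r ∈ P', ∃ s ∈ P', x * y = r + s)
    {α β : F} (hα : α ≠ 0) (hβ : β ≠ 0) {M : ℝ} (hM : 1 ≤ M)
    (hX : (#(P'.image (α * ·) - P'.image (β * ·)) : ℝ) ≤ M * #P) (hcard : #P ^ 4 ≤ T) :
    (#P : ℝ) ≤ M ^ 13 := by
  by_cases h1 : 1 < #P
  swap
  · have : (#P : ℝ) ≤ 1 := by exact_mod_cast not_lt.1 h1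
    exact this.trans (one_le_pow₀ hM)
  obtain ⟨a₁, ha₁, a₂, ha₂, b₁, hb₁, b₂, hb₂, hinj⟩ := exists_injOn_pivot hT (A := P) (B := P)
    (le_trans (le_of_eq (by ring)) hcard) hP h1 (one_ne_zero (α := F))
  set A := P'.image (α * ·) with hA
  set B := P'.image (β * ·) with hB
  have hAcard : #A = #P' := card_image_of_injective _ (mul_right_injective₀ hα)
  have hP' : P'.Nonempty := hP.mono hPP
  have hAne : A.Nonempty := hP'.image _
  have hprod : ∀ x ∈ P, ∀ y ∈ P, β * (x * y) ∈ 2 • B := by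
    intro x hx y hy
    obtain ⟨r, hr, s, hs, h⟩ := hmul x hx y hy
    rw [h, mul_add, two_nsmul]
    exact add_mem_add (mem_image_of_mem _ hr) (mem_image_of_mem _ hs)
  have h2 : #P * #P ≤ #(6 • B - 6 • B) := by
    rw [← card_product]
    refine card_le_card_of_injOn (fun z => β * ((b₁ - b₂) * z.1 +
      ((a₁ - a₂) + 1 * (b₁ - b₂)) * z.2)) ?_ ?_
    · rintro ⟨x, y⟩ hz
      rw [mem_coe, mem_product] at hz
      have hx : x ∈ P := hz.1
      have hy : y ∈ P := hz.2
      have e6 : (6 : ℕ) • B = 2 • B + 2 • B + 2 • B := by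
        rw [← add_nsmul, ← add_nsmul]
      have e : β * ((b₁ - b₂) * x + ((a₁ - a₂) + 1 * (b₁ - b₂)) * y) =
          (β * (b₁ * x) + β * (a₁ * y) + β * (b₁ * y)) -
          (β * (b₂ * x) + β * (a₂ * y) + β * (b₂ * y)) := by ring
      rw [mem_coe]
      change β * ((b₁ - b₂) * x + ((a₁ - a₂) + 1 * (b₁ - b₂)) * y) ∈ _
      rw [e, e6]
      exact sub_mem_sub
        (add_mem_add (add_mem_add (hprod _ hb₁ _ hx) (hprod _ ha₁ _ hy)) (hprod _ hb₁ _ hy))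
        (add_mem_add (add_mem_add (hprod _ hb₂ _ hx) (hprod _ ha₂ _ hy)) (hprod _ hb₂ _ hy))
    · intro z hz z' hz' heq
      exact hinj (by simpa using hz) (by simpa using hz') (mul_left_cancel₀ hβ heq)
  have h3 := pluennecke_ruzsa_inequality_nsmul_sub_nsmul_sub hAne B 6 6
  have h4 : (#(6 • B - 6 • B) : ℝ) ≤ ((#(A - B) : ℝ) / #A) ^ (6 + 6) * #A := by
    have := (NNRat.cast_le (K := ℝ)).2 h3
    push_cast at this
    exact this
  have h5 : #A ≤ #(A - B) := card_le_card_sub_right (hP'.image _)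
  have h6 : #P ≤ #A := by
    rw [hAcard]
    exact card_le_card hPP
  have h5' : (#A : ℝ) ≤ #(A - B) := by exact_mod_cast h5
  have h6' : (#P : ℝ) ≤ #A := by exact_mod_cast h6
  have h2' : (#P : ℝ) * #P ≤ #(6 • B - 6 • B) := by exact_mod_cast h2
  have hP0 : (0 : ℝ) < #P := by exact_mod_cast hP.card_pos
  generalize (#(6 • B - 6 • B) : ℝ) = Z at *
  generalize (#(A - B) : ℝ) = X at *
  generalize (#A : ℝ) = a at *
  generalize (#P : ℝ) = p at *
  have h7 : X / a ≤ M := by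
    rw [div_le_iff₀ (hP0.trans_le h6')]
    exact hX.trans (mul_le_mul_of_nonneg_left h6' (by linarith))
  have ha0 : 0 < a := hP0.trans_le h6'
  have h8 : (X / a) ^ (6 + 6) ≤ M ^ 12 :=
    pow_le_pow_left₀ (div_nonneg (ha0.le.trans h5') ha0.le) h7 12
  have h9 : p * p ≤ M ^ 13 * p := by
    calc p * p ≤ (X / a) ^ (6 + 6) * a := h2'.trans h4
      _ ≤ M ^ 12 * (M * p) := by
        exact mul_le_mul h8 (h5'.trans hX) ha0.le (by positivity)
      _ = _ := by ring
  exact le_of_mul_le_mul_right h9 hP0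

end SumProduct

section TorusBound

open Finset Pointwise

variable {F : Type u} [Field F]

theorem sl2_eq_of_trace {v g w w' : SL2 F} (hv : IsDiagonal v) (hv' : v 0 0 ≠ v 1 1)
    (hb : g 0 1 ≠ 0) (hc : g 1 0 ≠ 0) (h1 : sl2Trace w = sl2Trace w')
    (h2 : sl2Trace (v * w) = sl2Trace (v * w')) (h3 : sl2Trace (g * w) = sl2Trace (g * w'))
    (h4 : sl2Trace (v * (g * w)) = sl2Trace (v * (g * w'))) : w = w' := by
  have key : ∀ p q p' q' : F, p + q = p' + q' → v 0 0 * p + v 1 1 * q = v 0 0 * p' + v 1 1 * q' →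
      p = p' ∧ q = q' := by
    intro p q p' q' e1 e2
    have h0 : (v 0 0 - v 1 1) * (p - p') = 0 := by linear_combination e2 - v 1 1 * e1
    have hp := (mul_eq_zero.1 h0).resolve_left (sub_ne_zero.2 hv')
    exact ⟨by linear_combination hp, by linear_combination e1 - hp⟩
  have hvm : ∀ z : SL2 F, sl2Trace (v * z) = v 0 0 * z 0 0 + v 1 1 * z 1 1 := by
    intro z
    simp [sl2Trace, sl2_mul, hv.1, hv.2]
  rw [hvm, hvm] at h2 h4
  obtain ⟨e00, e11⟩ := key _ _ _ _ h1 h2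
  obtain ⟨e3, e4⟩ := key _ _ _ _ h3 h4
  simp only [sl2_mul, e00, e11] at e3 e4
  refine sl2_ext e00 ?_ ?_ e11
  · exact mul_left_cancel₀ hc (by linear_combination e4)
  · exact mul_left_cancel₀ hb (by linear_combination e3)

theorem IsDiagonal.eq_of_sq_add_sq_eq [DecidableEq F] {u v : SL2 F} (hu : IsDiagonal u)
    (hv : IsDiagonal v) (h : u 0 0 ^ 2 + u 1 1 ^ 2 = v 0 0 ^ 2 + v 1 1 ^ 2) :
    u ∈ ({v, -v, v⁻¹, -v⁻¹} : Finset (SL2 F)) := by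
  have hud := hu.det
  have hvd := hv.det
  have hinv : ∀ {a b c : F}, a * b = 1 → a * c = 1 → b = c := by
    intro a b c h1 h2
    linear_combination c * h1 - b * h2
  have h0 : ((u 0 0 - v 0 0) * (u 0 0 + v 0 0)) * ((u 0 0 - v 1 1) * (u 0 0 + v 1 1)) = 0 := by
    linear_combination (u 0 0) ^ 2 * h - (u 0 0 * u 1 1 + 1) * hud + (v 0 0 * v 1 1 + 1) * hvd
  simp only [mem_insert, mem_singleton]
  rcases mul_eq_zero.1 h0 with h0 | h0 <;> rcases mul_eq_zero.1 h0 with h1 | h1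
  · left
    have h2 : u 0 0 = v 0 0 := by linear_combination h1
    rw [h2] at hud
    exact sl2_ext h2 (by rw [hu.1, hv.1]) (by rw [hu.2, hv.2]) (hinv hud hvd)
  · right; left
    have h2 : u 0 0 = -v 0 0 := by linear_combination h1
    rw [h2] at hud
    apply sl2_ext
    · simp [h2]
    · simp [hu.1, hv.1]
    · simp [hu.2, hv.2]
    · simpa using hinv hud (by linear_combination hvd : -v 0 0 * -v 1 1 = 1)
  · right; right; left
    have h2 : u 0 0 = v 1 1 := by linear_combination h1
    rw [h2] at hud
    apply sl2_ext
    · simp [h2, sl2_inv]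
    · simp [hu.1, hv.1, sl2_inv]
    · simp [hu.2, hv.2, sl2_inv]
    · simpa [sl2_inv] using hinv hud (by linear_combination hvd : v 1 1 * v 0 0 = 1)
  · right; right; right
    have h2 : u 0 0 = -v 1 1 := by linear_combination h1
    rw [h2] at hud
    have hn : ∀ i j, (-v⁻¹ : SL2 F) i j = -(v⁻¹ i j) := fun _ _ => rfl
    obtain ⟨i00, i01, i10, i11⟩ := sl2_inv v
    apply sl2_ext
    · rw [hn, i00, h2]
    · rw [hn, i01, hu.1, hv.1, neg_zero, neg_zero]
    · rw [hn, i10, hu.2, hv.2, neg_zero, neg_zero]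
    · rw [hn, i11]
      exact hinv hud (by linear_combination hvd : -v 1 1 * -v 0 0 = 1)

variable [DecidableEq F] {H : Finset (SL2 F)} {κ : ℝ}

theorem IsApproxGroup.card_le_of_generic [IsAlgClosed F] (h : IsApproxGroup H κ)
    (hF : (2 : F) ≠ 0) {T : ℕ} (hT : ∀ k : ℕ, 0 < k → k ≤ T → (k : F) ≠ 0)
    (hH : #(H ^ 8) ^ 4 ≤ T)
    (hL : ∀ x : SL2 F, #{g ∈ H ^ 4 | IsDiagonal (x⁻¹ * g * x)} ≤ #{g ∈ H ^ 4 | IsDiagonal g})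
    {v g : SL2 F} (hvH : v ∈ H ^ 4) (hv : IsDiagonal v) (hv' : v 0 0 ≠ v 1 1) (hg : g ∈ H)
    (h00 : g 0 0 ≠ 0) (h01 : g 0 1 ≠ 0) (h10 : g 1 0 ≠ 0) (h11 : g 1 1 ≠ 0) :
    (#H : ℝ) ≤ (12 * κ) ^ 56 := by
  set V := {g ∈ H ^ 4 | IsDiagonal g} with hV
  have hg1 : g ∈ H ^ 1 := by rwa [pow_one]
  have hκ := h.one_le
  have h1V : (1 : SL2 F) ∈ V := mem_filter.2 ⟨h.one_mem_pow 4, isDiagonal_one⟩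
  set s : SL2 F → F := fun u => u 0 0 ^ 2 + u 1 1 ^ 2 with hs
  set P := V.image s with hP
  set P' := (V * V).image s with hP'
  have hPP : P ⊆ P' := image_subset_image fun u hu => by
    rw [← mul_one u]
    exact mul_mem_mul hu h1V
  have hPne : P.Nonempty := ⟨_, mem_image_of_mem _ h1V⟩
  have hVL : #V ≤ 4 * #P := by
    refine card_le_mul_card_image V 4 ?_
    intro b hb
    obtain ⟨u, hu, rfl⟩ := mem_image.1 hb
    have hu' := (mem_filter.1 hu).2
    refine (card_le_card fun w hw => ?_).trans (card_le_four (a := u) (b := -u) (c := u⁻¹) (d := -u⁻¹))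
    obtain ⟨hw1, hw2⟩ := mem_filter.1 hw
    exact (mem_filter.1 hw1).2.eq_of_sq_add_sq_eq hu' hw2
  have hVV : ∀ u ∈ V * V, u ∈ H ^ (4 + 4) ∧ IsDiagonal u := by
    intro u hu
    obtain ⟨x, hx, y, hy, rfl⟩ := mem_mul.1 hu
    obtain ⟨hx1, hx2⟩ := mem_filter.1 hx
    obtain ⟨hy1, hy2⟩ := mem_filter.1 hy
    exact ⟨mul_mem_pow_add hx1 hy1, hx2.mul hy2⟩
  have hVinv : ∀ u ∈ V, u⁻¹ ∈ V := by
    intro u hu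
    obtain ⟨hu1, hu2⟩ := mem_filter.1 hu
    exact mem_filter.2 ⟨h.inv_mem_pow hu1, hu2.inv⟩
  have hmul : ∀ x ∈ P, ∀ y ∈ P, ∃ r ∈ P', ∃ s ∈ P', x * y = r + s := by
    intro x hx y hy
    obtain ⟨u, hu, rfl⟩ := mem_image.1 hx
    obtain ⟨w, hw, rfl⟩ := mem_image.1 hy
    refine ⟨_, mem_image_of_mem s (mul_mem_mul hu hw), _,
      mem_image_of_mem s (mul_mem_mul hu (hVinv w hw)), ?_⟩
    have hu' := (mem_filter.1 hu).2
    have hw' := (mem_filter.1 hw).2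
    simp only [hs, sl2_mul, sl2_inv, hu'.1, hu'.2, hw'.1, hw'.2]
    ring
  have hL1 : (1 : ℝ) ≤ #V := by exact_mod_cast Finset.card_pos.2 ⟨1, h1V⟩
  have hX : (#(P'.image (g 0 0 * g 1 1 * ·) - P'.image (g 0 1 * g 1 0 * ·)) : ℝ) ≤
      12 * κ * #P := by
    obtain ⟨e, he⟩ : ∃ e, 4 + 4 = e := ⟨_, rfl⟩
    obtain ⟨k, hk⟩ : ∃ k, e + e + 1 + (e + e) + 1 = k := ⟨_, rfl⟩
    rw [he] at hVV
    have h1 := h.card_trace_le hF hL (k := k) (by omega)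
    have h2 : P'.image (g 0 0 * g 1 1 * ·) - P'.image (g 0 1 * g 1 0 * ·) ⊆
        (H ^ k).image sl2Trace := by
      intro z hz
      obtain ⟨x, hx, y, hy, rfl⟩ := mem_sub.1 hz
      obtain ⟨x', hx', rfl⟩ := mem_image.1 hx
      obtain ⟨y', hy', rfl⟩ := mem_image.1 hy
      obtain ⟨u, hu, rfl⟩ := mem_image.1 hx'
      obtain ⟨w, hw, rfl⟩ := mem_image.1 hy'
      obtain ⟨hu1, hu2⟩ := hVV u hu
      obtain ⟨hw1, hw2⟩ := hVV w hw
      have hm := mul_mem_pow_add (mul_mem_pow_add (mul_mem_pow_add (mul_mem_pow_add hu1 hw1) hg1)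
        (mul_mem_pow_add hu1 (h.inv_mem_pow hw1))) (h.inv_mem_pow hg1)
      rw [hk] at hm
      refine mem_image.2 ⟨_, hm, ?_⟩
      have hud := hu2.det
      have hwd := hw2.det
      simp only [hs, sl2Trace, sl2_mul, sl2_inv, hu2.1, hu2.2, hw2.1, hw2.2]
      linear_combination (u 0 0 ^ 2 + u 1 1 ^ 2) * g 0 0 * g 1 1 * hwd -
        (w 0 0 ^ 2 + w 1 1 ^ 2) * g 0 1 * g 1 0 * hud
    have h3 : (#(P'.image (g 0 0 * g 1 1 * ·) - P'.image (g 0 1 * g 1 0 * ·)) : ℝ) ≤ κ * #V + 2 :=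
      le_trans (by exact_mod_cast card_le_card h2) h1
    have h4 : (#V : ℝ) ≤ 4 * #P := by exact_mod_cast hVL
    nlinarith
  have hPcard : #P ^ 4 ≤ T := by
    refine le_trans (Nat.pow_le_pow_left ?_ 4) hH
    exact card_image_le.trans ((card_filter_le _ _).trans (card_le_card (h.pow_mono (by norm_num))))
  have hPle := card_le_of_sub_le hT hPP hPne hmul (mul_ne_zero h00 h11) (mul_ne_zero h01 h10)
    (by linarith : 1 ≤ 12 * κ) hX hPcard
  have hΘ := h.card_trace_le hF hL (k := 4 + (1 + 1)) (by norm_num)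
  set Θ := (H ^ (4 + (1 + 1))).image sl2Trace with hΘdef
  have hHΘ : #H ≤ #(Θ ×ˢ Θ ×ˢ Θ ×ˢ Θ) := by
    refine card_le_card_of_injOn (fun w => (sl2Trace w, sl2Trace (v * w), sl2Trace (g * w),
      sl2Trace (v * (g * w)))) ?_ ?_
    · intro w hw
      have hw1 : w ∈ H ^ 1 := by rwa [pow_one]
      simp only [coe_product, Set.mem_prod, mem_coe]
      refine ⟨mem_image_of_mem _ ?_, mem_image_of_mem _ ?_, mem_image_of_mem _ ?_,
        mem_image_of_mem _ ?_⟩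
      · exact h.pow_mono (by norm_num) hw1
      · exact h.pow_mono (by norm_num) (mul_mem_pow_add hvH hw1)
      · exact h.pow_mono (by norm_num) (mul_mem_pow_add hg1 hw1)
      · exact mul_mem_pow_add hvH (mul_mem_pow_add hg1 hw1)
    · intro w _ w' _ heq
      simp only [Prod.mk.injEq] at heq
      exact sl2_eq_of_trace hv hv' h01 h10 heq.1 heq.2.1 heq.2.2.1 heq.2.2.2
  simp only [card_product] at hHΘ
  have hHΘ' : (#H : ℝ) ≤ #Θ * (#Θ * (#Θ * #Θ)) := by exact_mod_cast hHΘ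
  have hVL' : (#V : ℝ) ≤ 4 * #P := by exact_mod_cast hVL
  have hΘ0 : (0 : ℝ) ≤ #Θ := Nat.cast_nonneg _
  generalize (#H : ℝ) = n at *
  generalize (#V : ℝ) = l at *
  generalize (#P : ℝ) = p at *
  generalize (#Θ : ℝ) = t at *
  have h1 : t ≤ (12 * κ) ^ 14 := by
    calc t ≤ 12 * κ * p := by nlinarith
      _ ≤ 12 * κ * (12 * κ) ^ 13 := by
        exact mul_le_mul_of_nonneg_left hPle (by linarith)
      _ = _ := by ring
  calc n ≤ t ^ 4 := hHΘ'.trans (le_of_eq (by ring))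
    _ ≤ ((12 * κ) ^ 14) ^ 4 := pow_le_pow_left₀ hΘ0 h1 4
    _ = _ := by ring

end TorusBound

section ProductTheorem

open Finset Pointwise

variable {F : Type u} [Field F]

theorem IsDiagonal.eq_one_or_neg_one {g : SL2 F} (hg : IsDiagonal g) (h : g 0 0 = g 1 1) :
    g = 1 ∨ g = -1 := by
  have hd := hg.det
  rw [← h] at hd
  obtain ⟨o00, o01, o10, o11⟩ := sl2_one (F := F)
  have hn : ∀ i j, (-1 : SL2 F) i j = -((1 : SL2 F) i j) := fun _ _ => rfl
  have h0 : (g 0 0 - 1) * (g 0 0 + 1) = 0 := by linear_combination hd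
  rcases mul_eq_zero.1 h0 with h0 | h0
  · left
    refine sl2_ext ?_ (by rw [hg.1, o01]) (by rw [hg.2, o10]) ?_
    · rw [o00]
      linear_combination h0
    · rw [o11, ← h]
      linear_combination h0
  · right
    refine sl2_ext ?_ (by rw [hn, hg.1, o01, neg_zero]) (by rw [hn, hg.2, o10, neg_zero]) ?_
    · rw [hn, o00]
      linear_combination h0
    · rw [hn, o11, ← h]
      linear_combination h0

theorem sl2_ne_inv_of_trace (hF : (2 : F) ≠ 0) {g : SL2 F} (h2 : sl2Trace g ≠ 2)
    (h2' : sl2Trace g ≠ -2) : g ≠ g⁻¹ := by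
  intro h
  obtain ⟨i00, i01, i10, -⟩ := sl2_inv g
  rw [← h] at i00 i01 i10
  have hz : ∀ a : F, a = -a → a = 0 := fun a ha =>
    (mul_eq_zero.1 (by linear_combination ha : 2 * a = 0)).resolve_left hF
  exact sl2_ne_of_trace (hz _ i10) h2 h2' i00

variable [DecidableEq F] {H : Finset (SL2 F)} {κ : ℝ}

theorem card_filter_conj_image_pow (y : SL2 F) (k : ℕ) (p : SL2 F → Prop) [DecidablePred p] :
    #{g ∈ (H.image (MulAut.conj y)) ^ k | p g} = #{g ∈ H ^ k | p (y * g * y⁻¹)} := by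
  rw [conj_image_pow, filter_image, card_image_of_injective _ (MulAut.conj y).injective]
  rfl

/-- After a conjugation, the diagonal torus is the richest maximal torus of `H ^ 4`. -/
theorem exists_conj_card_isDiagonal_le (H : Finset (SL2 F)) (k : ℕ) : ∃ y : SL2 F, ∀ x : SL2 F,
    #{g ∈ (H.image (MulAut.conj y)) ^ k | IsDiagonal (x⁻¹ * g * x)} ≤
      #{g ∈ (H.image (MulAut.conj y)) ^ k | IsDiagonal g} := by
  set f : SL2 F → ℕ := fun y => #{g ∈ H ^ k | IsDiagonal (y * g * y⁻¹)} with hf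
  have hbdd : BddAbove (Set.range f) := ⟨#(H ^ k), by
    rintro _ ⟨y, rfl⟩
    exact card_filter_le _ _⟩
  obtain ⟨y, hy⟩ := Nat.sSup_mem (Set.range_nonempty f) hbdd
  refine ⟨y, fun x => ?_⟩
  rw [card_filter_conj_image_pow, card_filter_conj_image_pow]
  have h1 : f (x⁻¹ * y) ≤ f y := by
    rw [hy]
    exact le_csSup hbdd ⟨_, rfl⟩
  simp only [hf] at h1
  refine le_trans (le_of_eq ?_) h1
  congr 1
  refine filter_congr fun g _ => ?_
  rw [_root_.mul_inv_rev, inv_inv]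
  simp only [mul_assoc]

/-- An approximate subgroup of `SL₂(F)` is covered by few two-dimensional subspaces, as long as
the characteristic is large. -/
theorem IsApproxGroup.coveredByLines [IsAlgClosed F] (h : IsApproxGroup H κ)
    (hF : (2 : F) ≠ 0) {T : ℕ} (hT : ∀ k : ℕ, 0 < k → k ≤ T → (k : F) ≠ 0)
    (hH : #(H ^ 8) ^ 4 ≤ T) : CoveredByLines {m | ∃ g ∈ H, g.1 = m} ((12 * κ) ^ 56) := by
  have hκ := h.one_le
  have hκ' : 12 * κ ≤ (12 * κ) ^ 56 := le_self_pow₀ (by linarith) (by norm_num)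
  by_cases htr : ∀ g ∈ H ^ 4, sl2Trace g = 2 ∨ sl2Trace g = -2
  · exact (h.covered_of_trace_eq hF htr).mono subset_rfl (by linarith)
  push Not at htr
  obtain ⟨w, hw, hw2, hw2'⟩ := htr
  obtain ⟨y, hy⟩ := exists_conj_card_isDiagonal_le H 4
  have hmem : ∀ {g : SL2 F} {k : ℕ}, g ∈ H ^ k → y * g * y⁻¹ ∈ (H.image (MulAut.conj y)) ^ k :=
    fun hg => mem_conj_image_pow.2 (by convert hg using 1; group)
  have hH' : #((H.image (MulAut.conj y)) ^ 8) ^ 4 ≤ T := by rwa [card_conj_image_pow]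
  have h' := h.map (MulAut.conj y)
  suffices hs : CoveredByLines {m | ∃ g ∈ H.image (MulAut.conj y), g.1 = m} ((12 * κ) ^ 56) from
    CoveredByLines.translate (A := {g | g ∈ H.image (MulAut.conj y)}) (B := {g | g ∈ H}) hs y y⁻¹
      fun g hg => mem_image_of_mem _ hg
  have hw' := hmem hw
  have hwt : sl2Trace (y * w * y⁻¹) = sl2Trace w := sl2Trace_conj' y w
  rw [← hwt] at hw2 hw2'
  change IsApproxGroup (H.image (MulAut.conj y)) κ at h'
  generalize H.image (MulAut.conj y) = H' at *
  generalize y * w * y⁻¹ = z at *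
  have hne := sl2_ne_inv_of_trace hF hw2 hw2'
  have hz1 : z ≠ 1 := by
    rintro rfl
    exact hne inv_one.symm
  obtain ⟨x, hx⟩ := exists_conj_isDiagonal hF hw2 hw2'
  have hcard : 2 < #{g ∈ H' ^ 4 | IsDiagonal g} := by
    refine lt_of_lt_of_le ?_ (hy x)
    refine two_lt_card.2 ⟨1, ?_, z, ?_, z⁻¹, ?_, hz1.symm, fun h0 => hz1 (inv_eq_one.1 h0.symm),
      hne⟩
    · exact mem_filter.2 ⟨h'.one_mem_pow 4, hx 1 (by rw [one_mul, mul_one])⟩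
    · exact mem_filter.2 ⟨hw', hx z rfl⟩
    · exact mem_filter.2 ⟨h'.inv_mem_pow hw', hx z⁻¹ (by rw [inv_mul_cancel, mul_inv_cancel])⟩
  obtain ⟨v, hv, hv'⟩ : ∃ v ∈ H' ^ 4, IsDiagonal v ∧ v 0 0 ≠ v 1 1 := by
    by_contra! hcon
    refine absurd (card_le_card (t := ({1, -1} : Finset (SL2 F))) fun g hg => ?_)
      (not_le.2 (lt_of_le_of_lt card_le_two hcard))
    obtain ⟨hg1, hg2⟩ := mem_filter.1 hg
    simpa using hg2.eq_one_or_neg_one (hcon g hg1 hg2)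
  by_cases hg : ∃ g ∈ H', g 0 0 ≠ 0 ∧ g 0 1 ≠ 0 ∧ g 1 0 ≠ 0 ∧ g 1 1 ≠ 0
  · obtain ⟨g, hg, h00, h01, h10, h11⟩ := hg
    have hb := h'.card_le_of_generic hF hT hH' hy hv hv'.1 hv'.2 hg h00 h01 h10 h11
    refine (coveredByLines_finset (H'.image fun g => g.1)).mono ?_
      (le_trans (by exact_mod_cast card_image_le) hb)
    rintro m ⟨g, hg, rfl⟩
    exact mem_coe.2 (mem_image_of_mem _ hg)
  · refine (h'.covered_of_exists_entry_eq_zero hT hH' fun g hg' => ?_).mono subset_rfl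
      (by linarith)
    by_contra! hcon
    exact hg ⟨g, hg', hcon⟩

end ProductTheorem

section Flattening

open Finset Pointwise

variable {F : Type u} [Field F]

/-- If the collision probability of a random element of `SL₂(F)` barely decreases after one
step of a random walk, then the element is concentrated on a two-dimensional subspace. -/
theorem one_le_mul_pow_of_collisions [DecidableEq F] [IsAlgClosed F] (hF : (2 : F) ≠ 0) {T : ℕ}
    (hT : ∀ k : ℕ, 0 < k → k ≤ T → (k : F) ≠ 0) {ι : Type*} [Fintype ι] [Nonempty ι]
    [DecidableEq ι] (φ : ι → SL2 F) {K R η : ℝ} (hK : 2 ≤ K)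
    (hη : ∀ W : Submodule F (Matrix (Fin 2) (Fin 2) F), finrank F W ≤ 2 → ∀ s : Finset ι,
      (∀ ω ∈ s, (φ ω).1 ∈ W) → (#s : ℝ) ≤ η * Fintype.card ι)
    (hE : (Fintype.card ι : ℝ) ^ 2 * #{p : ι × ι | φ p.1 = φ p.2} ≤
      K * #{p : (ι × ι) × (ι × ι) | φ p.1.1 * (φ p.1.2)⁻¹ = φ p.2.1 * (φ p.2.2)⁻¹})
    (hR : (Fintype.card ι : ℝ) ^ 2 ≤ R * #{p : ι × ι | φ p.1 = φ p.2})
    (hRT : (K ^ 20000 * R) ^ 4 ≤ T) {C : ℕ} (hC : 12000000 ≤ C) : 1 ≤ η * K ^ C := by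
  classical
  obtain ⟨H, y, h1, hinv, hpow, hcard, hmeas⟩ := exists_approximateSubgroup_of_collisions φ hK hE
  have hK1 : 1 ≤ K := by linarith
  have hI : (0 : ℝ) < Fintype.card ι := by exact_mod_cast Fintype.card_pos
  obtain ⟨A, hA⟩ : ∃ A, A = 2000 := ⟨_, rfl⟩
  obtain ⟨B, hB⟩ : ∃ B, B = 20000 := ⟨_, rfl⟩
  rw [← hA] at hcard hmeas
  rw [← hB] at hRT
  have hpow' : ∀ m, (#(H ^ m) : ℝ) ≤ K ^ (A * (m + 1)) * #H := by rwa [hA]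
  clear hpow
  have hap : IsApproxGroup H (K ^ (A * 101)) := ⟨h1, hinv, fun m hm => (hpow' m).trans <|
    mul_le_mul_of_nonneg_right (pow_le_pow_right₀ hK1 (Nat.mul_le_mul_left A (by omega)))
      (Nat.cast_nonneg _)⟩
  have hHR : (#H : ℝ) ≤ K ^ A * R := by
    have hcp : (0 : ℝ) < #{p : ι × ι | φ p.1 = φ p.2} := by
      obtain ⟨i⟩ := ‹Nonempty ι›
      exact_mod_cast Finset.card_pos.2 ⟨(i, i), by simp⟩
    generalize (#{p : ι × ι | φ p.1 = φ p.2} : ℝ) = c at *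
    refine le_of_mul_le_mul_right (hcard.trans ?_) hcp
    calc K ^ A * (Fintype.card ι : ℝ) ^ 2 ≤ K ^ A * (R * c) :=
          mul_le_mul_of_nonneg_left hR (by positivity)
      _ = _ := by ring
  have hR0 : 0 ≤ R := by
    have : 0 ≤ K ^ A * R := (Nat.cast_nonneg _).trans hHR
    exact nonneg_of_mul_nonneg_right this (by positivity)
  have hH8 : #(H ^ 8) ^ 4 ≤ T := by
    have h8 : (#(H ^ 8) : ℝ) ≤ K ^ B * R := by
      calc (#(H ^ 8) : ℝ) ≤ K ^ (A * (8 + 1)) * #H := hpow' 8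
        _ ≤ K ^ (A * (8 + 1)) * (K ^ A * R) := mul_le_mul_of_nonneg_left hHR (by positivity)
        _ = K ^ (A * (8 + 1) + A) * R := by rw [pow_add, mul_assoc]
        _ ≤ K ^ B * R := mul_le_mul_of_nonneg_right (pow_le_pow_right₀ hK1 (by omega)) hR0
    have := (pow_le_pow_left₀ (Nat.cast_nonneg _) h8 4).trans hRT
    exact_mod_cast this
  have hcov := CoveredByLines.translate (A := {g | g ∈ H}) (B := {g | y⁻¹ * g ∈ H})
    (hap.coveredByLines hF hT hH8) y⁻¹ 1 fun g hg => by rwa [mul_one]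
  obtain ⟨L, hL, hL2, hLm⟩ := hcov
  have hcount : #{ω | y⁻¹ * φ ω ∈ H} ≤ ∑ W ∈ L, #{ω | (φ ω).1 ∈ W} := by
    refine (card_le_card fun ω hω => ?_).trans card_biUnion_le
    obtain ⟨W, hW, hm⟩ := hLm (φ ω).1 ⟨φ ω, (mem_filter.1 hω).2, rfl⟩
    exact mem_biUnion.2 ⟨W, hW, mem_filter.2 ⟨mem_univ _, hm⟩⟩
  have hLK : (#L : ℝ) ≤ K ^ ((4 + A * 101) * 56) := by
    refine hL.trans ?_
    rw [pow_mul K (4 + A * 101) 56, pow_add K 4]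
    refine pow_le_pow_left₀ (by positivity) (mul_le_mul_of_nonneg_right ?_ (by positivity)) 56
    calc (12 : ℝ) ≤ 2 ^ 4 := by norm_num
      _ ≤ K ^ 4 := pow_le_pow_left₀ (by norm_num) hK 4
  have hsum : ((∑ W ∈ L, #{ω | (φ ω).1 ∈ W} : ℕ) : ℝ) ≤ #L * (η * Fintype.card ι) := by
    rw [Nat.cast_sum, ← nsmul_eq_mul]
    exact sum_le_card_nsmul _ _ _ fun W hW => hη W (hL2 W hW) _ fun ω hω => (mem_filter.1 hω).2
  have hη0 : 0 ≤ η := by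
    have := hη ⊥ (by simp) ∅ (by simp)
    rw [card_empty, Nat.cast_zero] at this
    exact nonneg_of_mul_nonneg_left this hI
  have hcount' : (#{ω | y⁻¹ * φ ω ∈ H} : ℝ) ≤ #L * (η * Fintype.card ι) :=
    le_trans (Nat.cast_le.2 hcount) hsum
  clear hRT hH8 hap hpow' hsum hcount
  generalize (#{ω | y⁻¹ * φ ω ∈ H} : ℝ) = z at *
  generalize (#L : ℝ) = l at *
  generalize (Fintype.card ι : ℝ) = I at *
  have h2 : I ≤ η * K ^ C * I := by
    calc I ≤ K ^ A * z := hmeas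
      _ ≤ K ^ A * (l * (η * I)) := mul_le_mul_of_nonneg_left hcount' (by positivity)
      _ ≤ K ^ A * (K ^ ((4 + A * 101) * 56) * (η * I)) := mul_le_mul_of_nonneg_left
          (mul_le_mul_of_nonneg_right hLK (by positivity)) (by positivity)
      _ = K ^ (A + (4 + A * 101) * 56) * (η * I) := by rw [pow_add]; ring
      _ ≤ K ^ C * (η * I) :=
          mul_le_mul_of_nonneg_right (pow_le_pow_right₀ hK1 (by omega)) (by positivity)
      _ = _ := by ring
  exact le_of_mul_le_mul_right (by linarith) hI

end Flattening

section RichFamilies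

open Finset

/-- Composing the partial injections of a rich family with one another's inverses gives a rich
family. -/
theorem rich_step {ι 𝒳 : Type*} [Fintype ι] [Fintype 𝒳] [DecidableEq ι] [DecidableEq 𝒳]
    (R : ι → 𝒳 → 𝒳 → Prop)
    (hinj : ∀ ω i k i', R ω i i' → R ω k i' → i = k) (R' : ι × ι → 𝒳 → 𝒳 → Prop)
    (hR' : ∀ a b i i' i'', R a i i' → R b i i'' → R' (a, b) i'' i') {c : ℝ} (hc : 0 ≤ c)
    (s : Finset (ι × 𝒳)) (hs : ∀ p ∈ s, ∃ i', R p.1 p.2 i')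
    (h : c * Fintype.card ι * Fintype.card 𝒳 ≤ #s) :
    ∃ s' : Finset ((ι × ι) × 𝒳), (∀ p ∈ s', ∃ i', R' p.1 p.2 i') ∧
      c ^ 2 * Fintype.card (ι × ι) * Fintype.card 𝒳 ≤ #s' := by
  classical
  have hs' : ∀ p : ι × 𝒳, ∃ i', p ∈ s → R p.1 p.2 i' := fun p => by
    by_cases hp : p ∈ s
    · obtain ⟨i', hi'⟩ := hs p hp
      exact ⟨i', fun _ => hi'⟩
    · exact ⟨p.2, fun h0 => absurd h0 hp⟩
  choose f hf using hs'
  set D : Finset ((ι × ι) × 𝒳) := {p | (p.1.1, p.2) ∈ s ∧ (p.1.2, p.2) ∈ s} with hD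
  refine ⟨D.image fun p => (p.1, f (p.1.2, p.2)), ?_, ?_⟩
  · intro p hp
    obtain ⟨⟨⟨a, b⟩, i⟩, hq, rfl⟩ := mem_image.1 hp
    have hq' := (mem_filter.1 hq).2
    exact ⟨f (a, i), hR' a b i _ _ (hf _ hq'.1) (hf _ hq'.2)⟩
  · rw [card_image_of_injOn]
    · set d : 𝒳 → ℕ := fun i => #{ω | (ω, i) ∈ s} with hd
      have h1 : #s = ∑ i, d i := by
        rw [card_eq_sum_card_fiberwise (f := Prod.snd) (t := univ) fun _ _ => mem_coe.2 (mem_univ _)]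
        refine sum_congr rfl fun i _ => ?_
        refine card_bij (fun p _ => p.1) ?_ ?_ ?_
        · rintro ⟨ω, k⟩ hp
          obtain ⟨hp1, rfl⟩ := mem_filter.1 hp
          exact mem_filter.2 ⟨mem_univ _, hp1⟩
        · exact fun p hp p' hp' hpp =>
            Prod.ext hpp ((mem_filter.1 hp).2.trans (mem_filter.1 hp').2.symm)
        · intro ω hω
          exact ⟨(ω, i), mem_filter.2 ⟨(mem_filter.1 hω).2, rfl⟩, rfl⟩
      have h2 : #D = ∑ i, d i ^ 2 := by
        rw [card_eq_sum_card_fiberwise (f := Prod.snd) (t := univ) fun _ _ => mem_coe.2 (mem_univ _)]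
        refine sum_congr rfl fun i _ => ?_
        rw [sq, hd, ← card_product]
        refine card_bij (fun p _ => p.1) ?_ ?_ ?_
        · rintro ⟨⟨a, b⟩, k⟩ hp
          obtain ⟨hp1, rfl⟩ := mem_filter.1 hp
          have := (mem_filter.1 hp1).2
          exact mem_product.2 ⟨mem_filter.2 ⟨mem_univ _, this.1⟩, mem_filter.2 ⟨mem_univ _, this.2⟩⟩
        · exact fun p hp p' hp' hpp =>
            Prod.ext hpp ((mem_filter.1 hp).2.trans (mem_filter.1 hp').2.symm)
        · rintro ⟨a, b⟩ hω
          obtain ⟨ha, hb⟩ := mem_product.1 hω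
          exact ⟨((a, b), i), mem_filter.2 ⟨mem_filter.2 ⟨mem_univ _, (mem_filter.1 ha).2,
            (mem_filter.1 hb).2⟩, rfl⟩, rfl⟩
      have h3 : (#s : ℝ) ^ 2 ≤ Fintype.card 𝒳 * #D := by
        rw [h1, h2]
        push_cast
        exact sq_sum_le_card_mul_sum_sq
      have h4 := (pow_le_pow_left₀ (by positivity) h 2).trans h3
      rw [Fintype.card_prod, Nat.cast_mul]
      have hz : (0 : ℝ) ≤ #D := Nat.cast_nonneg _
      generalize (#D : ℝ) = z at *
      rcases (Nat.cast_nonneg (Fintype.card 𝒳) : (0 : ℝ) ≤ _).eq_or_lt with h0 | h0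
      · rwa [← h0, mul_zero]
      · refine le_of_mul_le_mul_left (le_trans (le_of_eq ?_) h4) h0
        ring
    · rintro ⟨⟨a, b⟩, i⟩ hp ⟨⟨a', b'⟩, i'⟩ hp' heq
      simp only [Prod.mk.injEq] at heq
      obtain ⟨⟨rfl, rfl⟩, heq⟩ := heq
      have hp := (mem_filter.1 (mem_coe.1 hp)).2
      have hp' := (mem_filter.1 (mem_coe.1 hp')).2
      have h1 := hf _ hp.2
      rw [heq] at h1
      exact Prod.ext rfl (hinj _ _ _ _ h1 (hf _ hp'.2))

variable {F : Type u} [Field F]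

/-- Every two-dimensional subspace contains a proportion at most `η` of the family `φ`. -/
def SpreadOut {ι : Type*} [Fintype ι] (φ : ι → Matrix (Fin 2) (Fin 2) F) (η : ℝ) : Prop :=
  ∀ W : Submodule F (Matrix (Fin 2) (Fin 2) F), finrank F W ≤ 2 → ∀ s : Finset ι,
    (∀ ω ∈ s, φ ω ∈ W) → (#s : ℝ) ≤ η * Fintype.card ι

theorem SpreadOut.mul_inv {ι : Type*} [Fintype ι] [DecidableEq ι] {φ : ι → SL2 F} {η : ℝ}
    (h : SpreadOut (fun ω => (φ ω).1) η) :
    SpreadOut (fun p : ι × ι => (φ p.1 * (φ p.2)⁻¹).1) η := by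
  intro W hW s hs
  have h1 : ∀ b : ι, (#{p ∈ s | p.2 = b} : ℝ) ≤ η * Fintype.card ι := by
    intro b
    set f := LinearMap.mulRight F ((φ b)⁻¹).1 with hf
    have hfinj : Function.Injective f := by
      intro m m' hmm
      simp only [hf, LinearMap.mulRight_apply] at hmm
      have := congrArg (· * (φ b).1) hmm
      simp only [mul_assoc, ← Matrix.SpecialLinearGroup.coe_mul, inv_mul_cancel] at this
      simpa using this
    have hfr : finrank F (W.comap f) ≤ 2 := by
      refine le_trans ?_ hW
      refine LinearMap.finrank_le_finrank_of_injective (f := f.restrict fun m hm => hm) ?_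
      intro m m' hmm
      exact Subtype.ext (hfinj (congrArg Subtype.val hmm))
    refine le_trans (Nat.cast_le.2 ?_) (h (W.comap f) hfr ({p ∈ s | p.2 = b}.image Prod.fst) ?_)
    · rw [card_image_of_injOn]
      exact fun p hp p' hp' hpp => Prod.ext hpp ((mem_filter.1 (mem_coe.1 hp)).2.trans
        (mem_filter.1 (mem_coe.1 hp')).2.symm)
    · intro ω hω
      obtain ⟨⟨a, b'⟩, hp, rfl⟩ := mem_image.1 hω
      obtain ⟨hp1, rfl⟩ := mem_filter.1 hp
      exact hs _ hp1
  have h2 : #s = ∑ b : ι, #{p ∈ s | p.2 = b} :=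
    card_eq_sum_card_fiberwise fun _ _ => mem_coe.2 (mem_univ _)
  rw [h2, Nat.cast_sum, Fintype.card_prod, Nat.cast_mul]
  calc ∑ b : ι, (#{p ∈ s | p.2 = b} : ℝ) ≤ #(univ : Finset ι) • (η * Fintype.card ι) :=
        sum_le_card_nsmul _ _ _ fun b _ => h1 b
    _ = _ := by
      rw [nsmul_eq_mul, card_univ]
      ring

end RichFamilies

section Endgame

open Finset

variable {F : Type u} [Field F]

/-- The determinant of the pair of plane vectors `v, w`. -/
def cross (v w : Fin 2 → F) : F := v 0 * w 1 - v 1 * w 0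

theorem cross_eq_zero_trans {a b c : Fin 2 → F} (hb : b ≠ 0) (h1 : cross a b = 0)
    (h2 : cross c b = 0) : cross a c = 0 := by
  have h0 : b 0 * cross a c = 0 := by
    simp only [cross] at h1 h2 ⊢
    linear_combination c 0 * h1 - a 0 * h2
  have h1' : b 1 * cross a c = 0 := by
    simp only [cross] at h1 h2 ⊢
    linear_combination c 1 * h1 - a 1 * h2
  by_contra hne
  refine hb (funext fun i => ?_)
  fin_cases i
  · exact (mul_eq_zero.1 h0).resolve_right hne
  · exact (mul_eq_zero.1 h1').resolve_right hne

theorem cross_comm_eq_zero {a b : Fin 2 → F} (h : cross a b = 0) : cross b a = 0 := by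
  simp only [cross] at h ⊢
  linear_combination -h

theorem cross_mulVec (g : SL2 F) (v w : Fin 2 → F) :
    cross (g.1 *ᵥ v) (g.1 *ᵥ w) = cross v w := by
  have hd := sl2_det g
  simp only [cross, Matrix.mulVec, dotProduct, Fin.sum_univ_two]
  linear_combination (v 0 * w 1 - v 1 * w 0) * hd

theorem binary_quadratic_eq_zero {A B C : F} {v w u : Fin 2 → F} (hvw : cross v w ≠ 0)
    (hvu : cross v u ≠ 0) (hwu : cross w u ≠ 0)
    (h1 : A * v 0 ^ 2 + B * (v 0 * v 1) + C * v 1 ^ 2 = 0)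
    (h2 : A * w 0 ^ 2 + B * (w 0 * w 1) + C * w 1 ^ 2 = 0)
    (h3 : A * u 0 ^ 2 + B * (u 0 * u 1) + C * u 1 ^ 2 = 0) : A = 0 ∧ B = 0 ∧ C = 0 := by
  have hD : cross v w * cross v u * cross w u ≠ 0 := mul_ne_zero (mul_ne_zero hvw hvu) hwu
  refine ⟨?_, ?_, ?_⟩ <;> refine (mul_eq_zero.1 ?_).resolve_right hD
  · simp only [cross]
    linear_combination (w 1 * u 1 * (w 0 * u 1 - w 1 * u 0)) * h1 -
      (v 1 * u 1 * (v 0 * u 1 - v 1 * u 0)) * h2 + (v 1 * w 1 * (v 0 * w 1 - v 1 * w 0)) * h3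
  · simp only [cross]
    linear_combination (-(w 0 * u 1 + w 1 * u 0) * (w 0 * u 1 - w 1 * u 0)) * h1 +
      ((v 0 * u 1 + v 1 * u 0) * (v 0 * u 1 - v 1 * u 0)) * h2 -
      ((v 0 * w 1 + v 1 * w 0) * (v 0 * w 1 - v 1 * w 0)) * h3
  · simp only [cross]
    linear_combination (w 0 * u 0 * (w 0 * u 1 - w 1 * u 0)) * h1 -
      (v 0 * u 0 * (v 0 * u 1 - v 1 * u 0)) * h2 + (v 0 * w 0 * (v 0 * w 1 - v 1 * w 0)) * h3

theorem sl2_eq_one_or_neg_one {k : SL2 F} {v w u : Fin 2 → F} (hvw : cross v w ≠ 0)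
    (hvu : cross v u ≠ 0) (hwu : cross w u ≠ 0) (h1 : cross (k.1 *ᵥ v) v = 0)
    (h2 : cross (k.1 *ᵥ w) w = 0) (h3 : cross (k.1 *ᵥ u) u = 0) : k = 1 ∨ k = -1 := by
  have hq : ∀ z : Fin 2 → F, cross (k.1 *ᵥ z) z = 0 →
      k 1 0 * z 0 ^ 2 + (k 1 1 - k 0 0) * (z 0 * z 1) + -k 0 1 * z 1 ^ 2 = 0 := by
    intro z hz
    simp only [cross, Matrix.mulVec, dotProduct, Fin.sum_univ_two] at hz
    linear_combination -hz
  obtain ⟨hA, hB, hC⟩ := binary_quadratic_eq_zero hvw hvu hwu (hq v h1) (hq w h2) (hq u h3)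
  exact IsDiagonal.eq_one_or_neg_one ⟨neg_eq_zero.1 hC, hA⟩ (sub_eq_zero.1 hB).symm

theorem sl2_mul_inv_eq_one_or_neg_one {g h : SL2 F} {v w u v' w' u' : Fin 2 → F}
    (hvw : cross v w ≠ 0) (hvu : cross v u ≠ 0) (hwu : cross w u ≠ 0) (hv' : v' ≠ 0)
    (hw' : w' ≠ 0) (hu' : u' ≠ 0)
    (h1 : cross (g.1 *ᵥ v) v' = 0) (h2 : cross (g.1 *ᵥ w) w' = 0) (h3 : cross (g.1 *ᵥ u) u' = 0)
    (h1' : cross (h.1 *ᵥ v) v' = 0) (h2' : cross (h.1 *ᵥ w) w' = 0)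
    (h3' : cross (h.1 *ᵥ u) u' = 0) : g * h⁻¹ = 1 ∨ g * h⁻¹ = -1 := by
  have key : ∀ {z z' : Fin 2 → F}, z' ≠ 0 → cross (g.1 *ᵥ z) z' = 0 → cross (h.1 *ᵥ z) z' = 0 →
      cross ((h⁻¹ * g).1 *ᵥ z) z = 0 := by
    intro z z' hz e e'
    have := cross_eq_zero_trans hz e e'
    rw [← cross_mulVec h, Matrix.mulVec_mulVec, ← Matrix.SpecialLinearGroup.coe_mul,
      mul_inv_cancel_left]
    exact this
  rcases sl2_eq_one_or_neg_one hvw hvu hwu (key hv' h1 h1') (key hw' h2 h2') (key hu' h3 h3')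
    with h0 | h0
  · left
    rw [← inv_mul_eq_one.1 h0, mul_inv_cancel]
  · right
    have : g = h * -1 := by rw [← h0, mul_inv_cancel_left]
    rw [this]
    simp

theorem exists_eq_vecMulVec {m : Matrix (Fin 2) (Fin 2) F} (h0 : m ≠ 0) (hd : m.det = 0) :
    ∃ v w : Fin 2 → F, v ≠ 0 ∧ w ≠ 0 ∧ m = vecMulVec v w := by
  rw [Matrix.det_fin_two] at hd
  obtain ⟨i, j, hij⟩ : ∃ i j, m i j ≠ 0 := by
    by_contra! h
    exact h0 (Matrix.ext h)
  refine ⟨fun a => m a j, fun b => m i b / m i j, fun h => hij (congrFun h i),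
    fun h => ?_, ?_⟩
  · have := congrFun h j
    simp [hij] at this
  · ext a b
    rw [vecMulVec_apply]
    field_simp
    fin_cases i <;> fin_cases j <;> fin_cases a <;> fin_cases b <;> simp <;>
      first | ring1 | linear_combination hd | linear_combination -hd

theorem cross_mulVec_eq_zero {g h : SL2 F} {v w v' w' : Fin 2 → F} (hw' : w' ≠ 0) {c : F}
    (hc : c ≠ 0) (heq : g.1 * vecMulVec v w * h.1 = c • vecMulVec v' w') :
    cross (g.1 *ᵥ v) v' = 0 := by
  obtain ⟨k, hk⟩ : ∃ k, w' k ≠ 0 := by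
    by_contra! h0
    exact hw' (funext h0)
  have e0 := congrFun (congrFun heq 0) k
  have e1 := congrFun (congrFun heq 1) k
  rw [Matrix.mul_vecMulVec, Matrix.vecMulVec_mul] at e0 e1
  simp only [vecMulVec_apply, Matrix.smul_apply, smul_eq_mul] at e0 e1
  refine (mul_eq_zero.1 ?_).resolve_right (mul_ne_zero hc hk)
  simp only [cross]
  linear_combination (g.1 *ᵥ v) 1 * e0 - (g.1 *ᵥ v) 0 * e1

theorem SpreadOut.card_cross_le {𝒳 : Type*} [Fintype 𝒳] {x : 𝒳 → Matrix (Fin 2) (Fin 2) F}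
    {η : ℝ} (h : SpreadOut x η) {v w : 𝒳 → Fin 2 → F} (hx : ∀ i, x i = vecMulVec (v i) (w i))
    {z : Fin 2 → F} (hz : z ≠ 0) (s : Finset 𝒳) (hs : ∀ i ∈ s, cross (v i) z = 0) :
    (#s : ℝ) ≤ η * Fintype.card 𝒳 := by
  obtain ⟨k, hk⟩ : ∃ k, z k ≠ 0 := by
    by_contra! h0
    exact hz (funext h0)
  set f : (Fin 2 → F) →ₗ[F] Matrix (Fin 2) (Fin 2) F :=
    { toFun := vecMulVec z
      map_add' := vecMulVec_add z
      map_smul' := fun c y => vecMulVec_smul c z y } with hf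
  refine h (LinearMap.range f) ((LinearMap.finrank_range_le f).trans (by simp)) s fun i hi => ?_
  have h0 := hs i hi
  refine ⟨(v i k / z k) • w i, ?_⟩
  change vecMulVec z _ = _
  rw [hx]
  ext a b
  simp only [vecMulVec_apply, Pi.smul_apply, smul_eq_mul]
  field_simp
  simp only [cross] at h0
  fin_cases k <;> fin_cases a <;> simp <;>
    first | ring1 | linear_combination w i b * h0 | linear_combination -w i b * h0

/-- A spread out family of rank one matrices cannot be richly permuted by a family of pairs of
elements of `SL₂(F)` with few coincidences. -/
theorem false_of_rich_of_few_collisions [DecidableEq F] {ι 𝒳 : Type*} [Fintype ι] [Nonempty ι]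
    [DecidableEq ι] [Fintype 𝒳] [DecidableEq 𝒳] {x : 𝒳 → Matrix (Fin 2) (Fin 2) F} {η c : ℝ}
    (hx0 : ∀ i, x i ≠ 0) (hxd : ∀ i, (x i).det = 0) (hx : SpreadOut x η)
    (φ ψ : ι → SL2 F) (s : Finset (ι × 𝒳))
    (hs : ∀ p ∈ s, ∃ i', ∃ a : F, a ≠ 0 ∧ (φ p.1).1 * x p.2 * (ψ p.1).1 = a • x i')
    (h : c * Fintype.card ι * Fintype.card 𝒳 ≤ #s) (hc0 : 0 ≤ c) (hηc : 4 * η ≤ c)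
    (hc : 8 < c ^ 2 * Fintype.card 𝒳)
    (hcp : (Fintype.card 𝒳 : ℝ) ^ 8 * #{p : ι × ι | φ p.1 = φ p.2} ≤ Fintype.card ι ^ 2) :
    False := by
  have hI : (0 : ℝ) < Fintype.card ι := by exact_mod_cast Fintype.card_pos
  have hn : (1 : ℝ) ≤ Fintype.card 𝒳 := by
    rcases Nat.eq_zero_or_pos (Fintype.card 𝒳) with h0 | h0
    · rw [h0] at hc
      norm_num at hc
    · exact_mod_cast h0
  choose v w hv hw hvw using fun i => exists_eq_vecMulVec (hx0 i) (hxd i)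
  have hne : Nonempty 𝒳 := Fintype.card_pos_iff.1 (by exact_mod_cast hn)
  choose! f hf using hs
  set N : ι → Finset 𝒳 := fun ω => {i | (ω, i) ∈ s} with hN
  set Ω : Finset ι := {ω | 2 * η * Fintype.card 𝒳 < #(N ω)} with hΩ
  have hfar : ∀ ω ∈ Ω, ∀ j k : 𝒳, ∃ i ∈ N ω, cross (v j) (v i) ≠ 0 ∧ cross (v k) (v i) ≠ 0 := by
    intro ω hω j k
    by_contra! hcon
    have h1 := hx.card_cross_le hvw (hv j) {i ∈ N ω | cross (v i) (v j) = 0}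
      fun i hi => (mem_filter.1 hi).2
    have h2 := hx.card_cross_le hvw (hv k) {i ∈ N ω | cross (v i) (v k) = 0}
      fun i hi => (mem_filter.1 hi).2
    have h3 : #(N ω) ≤ #{i ∈ N ω | cross (v i) (v j) = 0} + #{i ∈ N ω | cross (v i) (v k) = 0} := by
      refine (card_le_card fun i hi => ?_).trans (card_union_le _ _)
      by_cases hij : cross (v j) (v i) = 0
      · exact mem_union_left _ (mem_filter.2 ⟨hi, cross_comm_eq_zero hij⟩)
      · exact mem_union_right _ (mem_filter.2 ⟨hi, cross_comm_eq_zero (hcon i hi hij)⟩)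
    have h4 := (mem_filter.1 hω).2
    have h5 : (#(N ω) : ℝ) ≤ #{i ∈ N ω | cross (v i) (v j) = 0} +
      #{i ∈ N ω | cross (v i) (v k) = 0} := by exact_mod_cast h3
    linarith
  have hmove : ∀ ω, ∀ i ∈ N ω, cross ((φ ω).1 *ᵥ v i) (v (f (ω, i))) = 0 := by
    intro ω i hi
    obtain ⟨a, ha, heq⟩ := hf (ω, i) (mem_filter.1 hi).2
    rw [hvw i, hvw (f (ω, i))] at heq
    exact cross_mulVec_eq_zero (hw _) ha heq
  have htrip : ∀ ω, ∃ t : 𝒳 × 𝒳 × 𝒳, ω ∈ Ω → t.1 ∈ N ω ∧ t.2.1 ∈ N ω ∧ t.2.2 ∈ N ω ∧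
      cross (v t.1) (v t.2.1) ≠ 0 ∧ cross (v t.1) (v t.2.2) ≠ 0 ∧
      cross (v t.2.1) (v t.2.2) ≠ 0 := by
    intro ω
    obtain ⟨k⟩ := hne
    by_cases hω : ω ∈ Ω
    · obtain ⟨i₁, h1, -⟩ := hfar ω hω k k
      obtain ⟨i₂, h2, h12, -⟩ := hfar ω hω i₁ i₁
      obtain ⟨i₃, h3, h13, h23⟩ := hfar ω hω i₁ i₂
      exact ⟨(i₁, i₂, i₃), fun _ => ⟨h1, h2, h3, h12, h13, h23⟩⟩
    · exact ⟨(k, k, k), fun h0 => absurd h0 hω⟩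
  choose t ht using htrip
  have hcoll := card_sq_le_card_mul_card_collisions (s := Ω) (t := univ)
    (f := fun ω => (t ω, f (ω, (t ω).1), f (ω, (t ω).2.1), f (ω, (t ω).2.2))) fun _ _ => mem_univ _
  have hle : #{p ∈ Ω ×ˢ Ω | (t p.1, f (p.1, (t p.1).1), f (p.1, (t p.1).2.1), f (p.1, (t p.1).2.2)) =
      (t p.2, f (p.2, (t p.2).1), f (p.2, (t p.2).2.1), f (p.2, (t p.2).2.2))} ≤
      2 * #{p : ι × ι | φ p.1 = φ p.2} := by
    rw [two_mul]
    refine (card_le_card (t := ({p | φ p.1 * (φ p.2)⁻¹ = 1} : Finset (ι × ι)) ∪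
      ({p | φ p.1 * (φ p.2)⁻¹ = -1} : Finset (ι × ι))) ?_).trans
      ((card_union_le _ _).trans (add_le_add (card_quotient_le_card_collisions φ 1)
      (card_quotient_le_card_collisions φ (-1))))
    rintro ⟨a, b⟩ hp
    obtain ⟨hp1, hp2⟩ := mem_filter.1 hp
    obtain ⟨ha, hb⟩ := mem_product.1 hp1
    simp only [Prod.mk.injEq] at ha hb hp2
    obtain ⟨ht', hf1, hf2, hf3⟩ := hp2
    obtain ⟨a1, a2, a3, c1, c2, c3⟩ := ht a ha
    obtain ⟨b1, b2, b3, -⟩ := ht b hb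
    have e1 := hmove b _ b1
    have e2 := hmove b _ b2
    have e3 := hmove b _ b3
    rw [← hf1, ← ht'] at e1
    rw [← hf2, ← ht'] at e2
    rw [← hf3, ← ht'] at e3
    have := sl2_mul_inv_eq_one_or_neg_one c1 c2 c3 (hv _) (hv _) (hv _) (hmove a _ a1)
      (hmove a _ a2) (hmove a _ a3) e1 e2 e3
    simpa using this
  have hΩ' : c * Fintype.card ι ≤ 2 * #Ω := by
    have h1 : #s = ∑ ω, #(N ω) := by
      rw [card_eq_sum_card_fiberwise (f := Prod.fst) (t := univ) fun _ _ => mem_coe.2 (mem_univ _)]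
      refine sum_congr rfl fun ω _ => ?_
      refine card_bij (fun p _ => p.2) ?_ ?_ ?_
      · rintro ⟨ω', k⟩ hp
        obtain ⟨hp1, rfl⟩ := mem_filter.1 hp
        exact mem_filter.2 ⟨mem_univ _, hp1⟩
      · exact fun p hp p' hp' hpp =>
          Prod.ext ((mem_filter.1 hp).2.trans (mem_filter.1 hp').2.symm) hpp
      · intro i hi
        exact ⟨(ω, i), mem_filter.2 ⟨(mem_filter.1 hi).2, rfl⟩, rfl⟩
    have h2 : (#s : ℝ) ≤ #Ω * Fintype.card 𝒳 + Fintype.card ι * (2 * η * Fintype.card 𝒳) := by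
      have hη0 : 0 ≤ 2 * η * Fintype.card 𝒳 := by
        have := hx ⊥ (by simp) ∅ (by simp)
        rw [card_empty, Nat.cast_zero] at this
        linarith
      rw [h1, Nat.cast_sum, ← sum_filter_add_sum_filter_not univ (· ∈ Ω)]
      refine add_le_add ?_ ?_
      · rw [filter_univ_mem, ← nsmul_eq_mul]
        exact sum_le_card_nsmul _ _ _ fun ω _ => by exact_mod_cast card_le_univ _
      · refine (sum_le_card_nsmul _ _ (2 * η * Fintype.card 𝒳) fun ω hω => ?_).trans ?_
        · by_contra! hcon
          exact (mem_filter.1 hω).2 (mem_filter.2 ⟨mem_univ _, hcon⟩)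
        · rw [nsmul_eq_mul]
          exact mul_le_mul_of_nonneg_right (by exact_mod_cast card_le_univ _) hη0
    have h3 := h.trans h2
    generalize (#Ω : ℝ) = o at *
    generalize (Fintype.card ι : ℝ) = I at *
    generalize (Fintype.card 𝒳 : ℝ) = n at *
    have h4 : 2 * η * I ≤ c / 2 * I := mul_le_mul_of_nonneg_right (by linarith) hI.le
    have h5 : c * I * n ≤ (o + 2 * η * I) * n := h3.trans (le_of_eq (by ring))
    have h6 := le_of_mul_le_mul_right h5 (by linarith)
    linarith
  have hfin : (#Ω : ℝ) ^ 2 ≤ Fintype.card 𝒳 ^ 6 * (2 * #{p : ι × ι | φ p.1 = φ p.2}) := by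
    have h1 := hcoll.trans (Nat.mul_le_mul_left _ hle)
    have h2 : #(univ : Finset ((𝒳 × 𝒳 × 𝒳) × 𝒳 × 𝒳 × 𝒳)) = Fintype.card 𝒳 ^ 6 := by
      simp only [card_univ, Fintype.card_prod]
      ring
    rw [h2] at h1
    exact_mod_cast h1
  generalize (#{p : ι × ι | φ p.1 = φ p.2} : ℝ) = P at *
  clear hcoll hle
  generalize (#Ω : ℝ) = o at *
  generalize (Fintype.card ι : ℝ) = I at *
  generalize (Fintype.card 𝒳 : ℝ) = n at *
  have h1 : (c * I) ^ 2 ≤ (2 * o) ^ 2 := pow_le_pow_left₀ (by positivity) hΩ' 2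
  have h2 : n ^ 2 * (c * I) ^ 2 ≤ 8 * I ^ 2 := by
    calc n ^ 2 * (c * I) ^ 2 ≤ n ^ 2 * (4 * (n ^ 6 * (2 * P))) :=
          mul_le_mul_of_nonneg_left (by linarith) (by positivity)
      _ = 8 * (n ^ 8 * P) := by ring
      _ ≤ 8 * I ^ 2 := by linarith
  have h3 : n ^ 2 * c ^ 2 ≤ 8 := by
    refine le_of_mul_le_mul_right (le_trans (le_of_eq ?_) h2) (by positivity : 0 < I ^ 2)
    ring
  have h4 : c ^ 2 * n ≤ n ^ 2 * c ^ 2 := by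
    have : 0 ≤ c ^ 2 * n * (n - 1) := mul_nonneg (by positivity) (by linarith)
    linarith
  linarith

end Endgame

section Iteration

open Finset

variable {F : Type u} [Field F]

theorem sl2_mul_mul_eq_iff (g h : SL2 F) (m y : Matrix (Fin 2) (Fin 2) F) :
    g.1 * m * h.1 = y ↔ m = (g⁻¹).1 * y * (h⁻¹).1 := by
  have h1 : ∀ k : SL2 F, k.1 * (k⁻¹).1 = 1 := fun k => by
    rw [← Matrix.SpecialLinearGroup.coe_mul, mul_inv_cancel, Matrix.SpecialLinearGroup.coe_one]
  have h2 : ∀ k : SL2 F, (k⁻¹).1 * k.1 = 1 := fun k => by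
    rw [← Matrix.SpecialLinearGroup.coe_mul, inv_mul_cancel, Matrix.SpecialLinearGroup.coe_one]
  constructor
  · rintro rfl
    rw [mul_assoc, mul_assoc, h1, mul_one, ← mul_assoc, h2, one_mul]
  · rintro rfl
    rw [mul_assoc, mul_assoc, h2, mul_one, ← mul_assoc, h1, one_mul]

theorem eq_smul_of_mul_mul_eq_smul {g h : SL2 F} {m m' y : Matrix (Fin 2) (Fin 2) F} {a b : F}
    (hb : b ≠ 0) (h1 : g.1 * m * h.1 = a • y) (h2 : g.1 * m' * h.1 = b • y) :
    m = (a / b) • m' := by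
  rw [sl2_mul_mul_eq_iff] at h1 h2
  rw [h1, h2]
  simp only [Matrix.mul_smul, Matrix.smul_mul, smul_smul]
  rw [div_mul_cancel₀ _ hb]

theorem eq_smul_of_adjugate_eq_smul {m m' : Matrix (Fin 2) (Fin 2) F} {a : F}
    (h : m.adjugate = a • m'.adjugate) : m = a • m' := by
  rw [Matrix.adjugate_fin_two, Matrix.adjugate_fin_two] at h
  have e00 := congrFun (congrFun h 0) 0
  have e01 := congrFun (congrFun h 0) 1
  have e10 := congrFun (congrFun h 1) 0
  have e11 := congrFun (congrFun h 1) 1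
  simp at e00 e01 e10 e11
  ext i j
  fin_cases i <;> fin_cases j <;> simp [*]

theorem false_of_rich_triples [DecidableEq F] [IsAlgClosed F] (hF : (2 : F) ≠ 0) {T : ℕ}
    (hT : ∀ k : ℕ, 0 < k → k ≤ T → (k : F) ≠ 0) {𝒳 𝒮 : Type u} [Fintype 𝒳] [DecidableEq 𝒳]
    [Fintype 𝒮] [DecidableEq 𝒮] [Nonempty 𝒮] {x : 𝒳 → Matrix (Fin 2) (Fin 2) F} {σ : 𝒮 → SL2 F}
    {η c K : ℝ} (hx0 : ∀ i, x i ≠ 0) (hxd : ∀ i, (x i).det = 0) (hx : SpreadOut x η)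
    (hxinj : ∀ i k (a : F), x i = a • x k → i = k) (hσ : SpreadOut (fun j => (σ j).1) η)
    (s : Finset (𝒮 × 𝒳))
    (hs : ∀ p ∈ s, ∃ i', ∃ a : F, a ≠ 0 ∧
      (σ p.1).1 * (x p.2).adjugate * (σ p.1).1 = a • x i')
    (h : c * Fintype.card 𝒮 * Fintype.card 𝒳 ≤ #s) (hc0 : 0 ≤ c) (hc1 : c ≤ 1) (hK : 2 ≤ K)
    {C J : ℕ} (hC : 12000000 ≤ C) (hηK : η * K ^ C < 1)
    (hTn : (K ^ 20000 * (Fintype.card 𝒳 : ℝ) ^ 8) ^ 4 ≤ T)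
    (hJ : (Fintype.card 𝒳 : ℝ) ^ 8 ≤ K ^ J) (hηc : 4 * η ≤ c ^ 2 ^ (J + 1))
    (hc : 8 < (c ^ 2 ^ (J + 1)) ^ 2 * Fintype.card 𝒳) : False := by
  have key : ∀ j ≤ J, ∃ (ι : Type u) (_ : Fintype ι) (_ : DecidableEq ι) (_ : Nonempty ι)
      (φ ψ : ι → SL2 F), SpreadOut (fun ω => (φ ω).1) η ∧
      (∃ s : Finset (ι × 𝒳),
        (∀ p ∈ s, ∃ i', ∃ a : F, a ≠ 0 ∧ (φ p.1).1 * x p.2 * (ψ p.1).1 = a • x i') ∧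
        c ^ 2 ^ (j + 1) * Fintype.card ι * Fintype.card 𝒳 ≤ #s) ∧
      K ^ j * #{p : ι × ι | φ p.1 = φ p.2} ≤ (Fintype.card ι : ℝ) ^ 2 := by
    intro j
    induction j with
    | zero =>
      intro _
      refine ⟨𝒮 × 𝒮, inferInstance, inferInstance, inferInstance, fun p => σ p.1 * (σ p.2)⁻¹,
        fun p => (σ p.2)⁻¹ * σ p.1, hσ.mul_inv, ?_, ?_⟩
      · rw [zero_add, pow_one]
        refine rich_step (fun j i i' => ∃ a : F, a ≠ 0 ∧
          (σ j).1 * (x i).adjugate * (σ j).1 = a • x i') ?_ (fun p i i' => ∃ a : F, a ≠ 0 ∧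
            (σ p.1 * (σ p.2)⁻¹).1 * x i * ((σ p.2)⁻¹ * σ p.1).1 = a • x i') ?_ hc0 s hs h
        · rintro ω i k i' ⟨a, ha, h1⟩ ⟨b, hb, h2⟩
          exact hxinj i k _ (eq_smul_of_adjugate_eq_smul (eq_smul_of_mul_mul_eq_smul hb h1 h2))
        · rintro a b i i' i'' ⟨y, hy, h1⟩ ⟨z, hz, h2⟩
          refine ⟨y / z, div_ne_zero hy hz, ?_⟩
          rw [sl2_mul_mul_eq_iff] at h2
          rw [h2] at h1
          rw [← smul_right_inj hz, smul_smul, mul_div_cancel₀ _ hz, ← h1]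
          simp only [Matrix.mul_smul, Matrix.smul_mul, Matrix.SpecialLinearGroup.coe_mul, mul_assoc]
      · rw [pow_zero, one_mul]
        refine (Nat.cast_le.2 (card_le_univ _)).trans (le_of_eq ?_)
        rw [Fintype.card_prod]
        push_cast
        ring
    | succ j ih =>
      intro hj
      obtain ⟨ι, _, _, _, φ, ψ, h1, ⟨s', hs', hcs⟩, h3⟩ := ih (by omega)
      refine ⟨ι × ι, inferInstance, inferInstance, inferInstance, fun p => φ p.1 * (φ p.2)⁻¹,
        fun p => (ψ p.2)⁻¹ * ψ p.1, h1.mul_inv, ?_, ?_⟩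
      · rw [pow_succ 2 (j + 1), pow_mul]
        refine rich_step (fun j i i' => ∃ a : F, a ≠ 0 ∧
          (φ j).1 * x i * (ψ j).1 = a • x i') ?_ (fun p i i' => ∃ a : F, a ≠ 0 ∧
            (φ p.1 * (φ p.2)⁻¹).1 * x i * ((ψ p.2)⁻¹ * ψ p.1).1 = a • x i') ?_ (pow_nonneg hc0 _) s' hs' hcs
        · rintro ω i k i' ⟨a, ha, h1⟩ ⟨b, hb, h2⟩
          exact hxinj i k _ (eq_smul_of_mul_mul_eq_smul hb h1 h2)
        · rintro a b i i' i'' ⟨y, hy, h1⟩ ⟨z, hz, h2⟩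
          refine ⟨y / z, div_ne_zero hy hz, ?_⟩
          rw [sl2_mul_mul_eq_iff] at h2
          rw [h2] at h1
          rw [← smul_right_inj hz, smul_smul, mul_div_cancel₀ _ hz, ← h1]
          simp only [Matrix.mul_smul, Matrix.smul_mul, Matrix.SpecialLinearGroup.coe_mul, mul_assoc]
      · by_contra! hcon
        have hcc : c ^ 2 ^ (J + 1) ≤ c ^ 2 ^ (j + 1) :=
          pow_le_pow_of_le_one hc0 hc1 (Nat.pow_le_pow_right (by norm_num) (by omega))
        rcases le_total ((Fintype.card 𝒳 : ℝ) ^ 8 * #{p : ι × ι | φ p.1 = φ p.2})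
          ((Fintype.card ι : ℝ) ^ 2) with hle | hle
        · refine false_of_rich_of_few_collisions hx0 hxd hx φ ψ s' hs' hcs (pow_nonneg hc0 _)
            (hηc.trans hcc) (hc.trans_le ?_) hle
          exact mul_le_mul_of_nonneg_right (pow_le_pow_left₀ (pow_nonneg hc0 _) hcc 2)
            (Nat.cast_nonneg _)
        · refine absurd (one_le_mul_pow_of_collisions hF hT φ hK h1 ?_ hle hTn hC) (not_le.2 hηK)
          rw [Fintype.card_prod] at hcon
          push_cast at hcon
          have hKj : 0 < K ^ j := pow_pos (by linarith) j
          generalize (#{p : ι × ι | φ p.1 = φ p.2} : ℝ) = P at *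
          generalize (#{p : (ι × ι) × (ι × ι) | φ p.1.1 * (φ p.1.2)⁻¹ = φ p.2.1 * (φ p.2.2)⁻¹} : ℝ) =
            Q at *
          generalize (Fintype.card ι : ℝ) = I at *
          refine le_of_mul_le_mul_left ?_ hKj
          have h4 : I ^ 2 * (K ^ j * P) ≤ I ^ 2 * I ^ 2 := mul_le_mul_of_nonneg_left h3 (sq_nonneg I)
          rw [pow_succ K] at hcon
          linarith
  obtain ⟨ι, _, _, _, φ, ψ, -, ⟨s', hs', hcs⟩, h3⟩ := key J le_rfl
  refine false_of_rich_of_few_collisions hx0 hxd hx φ ψ s' hs' hcs (pow_nonneg hc0 _) hηc hc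
    (le_trans (mul_le_mul_of_nonneg_right hJ (Nat.cast_nonneg _)) h3)

end Iteration

section ExtensionOfScalars

variable {K : Type u} [Field K]

theorem LinearIndependent.algebraMap_comp {F ι n : Type*} [Field F] [Algebra K F] {v : ι → n → K}
    (h : LinearIndependent K v) : LinearIndependent F fun i j => algebraMap K F (v i j) := by
  rw [linearIndependent_iff'] at h ⊢
  intro s g hg i hi
  rw [← Module.forall_dual_apply_eq_zero_iff K]
  intro f
  refine h s (fun i => f (g i)) ?_ i hi
  ext j
  have hj := congrArg f (congrFun hg j)
  simp only [Finset.sum_apply, Pi.smul_apply, smul_eq_mul, Pi.zero_apply, map_zero, map_sum] at hj ⊢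
  rw [← hj]
  refine Finset.sum_congr rfl fun k _ => ?_
  rw [mul_comm (g k), ← Algebra.smul_def, map_smul, smul_eq_mul, mul_comm]

theorem exists_finrank_eq_of_le {V : Type*} [AddCommGroup V] [Module K V] [FiniteDimensional K V]
    (U : Submodule K V) {k : ℕ} (hU : finrank K U ≤ k) (hk : k ≤ finrank K V) :
    ∃ U' : Submodule K V, U ≤ U' ∧ finrank K U' = k := by
  induction k, hU using Nat.le_induction with
  | base => exact ⟨U, le_rfl, rfl⟩
  | succ k _ ih =>
    obtain ⟨U', h1, h2⟩ := ih (by omega)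
    have hne : U' ≠ ⊤ := by
      rintro rfl
      rw [finrank_top] at h2
      omega
    obtain ⟨v, -, hv⟩ := SetLike.exists_of_lt (lt_top_iff_ne_top.2 hne)
    refine ⟨U' ⊔ K ∙ v, h1.trans le_sup_left, le_antisymm ?_ ?_⟩
    · have h3 := Submodule.finrank_add_le_finrank_add_finrank U' (K ∙ v)
      have h4 := finrank_span_singleton (K := K) (v := v) fun h => hv (h ▸ U'.zero_mem)
      omega
    · rw [← h2]
      refine Submodule.finrank_lt_finrank_of_lt (lt_of_le_of_ne le_sup_left fun h => hv ?_)
      rw [h]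
      exact Submodule.mem_sup_right (Submodule.mem_span_singleton_self v)

/-- The rational points of a two-dimensional subspace over an extension lie in a
two-dimensional subspace. -/
theorem exists_finrank_eq_two_of_algebraMap_mem {F : Type*} [Field F] [Algebra K F]
    (W : Submodule F (Fin 4 → F)) (hW : finrank F W ≤ 2) :
    ∃ U : Submodule K (Fin 4 → K), finrank K U = 2 ∧
      ∀ v : Fin 4 → K, (fun i => algebraMap K F (v i)) ∈ W → v ∈ U := by
  have h : ∃ U : Submodule K (Fin 4 → K), finrank K U ≤ 2 ∧
      ∀ v : Fin 4 → K, (fun i => algebraMap K F (v i)) ∈ W → v ∈ U := by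
    refine ⟨(W.restrictScalars K).comap ((Algebra.linearMap K F).compLeft (Fin 4)), ?_,
      fun v hv => hv⟩
    set U := (W.restrictScalars K).comap ((Algebra.linearMap K F).compLeft (Fin 4))
    have hb := ((finBasis K U).linearIndependent.map' U.subtype U.ker_subtype).algebraMap_comp
      (F := F)
    have hm : ∀ i, (fun j => algebraMap K F ((U.subtype ∘ finBasis K U) i j)) ∈ W :=
      fun i => (finBasis K U i).2
    have hb' : LinearIndependent F fun i => (⟨_, hm i⟩ : W) :=
      LinearIndependent.of_comp W.subtype hb
    simpa using hb'.fintype_card_le_finrank.trans hW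
  obtain ⟨U, hU, hm⟩ := h
  obtain ⟨U', h1, h2⟩ := exists_finrank_eq_of_le U hU (by simp)
  exact ⟨U', h2, fun v hv => h1 (hm v hv)⟩

/-- Over an algebraically closed field, every nondegenerate quadratic form in four variables is
equivalent to the determinant. -/
theorem exists_linearMap_det_eq {F : Type u} [Field F] [IsAlgClosed F] (hF : (2 : F) ≠ 0)
    (B : Matrix (Fin 4) (Fin 4) F) (hB : B.IsSymm) (hu : IsUnit B) :
    ∃ Φ : (Fin 4 → F) →ₗ[F] Matrix (Fin 2) (Fin 2) F, Function.Injective Φ ∧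
      ∀ v, (Φ v).det = v ⬝ᵥ (B *ᵥ v) := by
  let _ : Invertible (2 : F) := invertibleOfNonzero hF
  have hsep : ∀ A : Matrix (Fin 4) (Fin 4) F, A.IsSymm → IsUnit A →
      (QuadraticMap.associated A.toQuadraticForm').SeparatingLeft := by
    intro A hA hu
    have h1 : QuadraticMap.associated A.toQuadraticForm' = Matrix.toLinearMap₂' F A := by
      refine QuadraticMap.associated_left_inverse F fun x y => ?_
      rw [Matrix.toLinearMap₂'_apply', Matrix.toLinearMap₂'_apply', dotProduct_mulVec,
        dotProduct_comm, ← mulVec_transpose, hA.eq]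
    rw [h1, Matrix.separatingLeft_toLinearMap₂'_iff, Matrix.separatingLeft_iff_det_ne_zero]
    exact ((Matrix.isUnit_iff_isUnit_det A).1 hu).ne_zero
  set D : Matrix (Fin 4) (Fin 4) F :=
    !![0, 0, 0, 2⁻¹; 0, 0, -2⁻¹, 0; 0, -2⁻¹, 0, 0; 2⁻¹, 0, 0, 0] with hD
  have hDs : D.IsSymm := by
    ext i j
    fin_cases i <;> fin_cases j <;> rfl
  have hDu : IsUnit D := by
    refine IsUnit.of_mul_eq_one ((4 : F) • D) ?_
    ext i j
    fin_cases i <;> fin_cases j <;>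
      simp [hD, Matrix.mul_apply, Fin.sum_univ_four] <;> field_simp <;> norm_num
  obtain ⟨e⟩ := QuadraticForm.equivalent_of_isAlgClosed B.toQuadraticForm' D.toQuadraticForm'
    (hsep B hB hu) (hsep D hDs hDu)
  set Ψ : (Fin 4 → F) →ₗ[F] Matrix (Fin 2) (Fin 2) F :=
    { toFun := fun v => !![v 0, v 1; v 2, v 3]
      map_add' := fun v w => by ext i j; fin_cases i <;> fin_cases j <;> rfl
      map_smul' := fun a v => by ext i j; fin_cases i <;> fin_cases j <;> rfl } with hΨ
  refine ⟨Ψ.comp e.toLinearEquiv.toLinearMap, ?_, fun v => ?_⟩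
  · suffices hΨi : Function.Injective Ψ from hΨi.comp e.toLinearEquiv.injective
    intro v w h
    have h' : ∀ i j, (!![v 0, v 1; v 2, v 3] : Matrix (Fin 2) (Fin 2) F) i j =
      !![w 0, w 1; w 2, w 3] i j := fun i j => congrFun (congrFun h i) j
    ext i
    fin_cases i
    exacts [h' 0 0, h' 0 1, h' 1 0, h' 1 1]
  · have h1 := e.map_app v
    have h2 : ∀ (A : Matrix (Fin 4) (Fin 4) F) w, A.toQuadraticForm' w = w ⬝ᵥ (A *ᵥ w) :=
      fun A w => Matrix.toLinearMap₂'_apply' A w w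
    rw [h2, h2] at h1
    rw [← h1]
    change (!![e v 0, e v 1; e v 2, e v 3] : Matrix (Fin 2) (Fin 2) F).det = _
    generalize (e v : Fin 4 → F) = w
    rw [Matrix.det_fin_two_of]
    simp [hD, dotProduct, Matrix.mulVec, Fin.sum_univ_four]
    field_simp
    ring

end ExtensionOfScalars

section Parameters

/-- The choice of parameters in the iteration, as a function of the number `n` of points. -/
theorem exists_parameters {ε : ℝ} (hε : 0 < ε) (hε2 : ε ≤ 1 / 2) :
    ∃ (N : ℕ) (δ M : ℝ), 0 < N ∧ 0 < δ ∧ 2 ≤ M ∧ ∀ n : ℕ, M ≤ n →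
      ∃ (K : ℝ) (C J : ℕ), 2 ≤ K ∧ 12000000 ≤ C ∧ (n : ℝ) ^ (-ε) * K ^ C < 1 ∧
        (K ^ 20000 * (n : ℝ) ^ 8) ^ 4 ≤ (n ^ N : ℕ) ∧ (n : ℝ) ^ 8 ≤ K ^ J ∧
        4 * (n : ℝ) ^ (-ε) ≤ ((n : ℝ) ^ (-δ)) ^ 2 ^ (J + 1) ∧
        8 < (((n : ℝ) ^ (-δ)) ^ 2 ^ (J + 1)) ^ 2 * n := by
  obtain ⟨C, hC⟩ : ∃ C : ℕ, 12000000 = C := ⟨_, rfl⟩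
  obtain ⟨A, hA⟩ : ∃ A : ℕ, 20000 = A := ⟨_, rfl⟩
  have hAC : A ≤ C := by omega
  have hC0 : (0 : ℝ) < C := by exact_mod_cast (by omega : 0 < C)
  set κ : ℝ := ε / (2 * C) with hκ
  have hκ0 : 0 < κ := by positivity
  obtain ⟨J, hJ⟩ := exists_nat_ge (8 / κ)
  obtain ⟨D, hD⟩ : ∃ D : ℕ, D = 2 ^ (J + 1) := ⟨_, rfl⟩
  have hD0 : (0 : ℝ) < D := by exact_mod_cast hD ▸ (by positivity : 0 < 2 ^ (J + 1))
  set δ : ℝ := ε / (2 * D) with hδ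
  have hδ0 : 0 < δ := by positivity
  obtain ⟨M, hM⟩ : ∃ M : ℝ, 2 ≤ M ∧ 2 ≤ M ^ κ ∧ 4 ≤ M ^ (ε / 2) ∧ 8 < M ^ (1 - ε) := by
    have h1 := (tendsto_rpow_atTop hκ0).eventually_ge_atTop 2
    have h2 := (tendsto_rpow_atTop (half_pos hε)).eventually_ge_atTop 4
    have h3 := (tendsto_rpow_atTop (by linarith : 0 < 1 - ε)).eventually_gt_atTop 8
    exact ((Filter.eventually_ge_atTop 2).and (h1.and (h2.and h3))).exists
  obtain ⟨hM2, hMκ, hMε, hM1⟩ := hM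
  refine ⟨40, δ, M, by norm_num, hδ0, hM2, fun n hn => ⟨(n : ℝ) ^ κ, C, J, ?_, hC.le, ?_, ?_, ?_, ?_, ?_⟩⟩
  all_goals
    have hM0 : (0 : ℝ) ≤ M := by linarith
    have hn0 : (0 : ℝ) < n := by linarith
    have hn1 : (1 : ℝ) < n := by linarith
    have hpow : ∀ (a : ℝ) (k : ℕ), ((n : ℝ) ^ a) ^ k = (n : ℝ) ^ (a * k) := fun a k => by
      rw [Real.rpow_mul hn0.le, Real.rpow_natCast]
  · exact hMκ.trans (Real.rpow_le_rpow hM0 hn hκ0.le)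
  · rw [hpow, ← Real.rpow_add hn0]
    refine Real.rpow_lt_one_of_one_lt_of_neg hn1 ?_
    have : κ * C = ε / 2 := by rw [hκ]; field_simp
    linarith
  · have h8 : (n : ℝ) ^ 8 = (n : ℝ) ^ (8 : ℝ) := by exact_mod_cast (Real.rpow_natCast (n : ℝ) 8).symm
    have h40 : ((n ^ 40 : ℕ) : ℝ) = (n : ℝ) ^ (40 : ℝ) := by
      rw [Nat.cast_pow]
      exact_mod_cast (Real.rpow_natCast (n : ℝ) 40).symm
    rw [hA, hpow, h8, h40, ← Real.rpow_add hn0, hpow]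
    refine Real.rpow_le_rpow_of_exponent_le hn1.le ?_
    have h1 : κ * A ≤ κ * C := mul_le_mul_of_nonneg_left (by exact_mod_cast hAC) hκ0.le
    have h2 : κ * C = ε / 2 := by rw [hκ]; field_simp
    push_cast
    linarith
  · have h8 : (n : ℝ) ^ 8 = (n : ℝ) ^ (8 : ℝ) := by exact_mod_cast (Real.rpow_natCast (n : ℝ) 8).symm
    rw [hpow, h8]
    refine Real.rpow_le_rpow_of_exponent_le hn1.le ?_
    rw [div_le_iff₀ hκ0] at hJ
    linarith
  · have h1 : -δ * D = -ε + ε / 2 := by rw [hδ]; field_simp; ring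
    rw [← hD, hpow, h1, Real.rpow_add hn0, mul_comm]
    exact mul_le_mul_of_nonneg_left (hMε.trans (Real.rpow_le_rpow hM0 hn (by linarith)))
      (Real.rpow_nonneg hn0.le _)
  · have h1 : -δ * D * (2 : ℕ) = -ε := by rw [hδ]; push_cast; field_simp
    rw [← hD, hpow, hpow, h1]
    nth_rewrite 2 [← Real.rpow_one (n : ℝ)]
    rw [← Real.rpow_add hn0, neg_add_eq_sub]
    exact hM1.trans_le (Real.rpow_le_rpow hM0 hn (by linarith))

end Parameters

section Collinear

theorem mul_adjugate_mul_eq_smul {F : Type*} [CommRing F] {x y : Matrix (Fin 2) (Fin 2) F}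
    (hx : x.det = 0) (hy : y.det = 0) (a b : F) :
    (a • x + b • y) * x.adjugate * (a • x + b • y) = (b ^ 2 * (y * x.adjugate).trace) • y := by
  rw [Matrix.det_fin_two] at hx hy
  ext i j
  fin_cases i <;> fin_cases j <;>
    simp [Matrix.mul_apply, Fin.sum_univ_two, Matrix.adjugate_fin_two, Matrix.trace_fin_two]
  · linear_combination (a ^ 2 * x 0 0 + 2 * a * b * y 0 0) * hx - b ^ 2 * x 0 0 * hy
  · linear_combination (a ^ 2 * x 0 1 + 2 * a * b * y 0 1) * hx - b ^ 2 * x 0 1 * hy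
  · linear_combination (a ^ 2 * x 1 0 + 2 * a * b * y 1 0) * hx - b ^ 2 * x 1 0 * hy
  · linear_combination (a ^ 2 * x 1 1 + 2 * a * b * y 1 1) * hx - b ^ 2 * x 1 1 * hy

theorem det_smul_add_smul {F : Type*} [CommRing F] {x y : Matrix (Fin 2) (Fin 2) F}
    (hx : x.det = 0) (hy : y.det = 0) (a b : F) :
    (a • x + b • y).det = a * b * (y * x.adjugate).trace := by
  rw [Matrix.det_fin_two] at hx hy ⊢
  simp [Matrix.mul_apply, Fin.sum_univ_two, Matrix.adjugate_fin_two, Matrix.trace_fin_two]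
  linear_combination a ^ 2 * hx + b ^ 2 * hy

variable {K : Type u} [Field K]

theorem Projectivization.eq_of_rep_eq_smul {V : Type*} [AddCommGroup V] [Module K V]
    {x y : Projectivization K V} {a : K} (h : x.rep = a • y.rep) : x = y := by
  rw [← x.mk_rep, ← y.mk_rep, Projectivization.mk_eq_mk_iff']
  exact ⟨a, h.symm⟩

theorem Coll3.exists_rep_eq {x y z : Projectivization K (Fin 4 → K)} (h : Coll3 x y z)
    (hxy : x ≠ y) : ∃ a b : K, z.rep = a • x.rep + b • y.rep := by
  have h2 : finrank K ↥(x.submodule ⊔ y.submodule) = 2 := by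
    rw [← Projectivization.linearIndependent_pair_iff_ne] at hxy
    rw [x.submodule_eq, y.submodule_eq, ← Submodule.span_union, Set.singleton_union]
    have h := finrank_span_eq_card hxy
    rwa [Matrix.range_cons_cons_empty, Fintype.card_fin] at h
  have h3 : x.submodule ⊔ y.submodule = x.submodule ⊔ y.submodule ⊔ z.submodule :=
    Submodule.eq_of_le_of_finrank_le le_sup_left (by rw [h2]; exact h)
  have h4 : z.rep ∈ x.submodule ⊔ y.submodule := by
    rw [h3, z.submodule_eq]
    exact Submodule.mem_sup_right (Submodule.mem_span_singleton_self _)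
  rw [x.submodule_eq, y.submodule_eq, ← Submodule.span_union, Set.singleton_union,
    Submodule.mem_span_pair] at h4
  obtain ⟨a, b, h4⟩ := h4
  exact ⟨a, b, h4.symm⟩

theorem eq_smul_of_algebraMap_eq_smul {F n : Type*} [Field F] [Algebra K F] {v w : n → K}
    (hw : w ≠ 0) {a : F}
    (h : (fun i => algebraMap K F (v i)) = a • fun i => algebraMap K F (w i)) :
    ∃ b : K, v = b • w := by
  obtain ⟨i, hi⟩ := Function.ne_iff.1 hw
  have hi' : algebraMap K F (w i) ≠ 0 := by simpa using hi
  refine ⟨v i / w i, funext fun j => ?_⟩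
  apply (algebraMap K F).injective
  have h1 : algebraMap K F (v i) = a * algebraMap K F (w i) := congrFun h i
  have h2 : algebraMap K F (v j) = a * algebraMap K F (w j) := congrFun h j
  rw [Pi.smul_apply, smul_eq_mul, map_mul, map_div₀, h1, mul_div_cancel_right₀ _ hi', h2]

theorem natCast_ne_zero_of_le_pow {n N : ℕ} (hN : 0 < N)
    (h : ∀ p : ℕ, ringChar K = p → 0 < p → (n : ℝ) < (p : ℝ) ^ ((1 : ℝ) / N)) {k : ℕ}
    (hk : 0 < k) (hkn : k ≤ n ^ N) : (k : K) ≠ 0 := by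
  intro h0
  have hd := (ringChar.spec K k).1 h0
  have hp := Nat.pos_of_dvd_of_pos hd hk
  have h1 := pow_lt_pow_left₀ (h _ rfl hp) (Nat.cast_nonneg n) hN.ne'
  rw [← Real.rpow_natCast (_ ^ _), ← Real.rpow_mul (Nat.cast_nonneg _),
    one_div_mul_cancel (by exact_mod_cast hN.ne'), Real.rpow_one] at h1
  have h2 : n ^ N < ringChar K := by exact_mod_cast h1
  have h3 := Nat.le_of_dvd hk hd
  omega

end Collinear

section Quadric

open Finset

variable {K : Type u} [Field K]

theorem spreadOut_of_ncard_le {F : Type*} [Field F] {n : ℕ} (hn : 0 < n) {ε : ℝ}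
    {Θ : (Fin 4 → K) → Matrix (Fin 2) (Fin 2) F}
    (hΘ : ∀ W : Submodule F (Matrix (Fin 2) (Fin 2) F), finrank F W ≤ 2 →
      ∃ U : Submodule K (Fin 4 → K), finrank K U = 2 ∧ ∀ v, Θ v ∈ W → v ∈ U)
    {Y : Finset (Projectivization K (Fin 4 → K))} (hY : #Y = n)
    (hline : ∀ U : Submodule K (Fin 4 → K), finrank K U = 2 →
      ({y | y ∈ Y ∧ y.submodule ≤ U}.ncard : ℝ) ≤ (n : ℝ) ^ (1 - ε))
    {φ : Y → Matrix (Fin 2) (Fin 2) F} (hφ : ∀ W : Submodule F (Matrix (Fin 2) (Fin 2) F), ∀ y,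
      φ y ∈ W → Θ y.1.rep ∈ W) :
    SpreadOut φ ((n : ℝ) ^ (-ε)) := by
  classical
  intro W hW s hs
  obtain ⟨U, hU, hm⟩ := hΘ W hW
  have h1 : ((s.image Subtype.val : Finset (Projectivization K (Fin 4 → K))) : Set _) ⊆
      {y | y ∈ Y ∧ y.submodule ≤ U} := by
    intro y hy
    obtain ⟨⟨y, hyY⟩, hys, rfl⟩ := mem_image.1 (mem_coe.1 hy)
    refine ⟨hyY, ?_⟩
    rw [Projectivization.submodule_eq, Submodule.span_singleton_le_iff_mem]
    exact hm _ (hφ W _ (hs _ hys))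
  have h2 := Set.ncard_le_ncard h1 (Y.finite_toSet.subset fun y hy => hy.1)
  rw [Set.ncard_coe_finset, card_image_of_injective _ Subtype.val_injective] at h2
  refine (Nat.cast_le.2 h2).trans ((hline U hU).trans (le_of_eq ?_))
  rw [Fintype.card_coe, hY, Real.rpow_sub (by exact_mod_cast hn), Real.rpow_neg (by positivity),
    Real.rpow_one, div_eq_mul_inv, mul_comm]

theorem quadricOrchardStatement_of_parameters {ε δ M : ℝ} {N : ℕ} (hN : 0 < N) (hδ : 0 < δ)
    (hM : 2 ≤ M) (hpar : ∀ n : ℕ, M ≤ n →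
      ∃ (K : ℝ) (C J : ℕ), 2 ≤ K ∧ 12000000 ≤ C ∧ (n : ℝ) ^ (-ε) * K ^ C < 1 ∧
        (K ^ 20000 * (n : ℝ) ^ 8) ^ 4 ≤ (n ^ N : ℕ) ∧ (n : ℝ) ^ 8 ≤ K ^ J ∧
        4 * (n : ℝ) ^ (-ε) ≤ ((n : ℝ) ^ (-δ)) ^ 2 ^ (J + 1) ∧
        8 < (((n : ℝ) ^ (-δ)) ^ 2 ^ (J + 1)) ^ 2 * n) :
    QuadricOrchardStatement K ε N δ M := by
  classical
  intro B hB hu X S hX hS hXS hMn hp hline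
  obtain ⟨n, hn⟩ : ∃ n, n = #X := ⟨_, rfl⟩
  rw [← hn] at hXS hMn hp hline ⊢
  obtain ⟨κ, C, J, hκ, hC, h1, h2, h3, h4, h5⟩ := hpar n hMn
  have hn2 : 2 ≤ n := by exact_mod_cast hM.trans hMn
  have hn0 : (0 : ℝ) < n := by exact_mod_cast (by omega : 0 < n)
  set F := AlgebraicClosure K with hFdef
  have hT : ∀ k : ℕ, 0 < k → k ≤ n ^ N → (k : F) ≠ 0 := fun k hk hkn h =>
    natCast_ne_zero_of_le_pow hN hp hk hkn
      ((algebraMap K F).injective (by rw [map_natCast, map_zero, h]))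
  have hF : (2 : F) ≠ 0 := by
    exact_mod_cast hT 2 two_pos (hn2.trans (Nat.le_self_pow hN.ne' n))
  obtain ⟨Φ, hΦ, hΦd⟩ := exists_linearMap_det_eq hF (B.map (algebraMap K F))
    (by rw [Matrix.IsSymm, ← Matrix.transpose_map, hB.eq])
    (hu.map (algebraMap K F).mapMatrix)
  obtain ⟨Θ, hΘ⟩ : ∃ Θ : (Fin 4 → K) → Matrix (Fin 2) (Fin 2) F,
    ∀ v, Θ v = Φ fun i => algebraMap K F (v i) := ⟨_, fun _ => rfl⟩
  have hΘd : ∀ v, (Θ v).det = algebraMap K F (v ⬝ᵥ (B *ᵥ v)) := by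
    intro v
    have hv : algebraMap K F ∘ (B *ᵥ v) = B.map (algebraMap K F) *ᵥ (algebraMap K F ∘ v) :=
      funext fun i => RingHom.map_mulVec _ B v i
    rw [hΘ, hΦd, RingHom.map_dotProduct, hv]
    rfl
  have hΘc : ∀ (a b : K) v w,
      Θ (a • v + b • w) = algebraMap K F a • Θ v + algebraMap K F b • Θ w := by
    intro a b v w
    have hv : (fun i => algebraMap K F ((a • v + b • w) i)) =
        algebraMap K F a • (fun i => algebraMap K F (v i)) +
          algebraMap K F b • fun i => algebraMap K F (w i) := by
      ext i
      change algebraMap K F (a * v i + b * w i) = _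
      rw [map_add, map_mul, map_mul]
      rfl
    rw [hΘ, hΘ, hΘ, hv, map_add, map_smul, map_smul]
  have hΘi : ∀ (x y : Projectivization K (Fin 4 → K)) (a : F), Θ x.rep = a • Θ y.rep → x = y := by
    intro x y a h
    rw [hΘ, hΘ, ← map_smul] at h
    obtain ⟨b, hb⟩ := eq_smul_of_algebraMap_eq_smul y.rep_nonzero (hΦ h)
    exact Projectivization.eq_of_rep_eq_smul hb
  have hΘW : ∀ W : Submodule F (Matrix (Fin 2) (Fin 2) F), finrank F W ≤ 2 →
      ∃ U : Submodule K (Fin 4 → K), finrank K U = 2 ∧ ∀ v, Θ v ∈ W → v ∈ U := by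
    intro W hW
    have hinj : Function.Injective (Φ.submoduleComap W) :=
      fun v w h => Subtype.ext (hΦ (congrArg Subtype.val h))
    obtain ⟨U, hU, hm⟩ := exists_finrank_eq_two_of_algebraMap_mem (K := K) (W.comap Φ)
      ((LinearMap.finrank_le_finrank_of_injective hinj).trans hW)
    exact ⟨U, hU, fun v hv => hm v (by rw [Submodule.mem_comap, ← hΘ]; exact hv)⟩
  have hr : ∀ z : S, ∃ r : F, r ≠ 0 ∧ r * r = (Θ z.1.rep).det := by
    intro z
    obtain ⟨r, hr⟩ := IsAlgClosed.exists_eq_mul_self (Θ z.1.rep).det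
    refine ⟨r, ?_, hr.symm⟩
    rintro rfl
    rw [zero_mul, hΘd, map_eq_zero] at hr
    exact hS _ z.2 hr
  choose r hr0 hr using hr
  obtain ⟨σ, hσ⟩ : ∃ σ : S → SL2 F, ∀ z, (σ z).1 = (r z)⁻¹ • Θ z.1.rep := by
    refine ⟨fun z => ⟨(r z)⁻¹ • Θ z.1.rep, ?_⟩, fun _ => rfl⟩
    rw [Matrix.det_smul, ← hr, Fintype.card_fin, ← sq, ← mul_pow, inv_mul_cancel₀ (hr0 z), one_pow]
  have hXd : ∀ x ∈ X, (Θ x.rep).det = 0 := fun x hx => by rw [hΘd, hX x hx, map_zero]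
  by_contra! hcon
  set s : Finset (S × X) := {p | ∃ i' : X, ∃ a : F, a ≠ 0 ∧
    (σ p.1).1 * (Θ p.2.1.rep).adjugate * (σ p.1).1 = a • Θ i'.1.rep} with hs
  have hrel : ∀ (x y : X) (z : S), x ≠ y → Coll3 x.1 y.1 z.1 → ∃ a : F, a ≠ 0 ∧
      (σ z).1 * (Θ x.1.rep).adjugate * (σ z).1 = a • Θ y.1.rep := by
    intro x y z hxy hc
    obtain ⟨a, b, hab⟩ := hc.exists_rep_eq (Subtype.coe_injective.ne hxy)
    have hd := det_smul_add_smul (hXd x x.2) (hXd y y.2) (algebraMap K F a) (algebraMap K F b)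
    have hm := mul_adjugate_mul_eq_smul (hXd x x.2) (hXd y y.2) (algebraMap K F a)
      (algebraMap K F b)
    rw [← hΘc, ← hab] at hd hm
    have h0 : (Θ z.1.rep).det ≠ 0 := by
      rw [← hr]
      exact mul_ne_zero (hr0 z) (hr0 z)
    rw [hd] at h0
    refine ⟨(r z)⁻¹ * ((r z)⁻¹ * (algebraMap K F b ^ 2 * (Θ y.1.rep * (Θ x.1.rep).adjugate).trace)),
      mul_ne_zero (inv_ne_zero (hr0 z)) (mul_ne_zero (inv_ne_zero (hr0 z)) (mul_ne_zero
        (pow_ne_zero 2 (right_ne_zero_of_mul (left_ne_zero_of_mul h0)))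
        (right_ne_zero_of_mul h0))), ?_⟩
    rw [hσ, Matrix.smul_mul, Matrix.smul_mul, Matrix.mul_smul, hm, smul_smul, smul_smul, mul_assoc]
  have hcard : (n : ℝ) ^ (2 - δ) ≤ #s := by
    refine hcon.le.trans ?_
    have himg : #(s.image fun p => (p.1.1, p.2.1)) ≤ #s := card_image_le
    refine le_trans (Nat.cast_le.2 ?_) (Nat.cast_le.2 himg)
    rw [← Set.ncard_coe_finset]
    refine Set.ncard_le_ncard_of_injOn (fun t => (t.2.2, t.1)) ?_ ?_ (Finset.finite_toSet _)
    · rintro ⟨x, y, z⟩ ⟨hx, hy, hz, hxy, -, -, hc⟩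
      refine mem_coe.2 (mem_image.2 ⟨(⟨z, hz⟩, ⟨x, hx⟩), mem_filter.2 ⟨mem_univ _, ⟨y, hy⟩, ?_⟩, rfl⟩)
      exact hrel ⟨x, hx⟩ ⟨y, hy⟩ ⟨z, hz⟩ (fun h => hxy (congrArg Subtype.val h)) hc
    · rintro ⟨x, y, z⟩ ⟨hx, hy, hz, hxy, -, -, hc⟩ ⟨x', y', z'⟩ ⟨hx', hy', hz', hxy', -, -, hc'⟩ h
      obtain ⟨rfl, rfl⟩ := Prod.mk.inj h
      obtain ⟨a, ha, h6⟩ := hrel ⟨x, hx⟩ ⟨y, hy⟩ ⟨z, hz⟩ (fun h => hxy (congrArg Subtype.val h)) hc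
      obtain ⟨b, hb, h7⟩ :=
        hrel ⟨x, hx⟩ ⟨y', hy'⟩ ⟨z, hz⟩ (fun h => hxy' (congrArg Subtype.val h)) hc'
      rw [h6] at h7
      have h8 : y = y' := by
        refine hΘi y y' (a⁻¹ * b) ?_
        rw [mul_smul, ← h7, inv_smul_smul₀ ha]
      rw [h8]
  have hSne : Nonempty S := by
    rw [Finset.nonempty_coe_sort, ← Finset.card_pos, ← hXS]
    omega
  refine false_of_rich_triples (C := C) (J := J) (K := κ) (x := fun x : X => Θ x.1.rep) (σ := σ)
    (η := (n : ℝ) ^ (-ε)) (c := (n : ℝ) ^ (-δ)) hF hT ?_ (fun x => hXd x x.2) ?_ ?_ ?_ s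
    (fun p hp => (mem_filter.1 hp).2) ?_ (by positivity) ?_ hκ hC h1 ?_ ?_ h4 ?_
  · intro x h
    refine x.1.rep_nonzero ?_
    rw [hΘ, map_eq_zero_iff Φ hΦ] at h
    ext i
    exact (algebraMap K F).injective ((congrFun h i).trans (map_zero _).symm)
  · exact spreadOut_of_ncard_le (by omega) hΘW hn.symm (fun U hU => (hline U hU).1)
      fun W y h => h
  · exact fun x y a h => Subtype.ext (hΘi x.1 y.1 a h)
  · refine spreadOut_of_ncard_le (by omega) hΘW hXS.symm (fun U hU => (hline U hU).2) fun W z h => ?_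
    rw [hσ] at h
    exact (W.smul_mem_iff (inv_ne_zero (hr0 z))).1 h
  · rw [Fintype.card_coe, Fintype.card_coe, ← hn, ← hXS, mul_assoc]
    refine le_trans (le_of_eq ?_) hcard
    rw [sub_eq_neg_add, Real.rpow_add hn0, Real.rpow_two, sq]
  · exact Real.rpow_le_one_of_one_le_of_nonpos (by exact_mod_cast (by omega : 1 ≤ n)) (by linarith)
  · rw [Fintype.card_coe, ← hn]
    exact h2
  · rw [Fintype.card_coe, ← hn]
    exact h3
  · rw [Fintype.card_coe, ← hn]
    exact h5

theorem QuadricOrchardStatement.mono {ε ε' δ C : ℝ} {N : ℕ} (hε : ε' ≤ ε) (hC : 1 ≤ C)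
    (h : QuadricOrchardStatement K ε' N δ C) : QuadricOrchardStatement K ε N δ C := by
  intro B hB hu X S hX hS hXS hCn hp hline
  have hle : (#X : ℝ) ^ (1 - ε) ≤ (#X : ℝ) ^ (1 - ε') :=
    Real.rpow_le_rpow_of_exponent_le (hC.trans hCn) (by linarith)
  exact h B hB hu X S hX hS hXS hCn hp fun W hW =>
    ⟨(hline W hW).1.trans hle, (hline W hW).2.trans hle⟩

end Quadric

/-- For every `ε > 0` there are `N ∈ ℕ`, `δ > 0` and `C ≥ 1` such that
the quadric orchard statement holds over every finite field (uniformly) and over `ℂ`. -/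
theorem quadric_orchard :
    ∀ ε : ℝ, 0 < ε → ∃ (N : ℕ) (δ C : ℝ), 0 < N ∧ 0 < δ ∧ 1 ≤ C ∧
      ((∀ (K : Type u) [Field K] [Finite K], QuadricOrchardStatement K ε N δ C) ∧
        QuadricOrchardStatement ℂ ε N δ C) := by
  intro ε hε
  obtain ⟨N, δ, M, hN, hδ, hM, hpar⟩ :=
    exists_parameters (lt_min hε one_half_pos) (min_le_right ε (1 / 2))
  have hM1 : 1 ≤ M := by linarith
  exact ⟨N, δ, M, hN, hδ, hM1, fun K _ _ =>
    (quadricOrchardStatement_of_parameters hN hδ hM hpar).mono (min_le_left _ _) hM1,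
    (quadricOrchardStatement_of_parameters hN hδ hM hpar).mono (min_le_left _ _) hM1⟩
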